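/- arXiv:math/9903134 — 2 statements merged into one kernel-verified Lean document; each statement's English description precedes it below -/
import Mathlib

section
/- Fix γ ≥ 1. Let (M_N) be positive integers with M_N = γN + a_N where a_N = O(N^{1/3}) as N→∞, and let (d_N) be reals with d_N − (1+1/√γ)a_N = o(N^{1/3}) as N→∞. Then for each s ∈ ℝ, lim_{N→∞} ℙ[(H(M_N, N) − (1+√γ)² N − d_N) / (γ^{−1/6}(1+√γ)^{4/3} N^{1/3}) ≤ s] = F(s), where F is the Tracy–Widom distribution function. -/
open MeasureTheory Filter

/-- An up/right path from `(1,1)` to `(M,N)`: a sequence of `M+N-1` lattice sites starting at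
`(1,1)`, ending at `(M,N)`, each step increasing one coordinate by one. -/
def UpRightPath (M N : ℕ) (π : ℕ → ℕ × ℕ) : Prop :=
  π 0 = (1, 1) ∧ π (M + N - 2) = (M, N) ∧
    ∀ k, k < M + N - 2 →
      π (k + 1) = ((π k).1 + 1, (π k).2) ∨ π (k + 1) = ((π k).1, (π k).2 + 1)

/-- `H(M,N)`: the maximum over up/right paths from `(1,1)` to `(M,N)` of the sum of the
real site weights `u` along the path. -/
noncomputable def lppSupR (u : ℕ × ℕ → ℝ) (M N : ℕ) : ℝ :=
  sSup {s | ∃ π : ℕ → ℕ × ℕ, UpRightPath M N π ∧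
    s = ∑ k ∈ Finset.range (M + N - 1), u (π k)}


/-- The Airy function `Ai(x) = (1/2π) ∫_ℝ exp(i(t+is)³/3 + ix(t+is)) dt` (with `s = 1`). -/
noncomputable def Ai (x : ℝ) : ℝ :=
  (1 / (2 * Real.pi)) *
    (∫ t : ℝ, Complex.exp (Complex.I * ((t : ℂ) + Complex.I) ^ 3 / 3
        + Complex.I * (x : ℂ) * ((t : ℂ) + Complex.I))).re

/-- The Airy kernel `A(x,y) = (Ai(x)Ai′(y) − Ai′(x)Ai(y))/(x−y)`, extended continuously
to the diagonal. -/
noncomputable def airyKernel (x y : ℝ) : ℝ :=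
  if x = y then deriv Ai x ^ 2 - Ai x * deriv (deriv Ai) x
  else (Ai x * deriv Ai y - deriv Ai x * Ai y) / (x - y)

/-- The Tracy–Widom (GUE) distribution function, as a Fredholm determinant of the
Airy kernel on `L²[s,∞)`. -/
noncomputable def TW (s : ℝ) : ℝ :=
  ∑' k : ℕ, ((-1 : ℝ) ^ k / (Nat.factorial k)) *
    ∫ ξ : Fin k → ℝ in {ξ | ∀ i, s ≤ ξ i},
      Matrix.det (Matrix.of fun i j => airyKernel (ξ i) (ξ j))

section ResidueFunctions

open PowerSeries

/-- The power series `∑ yⁿ Xⁿ / n!` of `exp (y X)`. -/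
noncomputable def expSeries (y : ℝ) : PowerSeries ℝ :=
  PowerSeries.mk fun n => y ^ n / (n.factorial : ℝ)

lemma coeff_expSeries (y : ℝ) (n : ℕ) : coeff n (expSeries y) = y ^ n / (n.factorial : ℝ) := by
  simp [expSeries]

lemma expSeries_zero : expSeries 0 = 1 := by
  ext n
  rw [coeff_expSeries, coeff_one]
  rcases n with _ | n <;> simp

lemma hasDerivAt_coeff_expSeries (n : ℕ) (y : ℝ) :
    HasDerivAt (fun y => coeff n (expSeries y)) (coeff n (X * expSeries y)) y := by
  simp only [coeff_expSeries]
  rcases n with _ | n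
  · simpa using hasDerivAt_const y (1 : ℝ)
  · rw [coeff_succ_X_mul, coeff_expSeries]
    have h := (hasDerivAt_pow (n + 1) y).div_const ((n + 1).factorial : ℝ)
    refine h.congr_deriv ?_
    rw [Nat.factorial_succ]
    have : (n.factorial : ℝ) ≠ 0 := by positivity
    push_cast
    field_simp

lemma hasDerivAt_coeff_expSeries_mul (n : ℕ) (B : PowerSeries ℝ) (y : ℝ) :
    HasDerivAt (fun y => coeff n (expSeries y * B)) (coeff n (X * (expSeries y * B))) y := by
  rw [← mul_assoc, coeff_mul _ (X * expSeries y)]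
  simp only [coeff_mul _ (expSeries _)]
  exact HasDerivAt.fun_sum fun p _ => (hasDerivAt_coeff_expSeries p.1 y).mul_const _

lemma hasDerivAt_coeff_expSeries_neg_mul (n : ℕ) (B : PowerSeries ℝ) (y : ℝ) :
    HasDerivAt (fun y => coeff n (expSeries (-y) * B))
      (-coeff n (X * (expSeries (-y) * B))) y := by
  have h := (hasDerivAt_coeff_expSeries_mul n B (-y)).comp y (hasDerivAt_neg y)
  simpa [Function.comp_def] using h

lemma expSeries_mul_expSeries_neg (y : ℝ) : expSeries y * expSeries (-y) = 1 := by
  have key : ∀ n, ∀ y, coeff n (expSeries y * expSeries (-y)) = coeff n (1 : PowerSeries ℝ) := by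
    intro n
    have hd : ∀ y, HasDerivAt (fun y => coeff n (expSeries y * expSeries (-y))) 0 y := by
      intro y
      simp only [coeff_mul]
      have h : HasDerivAt (fun y => ∑ p ∈ Finset.HasAntidiagonal.antidiagonal n,
          coeff p.1 (expSeries y) * coeff p.2 (expSeries (-y)))
          (∑ p ∈ Finset.HasAntidiagonal.antidiagonal n, (coeff p.1 (X * expSeries y) * coeff p.2 (expSeries (-y))
            + coeff p.1 (expSeries y) * (-coeff p.2 (X * expSeries (-y))))) y := by
        refine HasDerivAt.fun_sum fun p _ => (hasDerivAt_coeff_expSeries p.1 y).mul ?_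
        simpa using hasDerivAt_coeff_expSeries_neg_mul p.2 1 y
      refine h.congr_deriv ?_
      rw [Finset.sum_add_distrib]
      simp only [mul_neg, Finset.sum_neg_distrib, ← coeff_mul]
      rw [mul_left_comm (expSeries y), mul_assoc, add_neg_cancel]
    intro y
    have := is_const_of_deriv_eq_zero (fun y => (hd y).differentiableAt)
      (fun y => (hd y).deriv) y 0
    simpa [expSeries_zero] using this
  ext n
  exact key n y

lemma one_add_X_mul_inv : (1 + X : PowerSeries ℝ) * (1 + X)⁻¹ = 1 :=
  PowerSeries.mul_inv_cancel _ (by simp)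

lemma X_sub_one_mul_inv : (X - 1 : PowerSeries ℝ) * (X - 1)⁻¹ = 1 :=
  PowerSeries.mul_inv_cancel _ (by simp)

/-- The residue at `0` of `exp (y z) z ^ (i - j - 1) (1 + z) ^ (-n)`. -/
noncomputable def zeroResidue (n i j : ℕ) (y : ℝ) : ℝ :=
  coeff j (expSeries y * (X ^ i * ((1 + X)⁻¹) ^ n))

/-- The residue at `-1` of `exp (y z) z ^ (i - j - 1) (1 + z) ^ (-n)`. -/
noncomputable def negOneResidue (n i j : ℕ) (y : ℝ) : ℝ :=
  Real.exp (-y) * coeff n (expSeries y * (X * ((X - 1) ^ i * ((X - 1)⁻¹) ^ (j + 1))))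

/-- The sum of the residues of `exp (y z) z ^ (i - j - 1) (1 + z) ^ (-n)`. -/
noncomputable def residueSum (n i j : ℕ) (y : ℝ) : ℝ :=
  zeroResidue n i j y + negOneResidue n i j y

lemma hasDerivAt_zeroResidue (n i j : ℕ) (y : ℝ) :
    HasDerivAt (zeroResidue n i j) (zeroResidue n (i + 1) j y) y := by
  have h := hasDerivAt_coeff_expSeries_mul j (X ^ i * ((1 + X)⁻¹) ^ n) y
  refine h.congr_deriv ?_
  rw [zeroResidue]
  congr 1
  ring

lemma hasDerivAt_negOneResidue (n i j : ℕ) (y : ℝ) :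
    HasDerivAt (negOneResidue n i j) (negOneResidue n (i + 1) j y) y := by
  have h := ((hasDerivAt_neg y).exp).mul
    (hasDerivAt_coeff_expSeries_mul n (X * ((X - 1) ^ i * ((X - 1)⁻¹) ^ (j + 1))) y)
  refine h.congr_deriv ?_
  rw [negOneResidue]
  have e : expSeries y * (X * ((X - 1) ^ (i + 1) * ((X - 1)⁻¹) ^ (j + 1)))
      = X * (expSeries y * (X * ((X - 1) ^ i * ((X - 1)⁻¹) ^ (j + 1))))
        - expSeries y * (X * ((X - 1) ^ i * ((X - 1)⁻¹) ^ (j + 1))) := by ring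
  rw [e, map_sub]
  ring

lemma hasDerivAt_residueSum (n i j : ℕ) (y : ℝ) :
    HasDerivAt (residueSum n i j) (residueSum n (i + 1) j y) y :=
  (hasDerivAt_zeroResidue n i j y).add (hasDerivAt_negOneResidue n i j y)

lemma continuous_residueSum (n i j : ℕ) : Continuous (residueSum n i j) :=
  continuous_iff_continuousAt.2 fun y => (hasDerivAt_residueSum n i j y).continuousAt

lemma zeroResidue_succ_succ (n i j : ℕ) (y : ℝ) :
    zeroResidue n (i + 1) (j + 1) y = zeroResidue n i j y := by
  have e : expSeries y * (X ^ (i + 1) * ((1 + X)⁻¹) ^ n)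
      = X * (expSeries y * (X ^ i * ((1 + X)⁻¹) ^ n)) := by ring
  rw [zeroResidue, zeroResidue, e, coeff_succ_X_mul]

lemma negOneResidue_succ_succ (n i j : ℕ) (y : ℝ) :
    negOneResidue n (i + 1) (j + 1) y = negOneResidue n i j y := by
  have e : (X - 1 : PowerSeries ℝ) ^ (i + 1) * ((X - 1)⁻¹) ^ (j + 1 + 1)
      = ((X - 1) * (X - 1)⁻¹) * ((X - 1) ^ i * ((X - 1)⁻¹) ^ (j + 1)) := by ring
  rw [negOneResidue, negOneResidue, e, X_sub_one_mul_inv, one_mul]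

lemma residueSum_succ_succ (n i j : ℕ) (y : ℝ) :
    residueSum n (i + 1) (j + 1) y = residueSum n i j y := by
  rw [residueSum, residueSum, zeroResidue_succ_succ, negOneResidue_succ_succ]

lemma zeroResidue_add (n i j : ℕ) (y : ℝ) :
    zeroResidue (n + 1) i j y + zeroResidue (n + 1) (i + 1) j y = zeroResidue n i j y := by
  have e : expSeries y * (X ^ i * ((1 + X)⁻¹) ^ (n + 1))
      + expSeries y * (X ^ (i + 1) * ((1 + X)⁻¹) ^ (n + 1))
      = ((1 + X) * (1 + X)⁻¹) * (expSeries y * (X ^ i * ((1 + X)⁻¹) ^ n)) := by ring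
  rw [zeroResidue, zeroResidue, ← map_add, e, one_add_X_mul_inv, one_mul, zeroResidue]

lemma negOneResidue_add (n i j : ℕ) (y : ℝ) :
    negOneResidue (n + 1) i j y + negOneResidue (n + 1) (i + 1) j y = negOneResidue n i j y := by
  have e : expSeries y * (X * ((X - 1) ^ i * ((X - 1)⁻¹) ^ (j + 1)))
      + expSeries y * (X * ((X - 1) ^ (i + 1) * ((X - 1)⁻¹) ^ (j + 1)))
      = X * (expSeries y * (X * ((X - 1) ^ i * ((X - 1)⁻¹) ^ (j + 1)))) := by ring
  rw [negOneResidue, negOneResidue, ← mul_add, ← map_add, e, coeff_succ_X_mul, negOneResidue]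

lemma residueSum_add (n i j : ℕ) (y : ℝ) :
    residueSum (n + 1) i j y + residueSum (n + 1) (i + 1) j y = residueSum n i j y := by
  simp only [residueSum]
  linarith [zeroResidue_add n i j y, negOneResidue_add n i j y]

lemma zeroResidue_eq_zero {n i j : ℕ} (h : j < i) (y : ℝ) : zeroResidue n i j y = 0 := by
  have e : expSeries y * (X ^ i * ((1 + X)⁻¹) ^ n) = X ^ i * (expSeries y * ((1 + X)⁻¹) ^ n) := by
    ring
  rw [zeroResidue, e, coeff_X_pow_mul', if_neg (by omega)]

lemma negOneResidue_zero (i j : ℕ) (y : ℝ) : negOneResidue 0 i j y = 0 := by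
  simp [negOneResidue]

lemma residueSum_zero_of_lt {i j : ℕ} (h : j < i) (y : ℝ) : residueSum 0 i j y = 0 := by
  rw [residueSum, zeroResidue_eq_zero h, negOneResidue_zero, add_zero]

lemma residueSum_zero_self (i : ℕ) (y : ℝ) : residueSum 0 i i y = 1 := by
  have e : expSeries y * (X ^ i * ((1 + X)⁻¹) ^ 0) = X ^ i * expSeries y := by
    ring
  rw [residueSum, negOneResidue_zero, add_zero, zeroResidue, e, coeff_X_pow_mul']
  simp [expSeries]

lemma coeff_one_add_X_inv_pow (n l : ℕ) :
    coeff l (((1 + X : PowerSeries ℝ)⁻¹) ^ (n + 1))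
      = -coeff n (((X - 1 : PowerSeries ℝ)⁻¹) ^ (l + 1)) := by
  have hR : ∀ n l, coeff (l + 1) (((1 + X : PowerSeries ℝ)⁻¹) ^ (n + 1))
      = coeff (l + 1) (((1 + X : PowerSeries ℝ)⁻¹) ^ n)
        - coeff l (((1 + X : PowerSeries ℝ)⁻¹) ^ (n + 1)) := by
    intro n l
    have e : ((1 + X : PowerSeries ℝ)⁻¹) ^ n = ((1 + X : PowerSeries ℝ)⁻¹) ^ (n + 1)
        + X * ((1 + X : PowerSeries ℝ)⁻¹) ^ (n + 1) := by
      calc ((1 + X : PowerSeries ℝ)⁻¹) ^ n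
          = ((1 + X) * (1 + X : PowerSeries ℝ)⁻¹) * ((1 + X : PowerSeries ℝ)⁻¹) ^ n := by
            rw [one_add_X_mul_inv, one_mul]
        _ = _ := by ring
    rw [e, map_add, coeff_succ_X_mul]
    ring
  have hQ : ∀ n l, coeff (n + 1) (((X - 1 : PowerSeries ℝ)⁻¹) ^ (l + 1))
      = coeff n (((X - 1 : PowerSeries ℝ)⁻¹) ^ (l + 1))
        - coeff (n + 1) (((X - 1 : PowerSeries ℝ)⁻¹) ^ l) := by
    intro n l
    have e : ((X - 1 : PowerSeries ℝ)⁻¹) ^ l = X * ((X - 1 : PowerSeries ℝ)⁻¹) ^ (l + 1)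
        - ((X - 1 : PowerSeries ℝ)⁻¹) ^ (l + 1) := by
      calc ((X - 1 : PowerSeries ℝ)⁻¹) ^ l
          = ((X - 1) * (X - 1 : PowerSeries ℝ)⁻¹) * ((X - 1 : PowerSeries ℝ)⁻¹) ^ l := by
            rw [X_sub_one_mul_inv, one_mul]
        _ = _ := by ring
    rw [e, map_sub, coeff_succ_X_mul]
    ring
  induction n generalizing l with
  | zero =>
    induction l with
    | zero => simp
    | succ l ih => rw [hR, ih]; simp [coeff_one, pow_succ]
  | succ n ih =>
    induction l with
    | zero =>
      rw [hQ, zero_add, pow_zero, coeff_one, if_neg (by omega), sub_zero]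
      have := ih 0
      simp only [zero_add] at this
      rw [← this]
      simp
    | succ l ihl => rw [hR, hQ, ih, ihl]; ring

lemma residueSum_last (n i j : ℕ) (h : i ≤ j) : residueSum (n + 1) i j 0 = 0 := by
  obtain ⟨l, rfl⟩ := Nat.exists_eq_add_of_le h
  induction i with
  | zero =>
    simp only [residueSum, zeroResidue, negOneResidue, expSeries_zero, neg_zero, Real.exp_zero,
      one_mul, pow_zero, coeff_succ_X_mul, zero_add]
    rw [coeff_one_add_X_inv_pow]
    ring
  | succ i ih => rw [Nat.add_right_comm, residueSum_succ_succ]; exact ih (by omega)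

end ResidueFunctions

section DeterminantStep

lemma hasDerivWithinAt_det {ι : Type*} [Fintype ι] [DecidableEq ι] {A : ℝ → Matrix ι ι ℝ}
    {A' : Matrix ι ι ℝ} {S : Set ℝ} {x : ℝ}
    (h : ∀ i j, HasDerivWithinAt (fun w => A w i j) (A' i j) S x) :
    HasDerivWithinAt (fun w => (A w).det)
      (∑ j, ((A x).updateCol j fun i => A' i j).det) S x := by
  simp only [Matrix.det_apply']
  rw [Finset.sum_comm]
  refine HasDerivWithinAt.fun_sum fun σ _ => ?_
  have h1 : HasDerivWithinAt (fun w => ∏ i, A w (σ i) i)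
      (∑ i, (∏ j ∈ Finset.univ.erase i, A x (σ j) j) • A' (σ i) i) S x :=
    HasDerivWithinAt.fun_finsetProd fun i _ => h (σ i) i
  refine (h1.const_mul _).congr_deriv ?_
  rw [Finset.mul_sum]
  refine Finset.sum_congr rfl fun j _ => ?_
  congr 1
  rw [← Finset.mul_prod_erase _ _ (Finset.mem_univ j), Matrix.updateCol_self, smul_eq_mul, mul_comm]
  congr 1
  refine Finset.prod_congr rfl fun i hi => ?_
  rw [Matrix.updateCol_ne (Finset.ne_of_mem_erase hi)]

/-- One step of the growth process integrated against the exponential density. -/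
lemma integral_exp_neg_mul_det_residueSum {N k : ℕ} (n : ℕ) (hk : k < N) {t a : ℝ} (hat : a ≤ t)
    (x : ℕ → ℝ) (hx : ∀ j, j < N → x j ≤ t)
    (hmono : ∀ j, k < j → j + 1 < N → x j ≤ x (j + 1)) :
    ∫ w in (0 : ℝ)..(t - a), Real.exp (-w) * Matrix.det (Matrix.of fun i j : Fin N =>
        if (j : ℕ) < k then residueSum n i j (t - x j)
        else if (j : ℕ) = k then residueSum n i j (t - (a + w))
        else residueSum (n + 1) i j (t - max (a + w) (x j)))
      = Matrix.det (Matrix.of fun i j : Fin N =>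
        if (j : ℕ) < k then residueSum n i j (t - x j)
        else if (j : ℕ) = k then residueSum (n + 1) i j (t - a)
        else residueSum (n + 1) i j (t - max a (x j))) := by
  set D : ℝ → Matrix (Fin N) (Fin N) ℝ := fun w => Matrix.of fun i j : Fin N =>
        if (j : ℕ) < k then residueSum n i j (t - x j)
        else if (j : ℕ) = k then residueSum (n + 1) i j (t - (a + w))
        else residueSum (n + 1) i j (t - max (a + w) (x j)) with hD
  set E : ℝ → Matrix (Fin N) (Fin N) ℝ := fun w => Matrix.of fun i j : Fin N =>
        if (j : ℕ) < k then residueSum n i j (t - x j)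
        else if (j : ℕ) = k then residueSum n i j (t - (a + w))
        else residueSum (n + 1) i j (t - max (a + w) (x j)) with hE
  have hcD : Continuous fun w => (D w).det := by
    refine Continuous.matrix_det (continuous_matrix fun i j => ?_)
    simp only [hD, Matrix.of_apply]
    split_ifs
    · exact continuous_const
    · exact (continuous_residueSum _ _ _).comp (by fun_prop)
    · exact (continuous_residueSum _ _ _).comp (by fun_prop)
  have hcE : Continuous fun w => (E w).det := by
    refine Continuous.matrix_det (continuous_matrix fun i j => ?_)
    simp only [hE, Matrix.of_apply]
    split_ifs
    · exact continuous_const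
    · exact (continuous_residueSum _ _ _).comp (by fun_prop)
    · exact (continuous_residueSum _ _ _).comp (by fun_prop)
  have hderiv : ∀ w, HasDerivWithinAt (fun w => -(Real.exp (-w) * (D w).det))
      (Real.exp (-w) * (E w).det) (Set.Ioi w) w := by
    intro w
    set D' : Matrix (Fin N) (Fin N) ℝ := Matrix.of fun i j : Fin N =>
      if (j : ℕ) < k then 0
      else if (j : ℕ) = k then -residueSum (n + 1) (i + 1) j (t - (a + w))
      else if x j ≤ a + w then -residueSum (n + 1) (i + 1) j (t - (a + w)) else 0 with hD'
    have haff : HasDerivAt (fun w => t - (a + w)) (-1) w := by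
      simpa using ((hasDerivAt_id w).const_add a).const_sub t
    have hent : ∀ i j, HasDerivWithinAt (fun w => D w i j) (D' i j) (Set.Ioi w) w := by
      intro i j
      have hres : HasDerivAt (fun w => residueSum (n + 1) i j (t - (a + w)))
          (-residueSum (n + 1) (i + 1) j (t - (a + w))) w := by
        have := (hasDerivAt_residueSum (n + 1) i j (t - (a + w))).comp w haff
        simpa [Function.comp_def] using this
      simp only [hD, hD', Matrix.of_apply]
      split_ifs with h1 h2 h3
      · exact hasDerivWithinAt_const _ _ _
      · exact hres.hasDerivWithinAt
      · refine hres.hasDerivWithinAt.congr (fun v hv => ?_) ?_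
        · have : w < v := hv
          rw [max_eq_left (by linarith)]
        · rw [max_eq_left h3]
      · have hev : (fun w => residueSum (n + 1) i j (t - max (a + w) (x j)))
            =ᶠ[nhds w] fun _ => residueSum (n + 1) i j (t - x j) := by
          filter_upwards [eventually_lt_nhds (show w < x j - a by linarith)] with v hv
          rw [max_eq_right (by linarith)]
        exact ((hasDerivAt_const w _).congr_of_eventuallyEq hev).hasDerivWithinAt
    have hdet := hasDerivWithinAt_det hent
    have hexp : HasDerivWithinAt (fun w : ℝ => Real.exp (-w)) (-Real.exp (-w)) (Set.Ioi w) w := by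
      simpa using ((hasDerivAt_neg w).exp).hasDerivWithinAt
    refine (hexp.mul hdet).neg.congr_deriv ?_
    have hsum : ∑ j, ((D w).updateCol j fun i => D' i j).det
        = ((D w).updateCol ⟨k, hk⟩ fun i => D' i ⟨k, hk⟩).det := by
      refine Finset.sum_eq_single _ (fun j _ hj => ?_) (by simp)
      have hjk : (j : ℕ) ≠ k := fun h => hj (Fin.ext h)
      by_cases h1 : (j : ℕ) < k
      · refine Matrix.det_eq_zero_of_column_eq_zero j fun i => ?_
        simp [hD', h1]
      by_cases h3 : x j ≤ a + w
      · have hj1 : (j : ℕ) - 1 < N := by omega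
        have hne : j ≠ ⟨(j : ℕ) - 1, hj1⟩ := by
          intro h
          have := congrArg Fin.val h
          simp at this
          omega
        have hcol : (fun i => D' i j) = (-1 : ℝ) • fun i => D w i ⟨(j : ℕ) - 1, hj1⟩ := by
          funext i
          have e1 : D' i j = -residueSum (n + 1) (i + 1) j (t - (a + w)) := by
            simp [hD', h1, hjk, h3]
          have e2 : D w i ⟨(j : ℕ) - 1, hj1⟩
              = residueSum (n + 1) i ((j : ℕ) - 1) (t - (a + w)) := by
            simp only [hD, Matrix.of_apply]
            rw [if_neg (by omega)]
            split_ifs with h4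
            · rfl
            · have := hmono ((j : ℕ) - 1) (by omega) (by omega)
              rw [Nat.sub_add_cancel (by omega)] at this
              rw [max_eq_left (this.trans h3)]
          have e3 := residueSum_succ_succ (n + 1) i ((j : ℕ) - 1) (t - (a + w))
          rw [Nat.sub_add_cancel (by omega)] at e3
          rw [Pi.smul_apply, e1, e2, e3]
          simp
        rw [hcol, Matrix.det_updateCol_smul, Matrix.det_zero_of_column_eq hne, mul_zero]
        intro i
        rw [Matrix.updateCol_self, Matrix.updateCol_ne hne.symm]
      · refine Matrix.det_eq_zero_of_column_eq_zero j fun i => ?_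
        simp [hD', h1, h3, hjk]
    rw [hsum]
    have hDk : (D w).det = ((D w).updateCol ⟨k, hk⟩ fun i => D w i ⟨k, hk⟩).det := by
      congr 1
      exact (Matrix.updateCol_eq_self _ _).symm
    have hEk : (E w).det = ((D w).updateCol ⟨k, hk⟩ fun i => E w i ⟨k, hk⟩).det := by
      congr 1
      ext i j
      by_cases hj : j = ⟨k, hk⟩
      · subst hj; rw [Matrix.updateCol_self]
      · have hjk : (j : ℕ) ≠ k := fun h => hj (Fin.ext h)
        rw [Matrix.updateCol_ne hj]
        simp [hD, hE, hjk]
    have hcol : (fun i => E w i ⟨k, hk⟩)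
        = (fun i => D w i ⟨k, hk⟩) + (-1 : ℝ) • fun i => D' i ⟨k, hk⟩ := by
      funext i
      simp only [Pi.add_apply, Pi.smul_apply, hE, hD, hD', Matrix.of_apply, lt_irrefl, if_false,
        if_true, smul_eq_mul]
      rw [← residueSum_add]
      ring
    rw [hEk, hcol, Matrix.det_updateCol_add, Matrix.det_updateCol_smul, ← hDk]
    ring
  have hint : IntervalIntegrable (fun w => Real.exp (-w) * (E w).det) volume 0 (t - a) :=
    (Continuous.mul (by fun_prop) hcE).intervalIntegrable _ _
  rw [intervalIntegral.integral_eq_sub_of_hasDeriv_right_of_le (sub_nonneg.2 hat)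
    (f := fun w => -(Real.exp (-w) * (D w).det))
    (Continuous.continuousOn (Continuous.neg (Continuous.mul (by fun_prop) hcD)))
    (fun w _ => hderiv w) hint]
  have hend : (D (t - a)).det = 0 := by
    refine Matrix.det_eq_zero_of_column_eq_zero ⟨N - 1, by omega⟩ fun i => ?_
    simp only [hD, Matrix.of_apply]
    rw [if_neg (by omega)]
    split_ifs with h
    · rw [show t - (a + (t - a)) = 0 by ring, residueSum_last _ _ _ (by omega)]
    · rw [max_eq_left (by have := hx (N - 1) (by omega); linarith),
        show t - (a + (t - a)) = 0 by ring, residueSum_last _ _ _ (by omega)]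
  rw [hend]
  simp [hD]

end DeterminantStep

section LastPassage

/-- The last passage times, computed recursively from zero boundary values. -/
noncomputable def passageTime (w : ℕ × ℕ → ℝ) : ℕ → ℕ → ℝ
  | 0, _ => 0
  | _ + 1, 0 => 0
  | m + 1, n + 1 => max (passageTime w m (n + 1)) (passageTime w (m + 1) n) + w (m + 1, n + 1)

@[simp] lemma passageTime_zero_left (w : ℕ × ℕ → ℝ) (n : ℕ) : passageTime w 0 n = 0 := by
  rw [passageTime]

@[simp] lemma passageTime_zero_right (w : ℕ × ℕ → ℝ) (m : ℕ) : passageTime w m 0 = 0 := by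
  cases m <;> rw [passageTime]

lemma passageTime_succ_succ (w : ℕ × ℕ → ℝ) (m n : ℕ) :
    passageTime w (m + 1) (n + 1)
      = max (passageTime w m (n + 1)) (passageTime w (m + 1) n) + w (m + 1, n + 1) := by
  rw [passageTime]

lemma passageTime_nonneg {w : ℕ × ℕ → ℝ} (hw : ∀ p, 0 ≤ w p) (m n : ℕ) :
    0 ≤ passageTime w m n := by
  induction m generalizing n with
  | zero => simp
  | succ m ih =>
    cases n with
    | zero => simp
    | succ n =>
      rw [passageTime_succ_succ]
      have := ih (n + 1)
      have := hw (m + 1, n + 1)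
      positivity

lemma passageTime_le_succ_right {w : ℕ × ℕ → ℝ} (hw : ∀ p, 0 ≤ w p) (m n : ℕ) :
    passageTime w m n ≤ passageTime w m (n + 1) := by
  cases m with
  | zero => simp
  | succ m =>
    rw [passageTime_succ_succ]
    have := le_max_right (passageTime w m (n + 1)) (passageTime w (m + 1) n)
    linarith [hw (m + 1, n + 1)]

lemma passageTime_congr {w w' : ℕ × ℕ → ℝ} {m n : ℕ}
    (h : ∀ i j, 1 ≤ i → i ≤ m → 1 ≤ j → j ≤ n → w (i, j) = w' (i, j)) :
    passageTime w m n = passageTime w' m n := by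
  induction m generalizing n with
  | zero => simp
  | succ m ih =>
    induction n with
    | zero => simp
    | succ n ihn =>
      rw [passageTime_succ_succ, passageTime_succ_succ,
        ih fun i j h1 h2 h3 h4 => h i j h1 (by omega) h3 h4,
        ihn fun i j h1 h2 h3 h4 => h i j h1 h2 h3 (by omega),
        h (m + 1) (n + 1) (by omega) le_rfl (by omega) le_rfl]

lemma measurable_passageTime (m n : ℕ) :
    Measurable fun w : ℕ × ℕ → ℝ => passageTime w m n := by
  induction m generalizing n with
  | zero => simp
  | succ m ih =>
    induction n with
    | zero => simp
    | succ n ihn =>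
      simp only [passageTime_succ_succ]
      exact ((ih (n + 1)).max ihn).add (measurable_pi_apply _)

lemma passageTime_add_le_of_step {w : ℕ × ℕ → ℝ} {p q : ℕ × ℕ} (hp : 1 ≤ p.1 ∧ 1 ≤ p.2)
    (h : q = (p.1 + 1, p.2) ∨ q = (p.1, p.2 + 1)) :
    passageTime w p.1 p.2 + w q ≤ passageTime w q.1 q.2 := by
  obtain ⟨a, b⟩ := p
  obtain ⟨ha, hb⟩ := hp
  dsimp only at *
  obtain ⟨a, rfl⟩ := Nat.exists_eq_add_of_le' ha
  obtain ⟨b, rfl⟩ := Nat.exists_eq_add_of_le' hb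
  rcases h with rfl | rfl
  · rw [passageTime_succ_succ _ (a + 1) b]
    gcongr
    exact le_max_left _ _
  · rw [passageTime_succ_succ _ a (b + 1)]
    gcongr
    exact le_max_right _ _

lemma exists_path_sum_eq_passageTime {w : ℕ × ℕ → ℝ} (hw : ∀ p, 0 ≤ w p) :
    ∀ l a b : ℕ, a + b = l → ∃ π : ℕ → ℕ × ℕ, UpRightPath (a + 1) (b + 1) π ∧
      passageTime w (a + 1) (b + 1) = ∑ k ∈ Finset.range (l + 1), w (π k) := by
  intro l
  induction l with
  | zero =>
    intro a b hab
    obtain ⟨rfl, rfl⟩ : a = 0 ∧ b = 0 := by omega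
    refine ⟨fun _ => (1, 1), ⟨rfl, rfl, fun k hk => by omega⟩, ?_⟩
    simp [passageTime_succ_succ]
  | succ l ih =>
    intro a b hab
    have extend : ∀ a' b', a' + b' = l → ((a + 1, b + 1) = (a' + 1 + 1, b' + 1) ∨
        (a + 1, b + 1) = (a' + 1, b' + 1 + 1)) →
        passageTime w (a + 1) (b + 1) = passageTime w (a' + 1) (b' + 1) + w (a + 1, b + 1) →
        ∃ π : ℕ → ℕ × ℕ, UpRightPath (a + 1) (b + 1) π ∧
          passageTime w (a + 1) (b + 1) = ∑ k ∈ Finset.range (l + 1 + 1), w (π k) := by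
      intro a' b' hab' hstep hval
      obtain ⟨π, ⟨h0, h1, h2⟩, hs⟩ := ih a' b' hab'
      have e : a' + 1 + (b' + 1) - 2 = l := by omega
      rw [e] at h1 h2
      refine ⟨fun k => if k ≤ l then π k else (a + 1, b + 1), ⟨by simpa using h0, ?_, ?_⟩, ?_⟩
      · dsimp only
        rw [if_neg (by omega)]
      · intro k hk
        have hkl : k ≤ l := by omega
        simp only [if_pos hkl]
        rcases Nat.lt_or_ge k l with h | h
        · rw [if_pos (by omega)]
          exact h2 k h
        · obtain rfl : k = l := by omega
          rw [if_neg (by omega), h1]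
          exact hstep
      · rw [Finset.sum_range_succ, hval, hs]
        congr 1
        · refine Finset.sum_congr rfl fun k hk => ?_
          dsimp only
          rw [if_pos (by have := Finset.mem_range.1 hk; omega)]
        · dsimp only
          rw [if_neg (by omega)]
    have hval := passageTime_succ_succ w a b
    have hn1 := passageTime_nonneg hw (a + 1) b
    have hn2 := passageTime_nonneg hw a (b + 1)
    rcases le_total (passageTime w a (b + 1)) (passageTime w (a + 1) b) with h | h
    · rw [max_eq_right h] at hval
      rcases b with _ | b
      · rw [passageTime_zero_right] at h hval
        obtain ⟨a, rfl⟩ : ∃ a', a = a' + 1 := ⟨a - 1, by omega⟩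
        refine extend a 0 (by omega) (Or.inl rfl) ?_
        rw [hval, le_antisymm h hn2]
      · exact extend a b (by omega) (Or.inr rfl) hval
    · rw [max_eq_left h] at hval
      rcases a with _ | a
      · rw [passageTime_zero_left] at h hval
        obtain ⟨b, rfl⟩ : ∃ b', b = b' + 1 := ⟨b - 1, by omega⟩
        refine extend 0 b (by omega) (Or.inr rfl) ?_
        rw [hval, le_antisymm h hn1]
      · exact extend a b (by omega) (Or.inl rfl) hval

lemma lppSupR_eq_passageTime {w : ℕ × ℕ → ℝ} (hw : ∀ p, 0 ≤ w p) {M N : ℕ} (hM : 1 ≤ M)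
    (hN : 1 ≤ N) : lppSupR w M N = passageTime w M N := by
  obtain ⟨a, rfl⟩ := Nat.exists_eq_add_of_le' hM
  obtain ⟨b, rfl⟩ := Nat.exists_eq_add_of_le' hN
  refine IsGreatest.csSup_eq ⟨?_, ?_⟩
  · obtain ⟨π, hπ, hs⟩ := exists_path_sum_eq_passageTime hw (a + b) a b rfl
    exact ⟨π, hπ, by rw [hs]; congr 2; omega⟩
  · rintro s ⟨π, ⟨h0, h1, h2⟩, rfl⟩
    have e : a + 1 + (b + 1) - 2 = a + b := by omega
    rw [e] at h1 h2
    have key : ∀ k, k ≤ a + b → (1 ≤ (π k).1 ∧ 1 ≤ (π k).2) ∧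
        ∑ l ∈ Finset.range (k + 1), w (π l) ≤ passageTime w (π k).1 (π k).2 := by
      intro k
      induction k with
      | zero =>
        intro _
        simp [h0, passageTime_succ_succ w 0 0]
      | succ k ih =>
        intro hk
        obtain ⟨hp, hle⟩ := ih (by omega)
        have hst := h2 k (by omega)
        refine ⟨?_, ?_⟩
        · rcases hst with h | h <;> rw [h] <;> dsimp only <;> omega
        · rw [Finset.sum_range_succ]
          have := passageTime_add_le_of_step (w := w) hp hst
          linarith
    have := (key (a + b) le_rfl).2
    rw [h1] at this
    rwa [show a + 1 + (b + 1) - 1 = a + b + 1 by omega]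

end LastPassage

section Exponential

open ProbabilityTheory

variable {Ω : Type*} [MeasurableSpace Ω] {μ : Measure Ω} [IsProbabilityMeasure μ]

lemma map_eq_expMeasure {V : Ω → ℝ} (hV : Measurable V) (h0 : ∀ ω, 0 ≤ V ω)
    (hexp : ∀ t, 0 ≤ t → μ {ω | V ω ≤ t} = ENNReal.ofReal (1 - Real.exp (-t))) :
    μ.map V = expMeasure 1 := by
  have := isProbabilityMeasure_expMeasure (r := 1) one_pos
  have := Measure.isProbabilityMeasure_map (μ := μ) hV.aemeasurable
  refine Measure.eq_of_cdf _ _ ?_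
  ext x
  rw [cdf_expMeasure_eq one_pos, cdf_eq_real, measureReal_def, Measure.map_apply hV measurableSet_Iic]
  split_ifs with hx
  · have : V ⁻¹' Set.Iic x = {ω | V ω ≤ x} := rfl
    rw [this, hexp x hx, ENNReal.toReal_ofReal, one_mul]
    have := Real.exp_le_one_iff.2 (neg_nonpos.2 hx)
    linarith
  · have : V ⁻¹' Set.Iic x = ∅ := by
      ext ω
      simp only [Set.mem_preimage, Set.mem_Iic, Set.mem_empty_iff_false, iff_false]
      have := h0 ω
      linarith
    simp [this]

lemma integral_expMeasure_one (f : ℝ → ℝ) :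
    ∫ v, f v ∂(expMeasure 1) = ∫ v in Set.Ioi 0, Real.exp (-v) * f v := by
  have h1 : expMeasure 1 = volume.withDensity (exponentialPDF 1) := rfl
  rw [h1, integral_withDensity_eq_integral_toReal_smul
    (f := exponentialPDF 1) (measurable_exponentialPDFReal 1).ennreal_ofReal
    (ae_of_all _ fun _ => ENNReal.ofReal_lt_top),
    ← integral_Ici_eq_integral_Ioi, ← integral_indicator measurableSet_Ici]
  congr 1
  ext v
  rw [exponentialPDF_eq]
  by_cases hv : 0 ≤ v
  · rw [if_pos hv, Set.indicator_of_mem (by exact hv), one_mul, one_mul,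
      ENNReal.toReal_ofReal (Real.exp_pos _).le, smul_eq_mul]
  · rw [if_neg hv, Set.indicator_of_notMem (by exact hv)]
    simp

lemma integral_comp_prod_of_indepFun {E : Type*} [MeasurableSpace E] {X : Ω → E} {V : Ω → ℝ}
    (hX : Measurable X) (hV : Measurable V) (hXV : IndepFun X V μ)
    (hlaw : μ.map V = expMeasure 1) {F : E × ℝ → ℝ} (hF : Measurable F) {C : ℝ}
    (hC : ∀ p, |F p| ≤ C) :
    ∫ ω, F (X ω, V ω) ∂μ = ∫ ω, (∫ v in Set.Ioi 0, Real.exp (-v) * F (X ω, v)) ∂μ := by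
  have := isProbabilityMeasure_expMeasure (r := 1) one_pos
  have := Measure.isProbabilityMeasure_map (μ := μ) hX.aemeasurable
  have hprod := (indepFun_iff_map_prod_eq_prod_map_map hX.aemeasurable hV.aemeasurable).1 hXV
  rw [hlaw] at hprod
  have hint : Integrable F ((μ.map X).prod (expMeasure 1)) :=
    Integrable.of_bound hF.aestronglyMeasurable C (ae_of_all _ hC)
  calc ∫ ω, F (X ω, V ω) ∂μ = ∫ p, F p ∂(μ.map fun ω => (X ω, V ω)) :=
        (integral_map (hX.prodMk hV).aemeasurable hF.aestronglyMeasurable).symm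
    _ = ∫ x, ∫ v, F (x, v) ∂(expMeasure 1) ∂(μ.map X) := by rw [hprod, integral_prod _ hint]
    _ = ∫ ω, ∫ v, F (X ω, v) ∂(expMeasure 1) ∂μ :=
        integral_map hX.aemeasurable hint.1.integral_prod_right'
    _ = _ := by simp only [integral_expMeasure_one]

end Exponential

section TransitionDeterminant

/-- The determinant of residue sums, with the first `k` entries of the profile already updated. -/
noncomputable def profileDet (N : ℕ) (t : ℝ) (n k : ℕ) (x : ℕ → ℝ) : ℝ :=
  open Classical in
  if ∀ j ∈ Finset.range (N + 1), 0 ≤ x j ∧ x j ≤ t then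
    Matrix.det (Matrix.of fun i j : Fin N =>
      if (j : ℕ) < k then residueSum n i j (t - x (j + 1))
      else residueSum (n + 1) i j (t - max (x k) (x (j + 1))))
  else 0

lemma measurable_profileDet (N : ℕ) (t : ℝ) (n k : ℕ) : Measurable (profileDet N t n k) := by
  unfold profileDet
  refine Measurable.ite ?_ ?_ measurable_const
  · simp only [Set.ofPred_forall]
    refine Finset.measurableSet_biInter _ fun j _ => ?_
    exact (measurableSet_le measurable_const (measurable_pi_apply j)).inter
      (measurableSet_le (measurable_pi_apply j) measurable_const)
  · refine Continuous.measurable ?_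
    refine Continuous.matrix_det (continuous_matrix fun i j => ?_)
    simp only [Matrix.of_apply]
    split_ifs
    · exact (continuous_residueSum _ _ _).comp (by fun_prop)
    · exact (continuous_residueSum _ _ _).comp (by fun_prop)

lemma exists_abs_profileDet_le (N : ℕ) (t : ℝ) (n k : ℕ) (hk : k ≤ N) :
    ∃ C, ∀ x, |profileDet N t n k x| ≤ C := by
  have h1 : ∀ n i j, ∃ B, ∀ y ∈ Set.Icc 0 t, |residueSum n i j y| ≤ B := fun n i j =>
    isCompact_Icc.exists_bound_of_continuousOn (continuous_residueSum n i j).continuousOn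
  choose B hB using h1
  set B' : ℝ := ∑ i ∈ Finset.range N, ∑ j ∈ Finset.range N, (|B n i j| + |B (n + 1) i j|) with hB'
  have h0 : ∀ i j, 0 ≤ |B n i j| + |B (n + 1) i j| := fun i j => by positivity
  have h2 : ∀ i j : Fin N, |B n i j| + |B (n + 1) i j| ≤ B' := fun i j => by
    refine le_trans ?_ (Finset.single_le_sum (f := fun i => ∑ j ∈ Finset.range N,
      (|B n i j| + |B (n + 1) i j|)) (fun i _ => Finset.sum_nonneg fun j _ => h0 i j)
      (Finset.mem_range.2 i.2))
    exact Finset.single_le_sum (f := fun j : ℕ => (|B n i j| + |B (n + 1) i j|))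
      (fun j _ => h0 i j) (Finset.mem_range.2 j.2)
  refine ⟨(Fintype.card (Fin N)).factorial • B' ^ Fintype.card (Fin N), fun x => ?_⟩
  have hB0 : 0 ≤ B' := Finset.sum_nonneg fun i _ => Finset.sum_nonneg fun j _ => h0 i j
  unfold profileDet
  split_ifs with hx
  · refine Matrix.det_le (abv := AbsoluteValue.abs) fun i j => ?_
    simp only [Matrix.of_apply, AbsoluteValue.abs_apply]
    refine le_trans ?_ (h2 i j)
    have hj := hx (j + 1) (Finset.mem_range.2 (by have := j.2; omega))
    have hk' := hx k (Finset.mem_range.2 (by omega))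
    split_ifs
    · refine (hB n i j _ ⟨by linarith, by linarith⟩).trans ?_
      have := le_abs_self (B n i j)
      have := abs_nonneg (B (n + 1) i j)
      linarith
    · have : max (x k) (x (j + 1)) ≤ t := max_le hk'.2 hj.2
      have : 0 ≤ max (x k) (x (j + 1)) := le_max_of_le_left hk'.1
      refine (hB (n + 1) i j _ ⟨by linarith, by linarith⟩).trans ?_
      have := le_abs_self (B (n + 1) i j)
      have := abs_nonneg (B n i j)
      linarith
  · simp only [abs_zero]
    positivity

lemma profileDet_succ_self (N : ℕ) (t : ℝ) (n : ℕ) {x : ℕ → ℝ} (h0 : x 0 = 0) :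
    profileDet N t (n + 1) N x = profileDet N t n 0 x := by
  unfold profileDet
  split_ifs with hx
  · congr 1
    ext i j
    have hj := hx (j + 1) (Finset.mem_range.2 (by have := j.2; omega))
    simp [h0, max_eq_right hj.1]
  · rfl

lemma integral_profileDet_update {N k : ℕ} (t : ℝ) (n : ℕ) (hk : k < N) {x : ℕ → ℝ}
    (hx : ∀ j, 0 ≤ x j) (hmono : ∀ j, k + 1 ≤ j → x j ≤ x (j + 1)) :
    ∫ w in Set.Ioi 0, Real.exp (-w) *
        profileDet N t n (k + 1) (Function.update x (k + 1) (max (x k) (x (k + 1)) + w))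
      = profileDet N t n k x := by
  set a := max (x k) (x (k + 1)) with ha
  have ha0 : 0 ≤ a := le_max_of_le_left (hx k)
  by_cases hxt : ∀ j ∈ Finset.range (N + 1), x j ≤ t
  · have hat : a ≤ t := max_le (hxt k (Finset.mem_range.2 (by omega)))
      (hxt (k + 1) (Finset.mem_range.2 (by omega)))
    have hP := integral_exp_neg_mul_det_residueSum (N := N) n hk hat (fun j => x (j + 1))
      (fun j hj => hxt _ (Finset.mem_range.2 (by omega))) (fun j hj _ => hmono (j + 1) (by omega))
    have hR : profileDet N t n k x = Matrix.det (Matrix.of fun i j : Fin N =>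
        if (j : ℕ) < k then residueSum n i j (t - x (j + 1))
        else if (j : ℕ) = k then residueSum (n + 1) i j (t - a)
        else residueSum (n + 1) i j (t - max a (x (j + 1)))) := by
      unfold profileDet
      rw [if_pos fun j hj => ⟨hx j, hxt j hj⟩]
      congr 1
      ext i j
      simp only [Matrix.of_apply]
      split_ifs with h1 h2
      · rfl
      · rw [h2]
      · have h3 : x (k + 1) ≤ x (j + 1) := by
          have h4 : ∀ l, k + 1 ≤ l → x (k + 1) ≤ x l := fun l hl => by
            induction l, hl using Nat.le_induction with
            | base => exact le_rfl
            | succ l hl ih => exact ih.trans (hmono l hl)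
          exact h4 _ (by omega)
        rw [ha, max_assoc, max_eq_right h3]
    rw [hR, ← hP, intervalIntegral.integral_of_le (by linarith), ← Set.Ioi_inter_Iic,
      ← setIntegral_indicator measurableSet_Iic]
    refine setIntegral_congr_fun measurableSet_Ioi fun w hw => ?_
    have hw : 0 < w := hw
    by_cases hwt : w ≤ t - a
    · rw [Set.indicator_of_mem (by exact hwt)]
      congr 1
      unfold profileDet
      rw [if_pos]
      · congr 1
        ext i j
        simp only [Matrix.of_apply]
        rcases lt_trichotomy (j : ℕ) k with h | h | h
        · rw [if_pos (by omega), if_pos h, Function.update_of_ne (by omega)]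
        · rw [if_pos (by omega), if_neg (by omega), if_pos h, h, Function.update_self]
        · rw [if_neg (by omega), if_neg (by omega), if_neg (by omega), Function.update_self,
            Function.update_of_ne (by omega)]
      · intro j hj
        by_cases hjk : j = k + 1
        · subst hjk
          rw [Function.update_self]
          exact ⟨by linarith, by linarith⟩
        · rw [Function.update_of_ne hjk]
          exact ⟨hx j, hxt j hj⟩
    · rw [Set.indicator_of_notMem (by exact hwt)]
      unfold profileDet
      rw [if_neg, mul_zero]
      intro h
      have := (h (k + 1) (Finset.mem_range.2 (by omega))).2
      rw [Function.update_self] at this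
      linarith
  · have hR : profileDet N t n k x = 0 := by
      unfold profileDet
      rw [if_neg]
      exact fun h => hxt fun j hj => (h j hj).2
    rw [hR]
    refine setIntegral_eq_zero_of_forall_eq_zero fun w hw => ?_
    have hw : 0 < w := hw
    unfold profileDet
    rw [if_neg, mul_zero]
    intro h
    refine hxt fun j hj => ?_
    by_cases hjk : j = k + 1
    · have := (h j hj).2
      rw [hjk, Function.update_self] at this
      have h2 := le_max_right (x k) (x (k + 1))
      rw [hjk]
      linarith
    · have := (h j hj).2
      rwa [Function.update_of_ne hjk] at this

end TransitionDeterminant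

section Distribution

open ProbabilityTheory

lemma profileDet_congr {N : ℕ} (t : ℝ) (n k : ℕ) (hk : k ≤ N) {x y : ℕ → ℝ}
    (h : ∀ j ≤ N, x j = y j) : profileDet N t n k x = profileDet N t n k y := by
  have h1 : (∀ j ∈ Finset.range (N + 1), 0 ≤ x j ∧ x j ≤ t)
      ↔ ∀ j ∈ Finset.range (N + 1), 0 ≤ y j ∧ y j ≤ t :=
    forall₂_congr fun j hj => by rw [h j (by have := Finset.mem_range.1 hj; omega)]
  unfold profileDet
  rw [h k hk]
  have h2 : ∀ j : Fin N, x (j + 1) = y (j + 1) := fun j => h _ (by omega)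
  simp only [h1, h2]
  congr

/-- The passage times to row `m + 1` in the columns up to `k`, and to row `m` beyond. -/
noncomputable def rowProfile (w : ℕ × ℕ → ℝ) (m k : ℕ) (j : ℕ) : ℝ :=
  if j ≤ k then passageTime w (m + 1) j else passageTime w m j

lemma rowProfile_succ (w : ℕ × ℕ → ℝ) (m k : ℕ) :
    rowProfile w m (k + 1) = Function.update (rowProfile w m k) (k + 1)
      (max (rowProfile w m k k) (rowProfile w m k (k + 1)) + w (m + 1, k + 1)) := by
  ext j
  rcases eq_or_ne j (k + 1) with rfl | hj
  · simp [rowProfile, passageTime_succ_succ, max_comm]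
  · rw [Function.update_of_ne hj]
    unfold rowProfile
    by_cases h : j ≤ k
    · rw [if_pos h, if_pos (by omega)]
    · rw [if_neg h, if_neg (by omega)]

lemma rowProfile_nonneg {w : ℕ × ℕ → ℝ} (hw : ∀ p, 0 ≤ w p) (m k j : ℕ) :
    0 ≤ rowProfile w m k j := by
  unfold rowProfile
  split_ifs <;> exact passageTime_nonneg hw _ _

lemma measurable_rowProfile (m k : ℕ) :
    Measurable fun w : ℕ × ℕ → ℝ => rowProfile w m k := by
  refine measurable_pi_lambda _ fun j => ?_
  unfold rowProfile
  split_ifs <;> exact measurable_passageTime _ _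

variable {Ω : Type*} [MeasurableSpace Ω] {μ : Measure Ω} [IsProbabilityMeasure μ]
  {v : ℕ × ℕ → Ω → ℝ}

lemma integral_profileDet_rowProfile_succ (hmeas : ∀ p, Measurable (v p))
    (h0 : ∀ p ω, 0 ≤ v p ω) (hindep : iIndepFun v μ) (hlaw : ∀ p, μ.map (v p) = expMeasure 1)
    {N k : ℕ} (hk : k < N) (t : ℝ) (n m : ℕ) :
    ∫ ω, profileDet N t n (k + 1) (rowProfile (fun p => v p ω) m (k + 1)) ∂μ
      = ∫ ω, profileDet N t n k (rowProfile (fun p => v p ω) m k) ∂μ := by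
  classical
  set q : ℕ × ℕ := (m + 1, k + 1) with hq
  set S : Finset (ℕ × ℕ) := (Finset.range (m + 2) ×ˢ Finset.range (N + 1)).erase q with hS
  set E : (S → ℝ) → ℕ × ℕ → ℝ := fun r p => if h : p ∈ S then r ⟨p, h⟩ else 0 with hE
  have hEm : Measurable E := by
    refine measurable_pi_lambda _ fun p => ?_
    by_cases h : p ∈ S
    · simp only [hE, h, dite_true]
      exact measurable_pi_apply _
    · simp only [hE, h, dite_false]
      exact measurable_const
  set X : Ω → ℕ → ℝ := fun ω => rowProfile (E fun p : S => v p ω) m k with hX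
  have hXm : Measurable X := (measurable_rowProfile m k).comp
    (hEm.comp (measurable_pi_lambda _ fun p => hmeas p))
  have hind : IndepFun X (v q) μ := by
    have h1 := hindep.indepFun_finset S {q} (by simp [hS]) hmeas
    exact h1.comp (φ := fun r => rowProfile (E r) m k)
      (ψ := fun r : (({q} : Finset (ℕ × ℕ)) → ℝ) => r ⟨q, Finset.mem_singleton_self q⟩)
      ((measurable_rowProfile m k).comp hEm) (measurable_pi_apply _)
  have hE0 : ∀ ω p, 0 ≤ E (fun p : S => v p ω) p := fun ω p => by
    simp only [hE]
    split_ifs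
    · exact h0 _ _
    · exact le_rfl
  have hcongr : ∀ ω, ∀ j ≤ N, rowProfile (fun p => v p ω) m k j = X ω j := by
    intro ω j hj
    have hmem : ∀ a b, a ≤ m + 1 → b ≤ N → (a, b) ≠ q →
        v (a, b) ω = E (fun p : S => v p ω) (a, b) := fun a b ha hb hab => by
      have h : (a, b) ∈ S := by
        rw [hS, Finset.mem_erase]
        exact ⟨hab, Finset.mem_product.2 ⟨Finset.mem_range.2 (by simp only; omega),
          Finset.mem_range.2 (by simp only; omega)⟩⟩
      simp only [hE, h, dite_true]
    simp only [hX, rowProfile]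
    split_ifs with hjk
    · exact passageTime_congr fun a b _ ha _ hb => hmem a b ha (by omega) (by
        rw [hq, Ne, Prod.mk.injEq]; omega)
    · exact passageTime_congr fun a b _ ha _ hb => hmem a b (by omega) (by omega) (by
        rw [hq, Ne, Prod.mk.injEq]; omega)
  set F : (ℕ → ℝ) × ℝ → ℝ := fun p => profileDet N t n (k + 1)
    (Function.update p.1 (k + 1) (max (p.1 k) (p.1 (k + 1)) + p.2)) with hF
  have hFm : Measurable F := by
    refine (measurable_profileDet _ _ _ _).comp (measurable_pi_lambda _ fun j => ?_)
    by_cases hj : j = k + 1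
    · subst hj
      simp only [Function.update_self]
      fun_prop
    · simp only [Function.update_of_ne hj]
      fun_prop
  obtain ⟨C, hC⟩ := exists_abs_profileDet_le N t n (k + 1) hk
  calc ∫ ω, profileDet N t n (k + 1) (rowProfile (fun p => v p ω) m (k + 1)) ∂μ
      = ∫ ω, F (X ω, v q ω) ∂μ := by
        refine integral_congr_ae (ae_of_all _ fun ω => ?_)
        dsimp only [hF]
        refine profileDet_congr t n (k + 1) hk fun j hj => ?_
        rw [rowProfile_succ]
        by_cases hjk : j = k + 1
        · subst hjk
          rw [Function.update_self, Function.update_self, hcongr ω k (by omega),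
            hcongr ω (k + 1) hk]
        · rw [Function.update_of_ne hjk, Function.update_of_ne hjk, hcongr ω j hj]
    _ = ∫ ω, (∫ w in Set.Ioi 0, Real.exp (-w) * F (X ω, w)) ∂μ :=
        integral_comp_prod_of_indepFun hXm (hmeas q) hind (hlaw q) hFm fun p => hC _
    _ = ∫ ω, profileDet N t n k (rowProfile (fun p => v p ω) m k) ∂μ := by
        refine integral_congr_ae (ae_of_all _ fun ω => ?_)
        refine (integral_profileDet_update t n hk (x := X ω)
          (fun j => rowProfile_nonneg (hE0 ω) m k j) fun j hj => ?_).trans ?_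
        · simp only [hX, rowProfile]
          rw [if_neg (by omega), if_neg (by omega)]
          exact passageTime_le_succ_right (hE0 ω) m j
        · exact (profileDet_congr t n k hk.le (hcongr ω)).symm

lemma integral_profileDet_rowProfile_eq (hmeas : ∀ p, Measurable (v p))
    (h0 : ∀ p ω, 0 ≤ v p ω) (hindep : iIndepFun v μ) (hlaw : ∀ p, μ.map (v p) = expMeasure 1)
    {N k : ℕ} (hk : k ≤ N) (t : ℝ) (n m : ℕ) :
    ∫ ω, profileDet N t n k (rowProfile (fun p => v p ω) m k) ∂μ
      = ∫ ω, profileDet N t n 0 (rowProfile (fun p => v p ω) m 0) ∂μ := by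
  induction k with
  | zero => rfl
  | succ k ih =>
    rw [integral_profileDet_rowProfile_succ hmeas h0 hindep hlaw (by omega), ih (by omega)]

lemma integral_profileDet_rowProfile_row (hmeas : ∀ p, Measurable (v p))
    (h0 : ∀ p ω, 0 ≤ v p ω) (hindep : iIndepFun v μ) (hlaw : ∀ p, μ.map (v p) = expMeasure 1)
    (N : ℕ) (t : ℝ) (n m : ℕ) :
    ∫ ω, profileDet N t n 0 (rowProfile (fun p => v p ω) (m + 1) 0) ∂μ
      = ∫ ω, profileDet N t (n + 1) 0 (rowProfile (fun p => v p ω) m 0) ∂μ := by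
  rw [← integral_profileDet_rowProfile_eq hmeas h0 hindep hlaw (le_refl N) t (n + 1) m]
  refine integral_congr_ae (ae_of_all _ fun ω => ?_)
  dsimp only
  rw [profileDet_succ_self]
  · refine profileDet_congr t n 0 (Nat.zero_le _) fun j hj => ?_
    unfold rowProfile
    rw [if_pos hj]
    split_ifs with h
    · obtain rfl : j = 0 := by omega
      simp
    · rfl
  · simp [rowProfile]

lemma integral_profileDet_rowProfile_zero (hmeas : ∀ p, Measurable (v p))
    (h0 : ∀ p ω, 0 ≤ v p ω) (hindep : iIndepFun v μ) (hlaw : ∀ p, μ.map (v p) = expMeasure 1)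
    (N : ℕ) (t : ℝ) (n m : ℕ) :
    ∫ ω, profileDet N t n 0 (rowProfile (fun p => v p ω) m 0) ∂μ
      = ∫ ω, profileDet N t (n + m) 0 (rowProfile (fun p => v p ω) 0 0) ∂μ := by
  induction m generalizing n with
  | zero => rfl
  | succ m ih =>
    rw [integral_profileDet_rowProfile_row hmeas h0 hindep hlaw, ih]
    congr! 3
    ring

lemma measureReal_passageTime_le (hmeas : ∀ p, Measurable (v p))
    (h0 : ∀ p ω, 0 ≤ v p ω) (hindep : iIndepFun v μ) (hlaw : ∀ p, μ.map (v p) = expMeasure 1)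
    {M N : ℕ} (hM : 1 ≤ M) {t : ℝ} (ht : 0 ≤ t) :
    μ.real {ω | passageTime (fun p => v p ω) M N ≤ t}
      = Matrix.det (Matrix.of fun i j : Fin N => residueSum M i j t) := by
  obtain ⟨m, rfl⟩ := Nat.exists_eq_add_of_le' hM
  have hS : MeasurableSet {ω | passageTime (fun p => v p ω) (m + 1) N ≤ t} :=
    measurableSet_le ((measurable_passageTime _ _).comp (measurable_pi_lambda _ hmeas))
      measurable_const
  have hdet : ∀ x : ℕ → ℝ, Matrix.det (Matrix.of fun i j : Fin N =>
      if (j : ℕ) < N then residueSum 0 i j (t - x (j + 1))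
      else residueSum 1 i j (t - max (x N) (x (j + 1)))) = 1 := by
    intro x
    rw [Matrix.det_of_isUpperTriangular]
    · refine Finset.prod_eq_one fun i _ => ?_
      rw [Matrix.of_apply, if_pos i.2, residueSum_zero_self]
    · intro i j hij
      rw [Matrix.of_apply, if_pos j.2, residueSum_zero_of_lt (by exact hij)]
  have hone : ∀ ω, profileDet N t 0 N (rowProfile (fun p => v p ω) m N)
      = Set.indicator {ω | passageTime (fun p => v p ω) (m + 1) N ≤ t} (fun _ => (1 : ℝ)) ω := by
    intro ω
    unfold profileDet
    rw [hdet]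
    have hiff : (∀ j ∈ Finset.range (N + 1), 0 ≤ rowProfile (fun p => v p ω) m N j ∧
        rowProfile (fun p => v p ω) m N j ≤ t) ↔ passageTime (fun p => v p ω) (m + 1) N ≤ t := by
      constructor
      · intro h
        have := (h N (Finset.mem_range.2 (by omega))).2
        rwa [rowProfile, if_pos le_rfl] at this
      · intro h j hj
        have hj' : j ≤ N := by have := Finset.mem_range.1 hj; omega
        refine ⟨rowProfile_nonneg (fun p => h0 p ω) _ _ _, ?_⟩
        rw [rowProfile, if_pos hj']
        exact (monotone_nat_of_le_succ (passageTime_le_succ_right (fun p => h0 p ω) (m + 1))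
          hj').trans h
    by_cases hω : passageTime (fun p => v p ω) (m + 1) N ≤ t
    · rw [if_pos (hiff.2 hω), Set.indicator_of_mem (by exact hω)]
    · rw [if_neg fun h => hω (hiff.1 h), Set.indicator_of_notMem (by exact hω)]
  rw [← integral_indicator_one hS]
  have h1 := integral_profileDet_rowProfile_eq hmeas h0 hindep hlaw (le_refl N) t 0 m
  rw [integral_profileDet_rowProfile_zero hmeas h0 hindep hlaw] at h1
  simp only [hone] at h1
  refine h1.trans ?_
  have hzero : ∀ ω, rowProfile (fun p => v p ω) 0 0 = 0 := fun ω => by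
    ext j
    unfold rowProfile
    split_ifs with h
    · obtain rfl : j = 0 := by omega
      simp
    · simp
  simp only [hzero, integral_const, probReal_univ, one_smul]
  unfold profileDet
  rw [if_pos fun j _ => ⟨le_rfl, ht⟩]
  simp

/-- The distribution function of the last passage time, as a finite determinant. -/
lemma toReal_measure_lppSupR_le {u : ℕ × ℕ → Ω → ℝ} (hmeas : ∀ p, Measurable (u p))
    (hindep : iIndepFun u μ)
    (hexp : ∀ p t, 0 ≤ t → μ {ω | u p ω ≤ t} = ENNReal.ofReal (1 - Real.exp (-t)))
    {M N : ℕ} (hM : 1 ≤ M) (hN : 1 ≤ N) {t : ℝ} (ht : 0 ≤ t) :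
    (μ {ω | lppSupR (fun p => u p ω) M N ≤ t}).toReal
      = Matrix.det (Matrix.of fun i j : Fin N => residueSum M i j t) := by
  set v : ℕ × ℕ → Ω → ℝ := fun p ω => max 0 (u p ω) with hv
  have hvm : ∀ p, Measurable (v p) := fun p => measurable_const.max (hmeas p)
  have hv0 : ∀ p ω, 0 ≤ v p ω := fun p ω => le_max_left _ _
  have hvi : iIndepFun v μ :=
    hindep.comp (g := fun _ x => max 0 x) fun _ => measurable_const.max measurable_id
  have hvl : ∀ p, μ.map (v p) = expMeasure 1 := fun p =>
    map_eq_expMeasure (hvm p) (hv0 p) fun t ht => by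
      rw [← hexp p t ht]
      congr 1
      ext ω
      simp [hv, ht]
  have hae : ∀ᵐ ω ∂μ, ∀ p, 0 ≤ u p ω := by
    refine ae_all_iff.2 fun p => ?_
    rw [ae_iff]
    refine measure_mono_null (fun ω hω => ?_) ((hexp p 0 le_rfl).trans (by simp))
    simp only [Set.mem_ofPred_eq, not_le] at hω ⊢
    exact hω.le
  rw [← measureReal_passageTime_le hvm hv0 hvi hvl hM ht, measureReal_def]
  congr 1
  refine measure_congr ?_
  filter_upwards [hae] with ω hω
  have : (fun p => v p ω) = fun p => u p ω := by
    ext p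
    exact max_eq_right (hω p)
  change (lppSupR (fun p => u p ω) M N ≤ t) = (passageTime (fun p => v p ω) M N ≤ t)
  rw [this, lppSupR_eq_passageTime hω hM hN]

end Distribution

section FredholmExpansion

lemma sum_det_submatrix_image_eq {ι : Type*} [Fintype ι] [DecidableEq ι] (G : Matrix ι ι ℝ)
    {k : ℕ} {s : Finset ι} (hs : s.card = k) :
    ∑ c : Fin k → ι with Function.Injective c ∧ Finset.univ.image c = s, (G.submatrix c c).det
      = k.factorial * (G.submatrix (Subtype.val : s → ι) (Subtype.val : s → ι)).det := by
  have e0 : Fin k ≃ s := (Fintype.equivFinOfCardEq (by simpa using hs)).symm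
  have h1 : ∑ e : Fin k ≃ s,
      (G.submatrix (fun i => (e i : ι)) (fun i => (e i : ι))).det
      = k.factorial * (G.submatrix (Subtype.val : s → ι) (Subtype.val : s → ι)).det := by
    have : ∀ e : Fin k ≃ s, (G.submatrix (fun i => (e i : ι)) (fun i => (e i : ι))).det
        = (G.submatrix (Subtype.val : s → ι) (Subtype.val : s → ι)).det := fun e =>
      Matrix.det_submatrix_equiv_self e (G.submatrix (Subtype.val : s → ι) (Subtype.val : s → ι))
    simp only [this, Finset.sum_const, Finset.card_univ, Fintype.card_equiv e0, Fintype.card_fin,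
      nsmul_eq_mul]
  rw [← h1]
  symm
  refine Finset.sum_bij (fun e _ i => (e i : ι)) ?_ ?_ ?_ ?_
  · intro e _
    refine Finset.mem_filter.2 ⟨Finset.mem_univ _, Subtype.val_injective.comp e.injective, ?_⟩
    ext x
    simp only [Finset.mem_image, Finset.mem_univ, true_and]
    constructor
    · rintro ⟨i, rfl⟩
      exact (e i).2
    · intro hx
      exact ⟨e.symm ⟨x, hx⟩, by simp⟩
  · intro e _ e' _ h
    ext i
    exact congrFun h i
  · intro c hc
    obtain ⟨hinj, himg⟩ := (Finset.mem_filter.1 hc).2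
    have hmem : ∀ i, c i ∈ s := fun i => himg ▸ Finset.mem_image_of_mem c (Finset.mem_univ i)
    refine ⟨Equiv.ofBijective (fun i => ⟨c i, hmem i⟩) ⟨fun i j h => hinj (congrArg Subtype.val h),
      fun ⟨x, hx⟩ => ?_⟩, Finset.mem_univ _, rfl⟩
    rw [← himg] at hx
    obtain ⟨i, _, hi⟩ := Finset.mem_image.1 hx
    exact ⟨i, Subtype.ext hi⟩
  · intro e _
    rfl

lemma sum_det_submatrix_eq {ι : Type*} [Fintype ι] [DecidableEq ι] (G : Matrix ι ι ℝ) (k : ℕ) :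
    ∑ c : Fin k → ι, (G.submatrix c c).det
      = k.factorial * ∑ s ∈ (Finset.univ : Finset ι).powersetCard k,
        (G.submatrix (Subtype.val : s → ι) (Subtype.val : s → ι)).det := by
  have h0 : ∑ c : Fin k → ι, (G.submatrix c c).det
      = ∑ c : Fin k → ι with Function.Injective c, (G.submatrix c c).det := by
    rw [Finset.sum_filter]
    refine Finset.sum_congr rfl fun c _ => ?_
    split_ifs with hc
    · rfl
    · simp only [Function.Injective, not_forall] at hc
      obtain ⟨i, j, hij, hne⟩ := hc
      exact Matrix.det_zero_of_row_eq hne (by ext l; simp [hij])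
  rw [h0, Finset.mul_sum, ← Finset.sum_fiberwise_of_maps_to
    (g := fun c : Fin k → ι => Finset.univ.image c) (t := Finset.univ.powersetCard k)]
  · refine Finset.sum_congr rfl fun s hs => ?_
    rw [Finset.filter_filter]
    exact sum_det_submatrix_image_eq G (Finset.mem_powersetCard.1 hs).2
  · intro c hc
    refine Finset.mem_powersetCard.2 ⟨Finset.subset_univ _, ?_⟩
    rw [Finset.card_image_of_injective _ (Finset.mem_filter.1 hc).2]
    simp

lemma hasSum_det_one_sub {ι : Type*} [Fintype ι] [DecidableEq ι] (G : Matrix ι ι ℝ) :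
    HasSum (fun k : ℕ => ((-1 : ℝ) ^ k / (Nat.factorial k)) *
      ∑ c : Fin k → ι, (G.submatrix c c).det) (1 - G).det := by
  set p : Polynomial ℝ := Matrix.det (1 + (Polynomial.X : Polynomial ℝ) • G.map Polynomial.C)
    with hp
  have hev : (1 - G).det = p.eval (-1) := by
    rw [hp, ← Polynomial.coe_evalRingHom, RingHom.map_det]
    congr 1
    ext i j
    simp [Matrix.one_apply, apply_ite, sub_eq_add_neg]
  rw [hev, Polynomial.eval_eq_sum_range]
  have hterm : ∀ k : ℕ, ((-1 : ℝ) ^ k / (Nat.factorial k)) *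
      ∑ c : Fin k → ι, (G.submatrix c c).det = p.coeff k * (-1) ^ k := fun k => by
    rw [sum_det_submatrix_eq, hp, Matrix.coeff_det_one_add_X_smul_eq_sum_minors]
    have : (k.factorial : ℝ) ≠ 0 := by positivity
    field_simp
  simp only [hterm]
  refine hasSum_sum_of_ne_finset_zero fun k hk => ?_
  rw [Polynomial.coeff_eq_zero_of_natDegree_lt, zero_mul]
  simpa using hk

/-- The integrated form of the Cauchy–Binet identity for a finite-rank kernel. -/
lemma integral_det_sum_mul {ι : Type*} [Fintype ι] [DecidableEq ι] (ν : Measure ℝ)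
    [SigmaFinite ν] (f g : ι → ℝ → ℝ) (hfg : ∀ i j, Integrable (fun x => f i x * g j x) ν)
    (k : ℕ) :
    ∫ x : Fin k → ℝ, Matrix.det (Matrix.of fun a b => ∑ i, f i (x a) * g i (x b))
        ∂(Measure.pi fun _ => ν)
      = ∑ c : Fin k → ι,
        ((Matrix.of fun i j => ∫ x, f i x * g j x ∂ν).submatrix c c).det := by
  have hexp : ∀ x : Fin k → ℝ,
      Matrix.det (Matrix.of fun a b => ∑ i, f i (x a) * g i (x b))
        = ∑ σ : Equiv.Perm (Fin k), ∑ c : Fin k → ι, (Equiv.Perm.sign σ : ℝ) *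
          ∏ a, (f (c (σ.symm a)) (x a) * g (c a) (x a)) := by
    intro x
    rw [Matrix.det_apply']
    refine Finset.sum_congr rfl fun σ _ => ?_
    rw [← Finset.mul_sum]
    congr 1
    simp only [Matrix.of_apply]
    rw [Fintype.prod_sum]
    refine Finset.sum_congr rfl fun c _ => ?_
    rw [Finset.prod_mul_distrib, Finset.prod_mul_distrib]
    congr 1
    rw [← Equiv.prod_comp σ fun a => f (c (σ.symm a)) (x a)]
    simp
  have hint : ∀ (σ : Equiv.Perm (Fin k)) (c : Fin k → ι), Integrable (fun x : Fin k → ℝ =>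
      (Equiv.Perm.sign σ : ℝ) * ∏ a, (f (c (σ.symm a)) (x a) * g (c a) (x a)))
      (Measure.pi fun _ => ν) := fun σ c =>
    (Integrable.fintype_prod (f := fun a y => f (c (σ.symm a)) y * g (c a) y)
      fun a => hfg _ _).const_mul _
  simp only [hexp]
  rw [integral_finsetSum _ fun σ _ => integrable_finsetSum _ fun c _ => hint σ c]
  simp only [integral_finsetSum _ fun c _ => hint _ c, integral_const_mul]
  rw [Finset.sum_comm]
  refine Finset.sum_congr rfl fun c _ => ?_
  rw [Matrix.det_apply']
  refine Fintype.sum_equiv (Equiv.inv _) _ _ fun σ => ?_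
  rw [integral_fintype_prod_eq_prod (f := fun a y => f (c (σ.symm a)) y * g (c a) y)]
  simp [Equiv.Perm.inv_def]

end FredholmExpansion

section PolynomialExponential

lemma tendsto_eval_mul_exp_neg (p : Polynomial ℝ) :
    Tendsto (fun y => p.eval y * Real.exp (-y)) atTop (nhds 0) := by
  simpa [Real.exp_neg, div_eq_mul_inv] using p.tendsto_div_exp_atTop

lemma integrableOn_eval_mul_exp_neg (p : Polynomial ℝ) (t : ℝ) :
    IntegrableOn (fun y => p.eval y * Real.exp (-y)) (Set.Ioi t) := by
  refine integrable_of_isBigO_exp_neg (b := 1 / 2) (by norm_num) ?_ ?_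
  · exact (p.continuous.mul (by fun_prop)).continuousOn
  · have h := (p.comp (Polynomial.C 2 * Polynomial.X)).tendsto_div_exp_atTop.comp
      (tendsto_id.const_mul_atTop (show (0 : ℝ) < 1 / 2 by norm_num))
    have h2 : (fun y => p.eval y * Real.exp (-y)) = fun y =>
        (((p.comp (Polynomial.C 2 * Polynomial.X)).eval (1 / 2 * y)) / Real.exp (1 / 2 * y))
          * Real.exp (-(1 / 2) * y) := by
      ext y
      rw [Polynomial.eval_comp, div_mul_eq_mul_div, eq_div_iff (Real.exp_ne_zero _), mul_assoc,
        ← Real.exp_add]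
      simp only [Polynomial.eval_mul, Polynomial.eval_C, Polynomial.eval_X]
      ring_nf
    rw [h2]
    have h3 := (h.isBigO_one ℝ).mul (Asymptotics.isBigO_refl (fun y => Real.exp (-(1 / 2) * y)) atTop)
    simpa [Function.comp_def] using h3

end PolynomialExponential

section ResidueMatrix

open PowerSeries

lemma exists_eval_eq_coeff_expSeries_mul (n : ℕ) (B : PowerSeries ℝ) :
    ∃ p : Polynomial ℝ, ∀ y, coeff n (expSeries y * B) = p.eval y := by
  refine ⟨∑ q ∈ Finset.HasAntidiagonal.antidiagonal n,
    Polynomial.C (coeff q.2 B / q.1.factorial) * Polynomial.X ^ q.1, fun y => ?_⟩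
  rw [coeff_mul, Polynomial.eval_finsetSum]
  refine Finset.sum_congr rfl fun q _ => ?_
  rw [coeff_expSeries]
  simp
  ring

lemma exists_eval_eq_coeff_expSeries_neg_mul (n : ℕ) (B : PowerSeries ℝ) :
    ∃ p : Polynomial ℝ, ∀ y, coeff n (expSeries (-y) * B) = p.eval y := by
  obtain ⟨p, hp⟩ := exists_eval_eq_coeff_expSeries_mul n B
  exact ⟨p.comp (-Polynomial.X), fun y => by simp [hp]⟩

lemma coeff_mul_eq_sum_fin (f B : PowerSeries ℝ) {N j : ℕ} (hj : j < N) :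
    coeff j (f * B) = ∑ k : Fin N, coeff k f * coeff j (X ^ (k : ℕ) * B) := by
  rw [coeff_mul, Finset.Nat.sum_antidiagonal_eq_sum_range_succ_mk, Fin.sum_univ_eq_sum_range
    (fun k => coeff k f * coeff j (X ^ k * B))]
  refine Finset.sum_subset_zero_on_sdiff (Finset.range_subset_range.2 hj) ?_ ?_
  · intro k hk
    have : ¬ k ≤ j := fun h => (Finset.mem_sdiff.1 hk).2 (Finset.mem_range.2 (by omega))
    rw [coeff_X_pow_mul', if_neg this, mul_zero]
  · intro k hk
    rw [coeff_X_pow_mul', if_pos (by have := Finset.mem_range.1 hk; omega)]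

/-- The entries of the inverse of the matrix of residues at `0`. -/
noncomputable def inverseEntry (M i k : ℕ) (y : ℝ) : ℝ :=
  coeff k (expSeries (-y) * (X ^ i * (1 + X) ^ M))

lemma sum_inverseEntry_mul_zeroResidue (M : ℕ) (y : ℝ) {N j : ℕ} (i : ℕ) (hj : j < N) :
    ∑ k : Fin N, inverseEntry M i k y * zeroResidue M k j y = if i = j then 1 else 0 := by
  have h := coeff_mul_eq_sum_fin (expSeries (-y) * (X ^ i * (1 + X) ^ M))
    (expSeries y * ((1 + X)⁻¹) ^ M) hj
  have e : (expSeries (-y) * (X ^ i * (1 + X) ^ M)) * (expSeries y * ((1 + X)⁻¹) ^ M)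
      = (expSeries y * expSeries (-y)) * ((1 + X) * (1 + X)⁻¹) ^ M * X ^ i := by
    rw [mul_pow]
    ring
  rw [e, expSeries_mul_expSeries_neg, one_add_X_mul_inv, one_pow, one_mul, one_mul,
    coeff_X_pow] at h
  simp only [eq_comm (a := i)]
  rw [h]
  refine Finset.sum_congr rfl fun k _ => ?_
  rw [inverseEntry, zeroResidue, mul_left_comm (expSeries y)]

lemma det_inverseEntry (M N : ℕ) (y : ℝ) :
    Matrix.det (Matrix.of fun i j : Fin N => inverseEntry M i j y) = 1 := by
  have e : ∀ i, expSeries (-y) * (X ^ i * (1 + X) ^ M) = X ^ i * (expSeries (-y) * (1 + X) ^ M) :=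
    fun i => mul_left_comm _ _ _
  rw [Matrix.det_of_isUpperTriangular]
  · refine Finset.prod_eq_one fun i _ => ?_
    rw [Matrix.of_apply, inverseEntry, e, coeff_X_pow_mul', if_pos le_rfl, Nat.sub_self]
    simp [expSeries]
  · intro i j hij
    have hij : (j : ℕ) < i := hij
    rw [Matrix.of_apply, inverseEntry, e, coeff_X_pow_mul', if_neg (by omega)]

lemma hasDerivAt_inverseEntry (M i k : ℕ) (y : ℝ) :
    HasDerivAt (inverseEntry M i k) (-inverseEntry M (i + 1) k y) y := by
  refine (hasDerivAt_coeff_expSeries_neg_mul k (X ^ i * (1 + X) ^ M) y).congr_deriv ?_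
  rw [inverseEntry, pow_succ']
  congr 2
  ring

lemma inverseEntry_succ_succ (M i k : ℕ) (y : ℝ) :
    inverseEntry M (i + 1) (k + 1) y = inverseEntry M i k y := by
  rw [inverseEntry, inverseEntry, ← coeff_succ_X_mul k]
  congr 1
  ring

lemma inverseEntry_eq_zero {M i k : ℕ} (h : k < i) (y : ℝ) : inverseEntry M i k y = 0 := by
  rw [inverseEntry, mul_left_comm, coeff_X_pow_mul', if_neg (by omega)]

lemma sum_inverseEntry_telescope (M i j : ℕ) (y : ℝ) (n : ℕ) :
    ∑ k : Fin (n + 1), (-inverseEntry M (i + 1) k y * negOneResidue M k j y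
      + inverseEntry M i k y * negOneResidue M (k + 1) j y)
      = inverseEntry M i n y * negOneResidue M (n + 1) j y := by
  rw [Fin.sum_univ_eq_sum_range (fun k => -inverseEntry M (i + 1) k y * negOneResidue M k j y
      + inverseEntry M i k y * negOneResidue M (k + 1) j y)]
  induction n with
  | zero =>
    simp [inverseEntry_eq_zero (Nat.succ_pos i)]
  | succ n ih =>
    rw [Finset.sum_range_succ, ih, inverseEntry_succ_succ]
    ring

lemma hasDerivAt_sum_inverseEntry_mul_negOneResidue (M i j : ℕ) (y : ℝ) (n : ℕ) :
    HasDerivAt (fun y => ∑ k : Fin (n + 1), inverseEntry M i k y * negOneResidue M k j y)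
      (inverseEntry M i n y * negOneResidue M (n + 1) j y) y := by
  rw [← sum_inverseEntry_telescope]
  exact HasDerivAt.fun_sum fun k _ =>
    (hasDerivAt_inverseEntry M i k y).mul (hasDerivAt_negOneResidue M k j y)

lemma exists_eval_mul_exp_neg_eq (M i k l j : ℕ) (c d : ℝ) : ∃ p : Polynomial ℝ, ∀ y,
    inverseEntry M i k (c + y) * negOneResidue M l j (d + y) = p.eval y * Real.exp (-y) := by
  obtain ⟨p, hp⟩ := exists_eval_eq_coeff_expSeries_neg_mul k (X ^ i * (1 + X) ^ M)
  obtain ⟨q, hq⟩ := exists_eval_eq_coeff_expSeries_mul M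
    (X * ((X - 1) ^ l * ((X - 1)⁻¹) ^ (j + 1)))
  refine ⟨p.comp (Polynomial.C c + Polynomial.X) * q.comp (Polynomial.C d + Polynomial.X)
    * Polynomial.C (Real.exp (-d)), fun y => ?_⟩
  rw [inverseEntry, negOneResidue, hp, hq, neg_add, Real.exp_add]
  simp
  ring

lemma tendsto_inverseEntry_mul_negOneResidue (M i k l j : ℕ) (c d : ℝ) :
    Tendsto (fun y => inverseEntry M i k (c + y) * negOneResidue M l j (d + y)) atTop
      (nhds 0) := by
  obtain ⟨p, hp⟩ := exists_eval_mul_exp_neg_eq M i k l j c d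
  simp only [hp]
  exact tendsto_eval_mul_exp_neg p

lemma integrableOn_inverseEntry_mul_negOneResidue (M i k l j : ℕ) (c d t : ℝ) :
    IntegrableOn (fun y => inverseEntry M i k (c + y) * negOneResidue M l j (d + y))
      (Set.Ioi t) := by
  obtain ⟨p, hp⟩ := exists_eval_mul_exp_neg_eq M i k l j c d
  simp only [hp]
  exact integrableOn_eval_mul_exp_neg p t

lemma sum_inverseEntry_mul_negOneResidue (M i j : ℕ) (t : ℝ) (n : ℕ) :
    ∑ k : Fin (n + 1), inverseEntry M i k t * negOneResidue M k j t
      = -∫ y in Set.Ioi t, inverseEntry M i n y * negOneResidue M (n + 1) j y := by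
  have hint := integrableOn_inverseEntry_mul_negOneResidue M i n (n + 1) j 0 0 t
  have hlim : Tendsto (fun y => ∑ k : Fin (n + 1), inverseEntry M i k y * negOneResidue M k j y)
      atTop (nhds 0) := by
    have := tendsto_finsetSum (Finset.univ : Finset (Fin (n + 1))) fun k _ =>
      tendsto_inverseEntry_mul_negOneResidue M i k k j 0 0
    simpa using this
  simp only [zero_add] at hint
  rw [integral_Ioi_of_hasDerivAt_of_tendsto'
    (fun y _ => hasDerivAt_sum_inverseEntry_mul_negOneResidue M i j y n) hint hlim]
  ring

lemma det_residueSum_eq (M n : ℕ) (t : ℝ) :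
    Matrix.det (Matrix.of fun i j : Fin (n + 1) => residueSum M i j t)
      = (1 - Matrix.of fun i j : Fin (n + 1) =>
        ∫ y in Set.Ioi t, inverseEntry M i n y * negOneResidue M (n + 1) j y).det := by
  rw [← one_mul (Matrix.det _), ← det_inverseEntry M (n + 1) t, ← Matrix.det_mul]
  congr 1
  ext i j
  rw [Matrix.mul_apply]
  simp only [Matrix.of_apply, residueSum, mul_add, Finset.sum_add_distrib]
  rw [sum_inverseEntry_mul_zeroResidue M t _ j.2, sum_inverseEntry_mul_negOneResidue]
  simp [Matrix.one_apply, Fin.ext_iff, sub_eq_add_neg]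

end ResidueMatrix

section LaguerreKernel

open PowerSeries

/-- The coefficient of `Xⁿ` in `exp (-y X) (1 + X) ^ M`. -/
noncomputable def laguerreCoeff (M n : ℕ) (y : ℝ) : ℝ :=
  coeff n (expSeries (-y) * (1 + X) ^ M)

lemma inverseEntry_zero (M n : ℕ) (y : ℝ) : inverseEntry M 0 n y = laguerreCoeff M n y := by
  rw [inverseEntry, laguerreCoeff, pow_zero, one_mul]

lemma negOneResidue_last (m n : ℕ) (y : ℝ) :
    negOneResidue (m + 1) (n + 2) 0 y
      = (-1) ^ (n + 1 + m) * (Real.exp (-y) * laguerreCoeff (n + 1) m y) := by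
  have e1 : expSeries y * (X * ((X - 1) ^ (n + 2) * ((X - 1)⁻¹) ^ (0 + 1)))
      = X * (expSeries y * (X - 1) ^ (n + 1)) := by
    have : (X - 1 : PowerSeries ℝ) ^ (n + 2) * ((X - 1)⁻¹) ^ (0 + 1)
        = ((X - 1) * (X - 1)⁻¹) * (X - 1) ^ (n + 1) := by ring
    rw [this, X_sub_one_mul_inv]
    ring
  have e2 : rescale (-1 : ℝ) (expSeries (-y) * (1 + X) ^ (n + 1))
      = (-1) ^ (n + 1) * (expSeries y * (X - 1) ^ (n + 1)) := by
    have h1 : rescale (-1 : ℝ) (expSeries (-y)) = expSeries y := by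
      ext k
      rw [coeff_rescale, coeff_expSeries, coeff_expSeries, ← mul_div_assoc, ← mul_pow]
      simp
    have h2 : rescale (-1 : ℝ) (1 + X : PowerSeries ℝ) = (-1) * (X - 1) := by
      ext k
      rw [coeff_rescale]
      rcases k with _ | _ | k <;> simp [coeff_X, coeff_one]
    rw [map_mul, map_pow, h1, h2, mul_pow]
    ring
  have e3 := congrArg (coeff m) e2
  have e4 : ((-1 : PowerSeries ℝ)) ^ (n + 1) = C ((-1 : ℝ) ^ (n + 1)) := by simp
  rw [coeff_rescale, e4, coeff_C_mul] at e3
  rw [negOneResidue, e1, coeff_succ_X_mul, laguerreCoeff, pow_add (-1 : ℝ)]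
  generalize coeff m (expSeries y * (X - 1) ^ (n + 1)) = q at e3 ⊢
  have h5 : ((-1 : ℝ) ^ (n + 1)) * (-1) ^ (n + 1) = 1 := by rw [← mul_pow]; simp
  linear_combination (-(Real.exp (-y)) * (-1 : ℝ) ^ (n + 1)) * e3
    + (-(Real.exp (-y)) * q) * h5

lemma hasDerivAt_sum_kernel (M n : ℕ) (x y r : ℝ) :
    HasDerivAt (fun r => ∑ i : Fin (n + 1), inverseEntry M i n (x + r)
        * negOneResidue M (n + 1) i (y + r))
      (laguerreCoeff M n (x + r) * negOneResidue M (n + 2) 0 (y + r)) r := by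
  have htel : ∀ L, ∑ i ∈ Finset.range L, (-inverseEntry M (i + 1) n (x + r)
      * negOneResidue M (n + 1) i (y + r)
      + inverseEntry M i n (x + r) * negOneResidue M (n + 2) i (y + r))
      = inverseEntry M 0 n (x + r) * negOneResidue M (n + 2) 0 (y + r)
        - inverseEntry M L n (x + r) * negOneResidue M (n + 2) L (y + r) := by
    intro L
    induction L with
    | zero => simp
    | succ L ih =>
      rw [Finset.sum_range_succ, ih, negOneResidue_succ_succ]
      ring
  have h := htel (n + 1)
  rw [inverseEntry_eq_zero (Nat.lt_succ_self n), zero_mul, sub_zero, inverseEntry_zero,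
    ← Fin.sum_univ_eq_sum_range (fun i => -inverseEntry M (i + 1) n (x + r)
      * negOneResidue M (n + 1) i (y + r)
      + inverseEntry M i n (x + r) * negOneResidue M (n + 2) i (y + r))] at h
  rw [← h]
  refine HasDerivAt.fun_sum fun i _ => ?_
  exact ((hasDerivAt_inverseEntry M i n (x + r)).comp_const_add x r).mul
    ((hasDerivAt_negOneResidue M (n + 1) i (y + r)).comp_const_add y r)

lemma sum_kernel_eq (m n : ℕ) (x y : ℝ) :
    ∑ i : Fin (n + 1), inverseEntry (m + 1) i n x * negOneResidue (m + 1) (n + 1) i y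
      = ∫ r in Set.Ioi 0, (-1) ^ (n + m) * (laguerreCoeff (m + 1) n (x + r) *
        (Real.exp (-(y + r)) * laguerreCoeff (n + 1) m (y + r))) := by
  have hint := integrableOn_inverseEntry_mul_negOneResidue (m + 1) 0 n (n + 2) 0 x y 0
  have hlim : Tendsto (fun r => ∑ i : Fin (n + 1), inverseEntry (m + 1) i n (x + r)
      * negOneResidue (m + 1) (n + 1) i (y + r)) atTop (nhds 0) := by
    have := tendsto_finsetSum (Finset.univ : Finset (Fin (n + 1))) fun i _ =>
      tendsto_inverseEntry_mul_negOneResidue (m + 1) i n (n + 1) i x y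
    simpa using this
  simp only [inverseEntry_zero] at hint
  have h := integral_Ioi_of_hasDerivAt_of_tendsto'
    (fun r _ => hasDerivAt_sum_kernel (m + 1) n x y r) hint hlim
  simp only [add_zero, zero_sub] at h
  rw [← neg_eq_iff_eq_neg] at h
  rw [← h, ← integral_neg]
  refine integral_congr_ae (ae_of_all _ fun r => ?_)
  dsimp only
  rw [negOneResidue_last]
  ring

lemma integral_comp_const_add_Ioi (F : ℝ → ℝ) (t : ℝ) :
    ∫ z in Set.Ioi 0, F (t + z) = ∫ z in Set.Ioi t, F z := by
  have h := (measurePreserving_add_left volume t).setIntegral_preimage_emb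
    (measurableEmbedding_addLeft t) F (Set.Ioi t)
  simpa using h

/-- The distribution function of the last passage time as a Fredholm series, in rescaled
coordinates and up to a conjugation of the kernel. -/
lemma hasSum_det_residueSum (m n : ℕ) (t c : ℝ) {σ : ℝ} (hσ : 0 < σ) {φ ψ : ℝ → ℝ}
    (h : ∀ x y, φ x * ψ y = σ ^ 2 * Real.exp (c * (y - x)) * ((-1) ^ (n + m) *
      (laguerreCoeff (m + 1) n (t + σ * x) *
        (Real.exp (-(t + σ * y)) * laguerreCoeff (n + 1) m (t + σ * y))))) :
    HasSum (fun k : ℕ => ((-1 : ℝ) ^ k / (Nat.factorial k)) *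
      ∫ ξ : Fin k → ℝ, Matrix.det (Matrix.of fun a b =>
        ∫ r in Set.Ioi 0, φ (ξ a + r) * ψ (ξ b + r))
        ∂(Measure.pi fun _ => volume.restrict (Set.Ioi 0)))
      (Matrix.det (Matrix.of fun i j : Fin (n + 1) => residueSum (m + 1) i j t)) := by
  rw [det_residueSum_eq]
  refine (hasSum_det_one_sub _).congr_fun fun k => ?_
  set f : Fin (n + 1) → ℝ → ℝ := fun i x =>
    σ * Real.exp (-(c * x)) * inverseEntry (m + 1) i n (t + σ * x) with hf
  set g : Fin (n + 1) → ℝ → ℝ := fun i y =>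
    Real.exp (c * y) * negOneResidue (m + 1) (n + 1) i (t + σ * y) with hg
  have hfg : ∀ i j x, f i x * g j x = σ * (inverseEntry (m + 1) i n (t + σ * x)
      * negOneResidue (m + 1) (n + 1) j (t + σ * x)) := fun i j x => by
    have : Real.exp (-(c * x)) * Real.exp (c * x) = 1 := by
      rw [← Real.exp_add]
      simp
    simp only [hf, hg]
    linear_combination (σ * (inverseEntry (m + 1) i n (t + σ * x)
      * negOneResidue (m + 1) (n + 1) j (t + σ * x))) * this
  have hG : ∀ i j, ∫ x in Set.Ioi 0, f i x * g j x
      = ∫ y in Set.Ioi t, inverseEntry (m + 1) i n y * negOneResidue (m + 1) (n + 1) j y := fun i j => by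
    simp only [hfg, integral_const_mul]
    rw [integral_comp_mul_left_Ioi (fun z => inverseEntry (m + 1) i n (t + z)
      * negOneResidue (m + 1) (n + 1) j (t + z)) 0 hσ, mul_zero, smul_eq_mul,
      mul_inv_cancel_left₀ hσ.ne', integral_comp_const_add_Ioi (fun z =>
      inverseEntry (m + 1) i n z * negOneResidue (m + 1) (n + 1) j z) t]
  have hint : ∀ i j, Integrable (fun x => f i x * g j x) (volume.restrict (Set.Ioi 0)) := fun i j => by
    simp only [hfg]
    refine Integrable.const_mul ?_ _
    have := (integrableOn_Ioi_comp_mul_left_iff (fun z => inverseEntry (m + 1) i n (t + z)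
      * negOneResidue (m + 1) (n + 1) j (t + z)) 0 hσ).2 (by
        rw [mul_zero]
        exact integrableOn_inverseEntry_mul_negOneResidue _ _ _ _ _ _ _ _)
    exact this
  have hK : ∀ x y, ∑ i, f i x * g i y = ∫ r in Set.Ioi 0, φ (x + r) * ψ (y + r) := fun x y => by
    have e1 : ∑ i, f i x * g i y = σ * Real.exp (c * (y - x)) *
        ∑ i : Fin (n + 1), inverseEntry (m + 1) i n (t + σ * x)
          * negOneResidue (m + 1) (n + 1) i (t + σ * y) := by
      rw [Finset.mul_sum]
      refine Finset.sum_congr rfl fun i _ => ?_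
      rw [mul_sub, sub_eq_neg_add, Real.exp_add]
      simp only [hf, hg]
      ring
    obtain ⟨H, hH⟩ : ∃ H : ℝ → ℝ, ∀ r, H r = (-1) ^ (n + m) * (laguerreCoeff (m + 1) n (t + σ * x + r) *
        (Real.exp (-(t + σ * y + r)) * laguerreCoeff (n + 1) m (t + σ * y + r))) :=
      ⟨_, fun _ => rfl⟩
    have e2 : ∀ r, φ (x + r) * ψ (y + r) = σ ^ 2 * Real.exp (c * (y - x)) * H (σ * r) := by
      intro r
      rw [h, hH, add_sub_add_right_eq_sub]
      simp only [mul_add, add_assoc]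
    rw [e1, sum_kernel_eq]
    simp only [e2, ← hH]
    rw [integral_const_mul, integral_comp_mul_left_Ioi H 0 hσ, mul_zero, smul_eq_mul]
    field_simp
  simp only [← hK]
  rw [integral_det_sum_mul _ f g hint]
  simp only [hG]

end LaguerreKernel

section ContourIntegral

open PowerSeries

lemma hasSum_coeff_expSeries_mul (y : ℝ) (M : ℕ) (z : ℂ) :
    HasSum (fun k => ((coeff k (expSeries y * (1 + X) ^ M) : ℝ) : ℂ) * z ^ k)
      (Complex.exp (y * z) * (1 + z) ^ M) := by
  induction M with
  | zero =>
    have h := NormedSpace.expSeries_div_hasSum_exp ((y : ℂ) * z)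
    rw [← Complex.exp_eq_exp_ℂ] at h
    simpa [coeff_expSeries, mul_pow, mul_div_right_comm] using h
  | succ M ih =>
    set p := expSeries y * (1 + X) ^ M with hp
    have h1 := ih.mul_right z
    have h2 : HasSum (fun k => (if k = 0 then 0 else ((coeff (k - 1) p : ℝ) : ℂ)) * z ^ k)
        (Complex.exp (y * z) * (1 + z) ^ M * z) := by
      rw [← hasSum_nat_add_iff' 1]
      simpa [pow_succ, mul_assoc] using h1
    have h3 := ih.add h2
    have h4 : Complex.exp (y * z) * (1 + z) ^ (M + 1)
        = Complex.exp (y * z) * (1 + z) ^ M + Complex.exp (y * z) * (1 + z) ^ M * z := by ring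
    rw [h4]
    refine h3.congr_fun fun k => ?_
    rw [pow_succ, ← mul_assoc, ← hp, mul_add, mul_one, map_add]
    rcases k with _ | k
    · simp
    · rw [coeff_succ_mul_X]
      simp [add_mul]

lemma integral_exp_pow_mul_exp_neg (k n : ℕ) :
    ∫ θ in (-Real.pi)..Real.pi,
      Complex.exp (θ * Complex.I) ^ k * Complex.exp (-(n * (θ * Complex.I)))
      = if k = n then 2 * (Real.pi : ℂ) else 0 := by
  have e : ∀ θ : ℝ, Complex.exp (θ * Complex.I) ^ k * Complex.exp (-(n * (θ * Complex.I)))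
      = Complex.exp ((((k : ℂ) - n) * Complex.I) * θ) := fun θ => by
    rw [← Complex.exp_nat_mul, ← Complex.exp_add]
    congr 1
    ring
  simp only [e]
  split_ifs with h
  · subst h
    simp
    ring
  · have h' : ((k : ℂ) - n) ≠ 0 := sub_ne_zero.2 (by exact_mod_cast h)
    rw [integral_exp_mul_complex (mul_ne_zero h' Complex.I_ne_zero)]
    have : Complex.exp ((((k : ℂ) - n) * Complex.I) * (Real.pi : ℝ))
        = Complex.exp ((((k : ℂ) - n) * Complex.I) * ((-Real.pi : ℝ) : ℂ)) := by
      rw [Complex.exp_eq_exp_iff_exists_int]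
      refine ⟨k - n, ?_⟩
      push_cast
      ring
    rw [this, sub_self, zero_div]

lemma laguerreCoeff_eq_integral (M n : ℕ) (y : ℝ) {ρ : ℝ} (hρ : 0 < ρ) :
    ((2 * Real.pi * ((-1) ^ n * ρ ^ n * laguerreCoeff M n y) : ℝ) : ℂ)
      = ∫ θ in (-Real.pi)..Real.pi, Complex.exp (y * (ρ * Complex.exp (θ * Complex.I)))
        * (1 - ρ * Complex.exp (θ * Complex.I)) ^ M * Complex.exp (-(n * (θ * Complex.I))) := by
  set c : ℕ → ℝ := fun k => coeff k (expSeries (-y) * (1 + X) ^ M) with hc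
  have hs : Summable fun k => ‖c k‖ * ρ ^ k := by
    have := (hasSum_coeff_expSeries_mul (-y) M (ρ : ℂ)).summable.norm
    simpa [abs_of_pos hρ] using this
  have hF : ∀ θ : ℝ, HasSum (fun k => (c k : ℂ) * (-ρ) ^ k *
      (Complex.exp (θ * Complex.I) ^ k * Complex.exp (-(n * (θ * Complex.I)))))
      (Complex.exp (y * (ρ * Complex.exp (θ * Complex.I)))
        * (1 - ρ * Complex.exp (θ * Complex.I)) ^ M * Complex.exp (-(n * (θ * Complex.I)))) := by
    intro θ
    have h := (hasSum_coeff_expSeries_mul (-y) M (-ρ * Complex.exp (θ * Complex.I))).mul_right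
      (Complex.exp (-(n * (θ * Complex.I))))
    have e1 : ((-y : ℝ) : ℂ) * (-ρ * Complex.exp (θ * Complex.I))
        = y * (ρ * Complex.exp (θ * Complex.I)) := by
      push_cast
      ring
    rw [e1, neg_mul, ← sub_eq_add_neg] at h
    refine h.congr_fun fun k => ?_
    rw [← neg_mul (ρ : ℂ), mul_pow]
    ring
  have h := intervalIntegral.hasSum_integral_of_dominated_convergence (μ := volume)
    (a := -Real.pi) (b := Real.pi) (fun k _ => ‖c k‖ * ρ ^ k)
    (F := fun k (θ : ℝ) => (c k : ℂ) * (-ρ) ^ k *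
      (Complex.exp (θ * Complex.I) ^ k * Complex.exp (-(n * (θ * Complex.I)))))
    (fun k => (Continuous.aestronglyMeasurable (by fun_prop)))
    (fun k => ae_of_all _ fun θ _ => by
      have h1 : ‖Complex.exp (-(n * (θ * Complex.I)))‖ = 1 := by
        rw [Complex.norm_exp]
        simp
      rw [norm_mul, norm_mul, norm_mul, h1, norm_pow, norm_pow, Complex.norm_exp_ofReal_mul_I]
      simp [abs_of_pos hρ])
    (ae_of_all _ fun θ _ => hs) (by simp) (ae_of_all _ fun θ _ => hF θ)
  simp only [intervalIntegral.integral_const_mul, integral_exp_pow_mul_exp_neg] at h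
  rw [← h.tsum_eq, tsum_eq_single n (fun k hk => by rw [if_neg hk, mul_zero]), if_pos rfl,
    laguerreCoeff, neg_pow]
  push_cast
  ring

end ContourIntegral

section SaddlePoint

/-- The fluctuation scale at the edge, for dimensions `A²` and `B²`. -/
noncomputable def edgeScale (A B : ℝ) : ℝ := ((A + B) ^ 4 / (A * B)) ^ ((1 : ℝ) / 3)

/-- The width of the saddle point, for dimensions `A²` and `B²`. -/
noncomputable def saddleWidth (A B : ℝ) : ℝ := (A + B) / (B * edgeScale A B)

/-- The integrand of the contour integral for the Laguerre coefficients in the local coordinate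
at the saddle point. -/
noncomputable def saddleIntegrand (A B : ℝ) (M n : ℕ) (ξ : ℝ) (w : ℂ) : ℂ :=
  Complex.exp (((((A + B) ^ 2 + edgeScale A B * ξ) * (B / (A + B)) : ℝ) : ℂ) *
      (Complex.exp (saddleWidth A B * w) - 1)) *
    (1 - ((B / A : ℝ) : ℂ) * (Complex.exp (saddleWidth A B * w) - 1)) ^ M *
    Complex.exp (-(n * (saddleWidth A B * w)))

/-- The Laguerre coefficients in edge scaling. -/
noncomputable def scaledLaguerre (A B : ℝ) (M n : ℕ) (ξ : ℝ) : ℝ :=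
  (-1) ^ n * (saddleWidth A B)⁻¹ * (B / (A + B)) ^ n *
    Real.exp (-(((A + B) ^ 2 + edgeScale A B * ξ) * (B / (A + B)))) * ((A / (A + B)) ^ M)⁻¹ *
    laguerreCoeff M n ((A + B) ^ 2 + edgeScale A B * ξ)

variable {A B : ℝ}

lemma edgeScale_pos (hA : 0 < A) (hB : 0 < B) : 0 < edgeScale A B := by
  unfold edgeScale
  positivity

lemma edgeScale_comm (A B : ℝ) : edgeScale A B = edgeScale B A := by
  rw [edgeScale, edgeScale, add_comm, mul_comm A B]

lemma edgeScale_pow_three (hA : 0 < A) (hB : 0 < B) :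
    edgeScale A B ^ 3 = (A + B) ^ 4 / (A * B) := by
  rw [edgeScale, ← Real.rpow_natCast, ← Real.rpow_mul (by positivity)]
  norm_num

lemma saddleWidth_pos (hA : 0 < A) (hB : 0 < B) : 0 < saddleWidth A B := by
  have := edgeScale_pos hA hB
  unfold saddleWidth
  positivity

lemma saddleWidth_pow_three (hA : 0 < A) (hB : 0 < B) :
    saddleWidth A B ^ 3 = A / (B ^ 2 * (A + B)) := by
  rw [saddleWidth, div_pow, mul_pow, edgeScale_pow_three hA hB]
  field_simp

lemma edgeScale_mul_eq (hA : 0 < A) (hB : 0 < B) :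
    edgeScale A B * (B / (A + B)) = (saddleWidth A B)⁻¹ := by
  have := edgeScale_pos hA hB
  rw [saddleWidth]
  field_simp

lemma two_pi_mul_scaledLaguerre (hA : 0 < A) (hB : 0 < B) (M n : ℕ) (ξ : ℝ) :
    ((2 * Real.pi * scaledLaguerre A B M n ξ : ℝ) : ℂ)
      = ∫ t in (-(Real.pi / saddleWidth A B))..(Real.pi / saddleWidth A B),
        saddleIntegrand A B M n ξ (Complex.I * (t + Complex.I)) := by
  have hη := saddleWidth_pos hA hB
  set η := saddleWidth A B with hηd
  set r := B / (A + B) with hr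
  set τ := (A + B) ^ 2 + edgeScale A B * ξ with hτ
  have hr0 : 0 < r := by positivity
  have hA' : A / (A + B) ≠ 0 := by positivity
  have h := laguerreCoeff_eq_integral M n τ (ρ := r * Real.exp (-η)) (by positivity)
  have hw : ∀ t : ℝ, ((r * Real.exp (-η) : ℝ) : ℂ) * Complex.exp (((η * t : ℝ) : ℂ) * Complex.I)
      = r * Complex.exp (η * (Complex.I * (t + Complex.I))) := fun t => by
    push_cast
    rw [mul_assoc, ← Complex.exp_add]
    congr 2
    linear_combination (-(η : ℂ)) * Complex.I_sq
  have hq : ∀ t : ℝ, (1 : ℂ) - r * Complex.exp (η * (Complex.I * (t + Complex.I)))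
      = ((A / (A + B) : ℝ) : ℂ) *
        (1 - ((B / A : ℝ) : ℂ) * (Complex.exp (η * (Complex.I * (t + Complex.I))) - 1)) := fun t => by
    have h1 : (A : ℂ) ≠ 0 := by exact_mod_cast hA.ne'
    have h2 : (A + B : ℂ) ≠ 0 := by exact_mod_cast (add_pos hA hB).ne'
    rw [hr]
    push_cast
    field_simp
    ring
  have hexp : ∀ t : ℝ, Complex.exp (-(n * (((η * t : ℝ) : ℂ) * Complex.I)))
      = ((Real.exp (-(n * η)) : ℝ) : ℂ) * Complex.exp (-(n * (η * (Complex.I * (t + Complex.I))))) := by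
    intro t
    push_cast
    rw [← Complex.exp_add]
    congr 1
    linear_combination ((n : ℂ) * η) * Complex.I_sq
  have hf : ∀ t : ℝ, Complex.exp (τ * (((r * Real.exp (-η) : ℝ) : ℂ) *
        Complex.exp (((η * t : ℝ) : ℂ) * Complex.I)))
      * (1 - ((r * Real.exp (-η) : ℝ) : ℂ) * Complex.exp (((η * t : ℝ) : ℂ) * Complex.I)) ^ M
      * Complex.exp (-(n * (((η * t : ℝ) : ℂ) * Complex.I)))
      = ((Real.exp (τ * r) * (A / (A + B)) ^ M * Real.exp (-(n * η)) : ℝ) : ℂ)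
        * saddleIntegrand A B M n ξ (Complex.I * (t + Complex.I)) := fun t => by
    rw [hw, hq, hexp, saddleIntegrand, ← hηd, ← hr, ← hτ, mul_pow]
    have : Complex.exp (τ * (r * Complex.exp (η * (Complex.I * (t + Complex.I)))))
        = ((Real.exp (τ * r) : ℝ) : ℂ) * Complex.exp (((τ * r : ℝ) : ℂ) *
          (Complex.exp (η * (Complex.I * (t + Complex.I))) - 1)) := by
      push_cast
      rw [← Complex.exp_add]
      congr 1
      ring
    rw [this]
    simp only [Complex.ofReal_mul, Complex.ofReal_pow]
    ring
  have h2 := intervalIntegral.smul_integral_comp_mul_left (a := -(Real.pi / η)) (b := Real.pi / η)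
    (fun θ : ℝ => Complex.exp (τ * (((r * Real.exp (-η) : ℝ) : ℂ) * Complex.exp (θ * Complex.I)))
        * (1 - ((r * Real.exp (-η) : ℝ) : ℂ) * Complex.exp (θ * Complex.I)) ^ M
        * Complex.exp (-(n * (θ * Complex.I)))) η
  simp only [hf] at h2
  rw [mul_neg, mul_div_cancel₀ _ hη.ne', ← h, intervalIntegral.integral_const_mul] at h2
  have hne : ((η * (Real.exp (τ * r) * (A / (A + B)) ^ M * Real.exp (-(n * η))) : ℝ) : ℂ) ≠ 0 := by
    norm_cast
    positivity
  refine mul_left_cancel₀ hne ?_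
  have h3 : η * (Real.exp (τ * r) * (A / (A + B)) ^ M * Real.exp (-(n * η))) *
      (2 * Real.pi * scaledLaguerre A B M n ξ)
      = 2 * Real.pi * ((-1) ^ n * (r * Real.exp (-η)) ^ n * laguerreCoeff M n τ) := by
    rw [scaledLaguerre, mul_pow, ← Real.exp_nat_mul, mul_neg, ← hηd, ← hr, ← hτ, Real.exp_neg (τ * r)]
    field_simp
  rw [← Complex.ofReal_mul, h3, ← h2, Complex.real_smul]
  push_cast
  ring

end SaddlePoint

section SaddleBound

lemma norm_sub_mul_exp_I_pow_le {a b : ℝ} (hab : b < a) (θ : ℝ) (M : ℕ) :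
    ‖(a : ℂ) - b * Complex.exp (θ * Complex.I)‖ ^ M
      ≤ (a - b) ^ M * Real.exp (M * (a * b / (a - b) ^ 2) * (1 - Real.cos θ)) := by
  have h0 : 0 < a - b := sub_pos.2 hab
  have h1 : ‖(a : ℂ) - b * Complex.exp (θ * Complex.I)‖ ^ 2
      = (a - b) ^ 2 * (2 * (a * b / (a - b) ^ 2 * (1 - Real.cos θ)) + 1) := by
    have : (a - b) ^ 2 * (2 * (a * b / (a - b) ^ 2 * (1 - Real.cos θ)) + 1)
        = (a - b) ^ 2 + 2 * (a * b) * (1 - Real.cos θ) := by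
      field_simp
      ring
    rw [this, Complex.sq_norm, Complex.normSq_apply]
    simp only [Complex.sub_re, Complex.sub_im, Complex.ofReal_re, Complex.ofReal_im,
      Complex.re_ofReal_mul, Complex.im_ofReal_mul, Complex.exp_ofReal_mul_I_re,
      Complex.exp_ofReal_mul_I_im]
    linear_combination b ^ 2 * Real.sin_sq_add_cos_sq θ
  have h2 : ‖(a : ℂ) - b * Complex.exp (θ * Complex.I)‖
      ≤ (a - b) * Real.exp (a * b / (a - b) ^ 2 * (1 - Real.cos θ)) := by
    refine (sq_le_sq₀ (norm_nonneg _) (by positivity)).1 ?_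
    rw [h1, mul_pow, ← Real.exp_nat_mul]
    exact mul_le_mul_of_nonneg_left (Real.add_one_le_exp _) (by positivity)
  calc _ ≤ ((a - b) * Real.exp (a * b / (a - b) ^ 2 * (1 - Real.cos θ))) ^ M :=
        pow_le_pow_left₀ (norm_nonneg _) h2 M
    _ = _ := by
        rw [mul_pow, ← Real.exp_nat_mul, mul_assoc (M : ℝ)]

variable {A B : ℝ}

/-- The norm of the integrand at the saddle point. -/
noncomputable def saddleHeight (A B : ℝ) (M n : ℕ) (ξ : ℝ) : ℝ :=
  Real.exp (((A + B) ^ 2 + edgeScale A B * ξ) * (B / (A + B)) * (Real.exp (-saddleWidth A B) - 1)) *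
    (1 + B / A - B / A * Real.exp (-saddleWidth A B)) ^ M * Real.exp (n * saddleWidth A B)

lemma saddleHeight_eq (hA : 0 < A) (hB : 0 < B) (M n : ℕ) (ξ : ℝ) :
    saddleHeight A B M n ξ = saddleHeight A B M n 0 *
      Real.exp (-((1 - Real.exp (-saddleWidth A B)) / saddleWidth A B * ξ)) := by
  have h := edgeScale_mul_eq hA hB
  have e : ((A + B) ^ 2 + edgeScale A B * ξ) * (B / (A + B)) * (Real.exp (-saddleWidth A B) - 1)
      = ((A + B) ^ 2 + edgeScale A B * 0) * (B / (A + B)) * (Real.exp (-saddleWidth A B) - 1)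
        + -((1 - Real.exp (-saddleWidth A B)) / saddleWidth A B * ξ) := by
    rw [div_eq_mul_inv (1 - _)]
    linear_combination (ξ * (Real.exp (-saddleWidth A B) - 1)) * h
  rw [saddleHeight, saddleHeight, e, Real.exp_add]
  ring

lemma saddleHeight_nonneg (hA : 0 < A) (hB : 0 < B) (M n : ℕ) (ξ : ℝ) :
    0 ≤ saddleHeight A B M n ξ := by
  have h1 : Real.exp (-saddleWidth A B) < 1 :=
    Real.exp_lt_one_iff.2 (neg_lt_zero.2 (saddleWidth_pos hA hB))
  have h2 : 0 ≤ 1 + B / A - B / A * Real.exp (-saddleWidth A B) := by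
    nlinarith [div_pos hB hA]
  rw [saddleHeight]
  positivity

lemma norm_saddleIntegrand_le (hA : 0 < A) (hB : 0 < B) {M : ℕ} (hM : (M : ℝ) = A ^ 2) (n : ℕ)
    {ξ t : ℝ} (ht : |saddleWidth A B * t| ≤ Real.pi)
    (hξ : 1 ≤ Real.exp (-saddleWidth A B) *
      ((1 - ((1 + B / A * (1 - Real.exp (-saddleWidth A B))) ^ 2)⁻¹) / (B / A * saddleWidth A B)
        + ξ * saddleWidth A B)) :
    ‖saddleIntegrand A B M n ξ (Complex.I * (t + Complex.I))‖
      ≤ saddleHeight A B M n ξ * Real.exp (-(2 / Real.pi ^ 2) * t ^ 2) := by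
  have hη := saddleWidth_pos hA hB
  have h3 := saddleWidth_pow_three hA hB
  have hs := edgeScale_mul_eq hA hB
  have hAB := add_pos hA hB
  have hq : 0 < B / A := by positivity
  have hqr : B / (A + B) = B / A / (1 + B / A) := by field_simp
  set η := saddleWidth A B with hηd
  set x := Real.exp (-η) with hx
  have hx0 : 0 < x := Real.exp_pos _
  have hx1 : x < 1 := by rw [hx]; exact Real.exp_lt_one_iff.2 (by linarith)
  set τ := (A + B) ^ 2 + edgeScale A B * ξ with hτ
  have hexp : Complex.exp (η * (Complex.I * (t + Complex.I)))
      = x * Complex.exp (((η * t : ℝ) : ℂ) * Complex.I) := by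
    rw [hx]
    push_cast
    rw [← Complex.exp_add]
    congr 1
    linear_combination (η : ℂ) * Complex.I_sq
  have n1 : ‖Complex.exp (((τ * (B / (A + B)) : ℝ) : ℂ) *
      (x * Complex.exp (((η * t : ℝ) : ℂ) * Complex.I) - 1))‖
      = Real.exp (τ * (B / (A + B)) * (x - 1)) *
        Real.exp (-(τ * (B / (A + B)) * x * (1 - Real.cos (η * t)))) := by
    rw [Complex.norm_exp, Complex.re_ofReal_mul, Complex.sub_re, Complex.re_ofReal_mul,
      Complex.exp_ofReal_mul_I_re, Complex.one_re, ← Real.exp_add]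
    congr 1
    ring
  have n3 : ‖Complex.exp (-(n * (η * (Complex.I * (t + Complex.I)))))‖ = Real.exp (n * η) := by
    rw [Complex.norm_exp]
    congr 1
    simp
  have n2 := norm_sub_mul_exp_I_pow_le (a := 1 + B / A) (b := B / A * x)
    (by nlinarith) (η * t) M
  have e2 : (1 : ℂ) - ((B / A : ℝ) : ℂ) * (x * Complex.exp (((η * t : ℝ) : ℂ) * Complex.I) - 1)
      = ((1 + B / A : ℝ) : ℂ) - ((B / A * x : ℝ) : ℂ) * Complex.exp (((η * t : ℝ) : ℂ) * Complex.I) := by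
    push_cast
    ring
  rw [saddleIntegrand, ← hηd, ← hτ, hexp, norm_mul, norm_mul, norm_pow, n1, n3, e2]
  have hcos := Real.cos_le_one_sub_mul_cos_sq ht
  have key : -(τ * (B / (A + B)) * x * (1 - Real.cos (η * t)))
      + M * ((1 + B / A) * (B / A * x) / (1 + B / A - B / A * x) ^ 2) * (1 - Real.cos (η * t))
      ≤ -(2 / Real.pi ^ 2) * t ^ 2 := by
    have h4 : (τ * (B / (A + B)) * x) - M * ((1 + B / A) * (B / A * x) / (1 + B / A - B / A * x) ^ 2)
        = (x * ((1 - ((1 + B / A * (1 - x)) ^ 2)⁻¹) / (B / A * η) + ξ * η)) / η ^ 2 := by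
      have h5 : (1 + B / A - B / A * x) = 1 + B / A * (1 - x) := by ring
      have h6 : 1 + B / A * (1 - x) ≠ 0 := by
        have : 0 < B / A * (1 - x) := mul_pos hq (by linarith)
        positivity
      have h7 : η ^ 3 * (B * (A + B)) = A / B := by
        rw [h3]; field_simp
      have h8 : τ * (B / (A + B)) = B * (A + B) + ξ / η := by
        rw [hτ, add_mul, mul_right_comm, hs]
        field_simp
      have h9 : (M : ℝ) * (1 + B / A) * (B / A) = B * (A + B) := by
        rw [hM]; field_simp
      have h10 : B * (A + B) = A / B / η ^ 3 := by rw [← h7]; field_simp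
      rw [h5, h8]
      have h11 : (M : ℝ) * ((1 + B / A) * (B / A * x) / (1 + B / A * (1 - x)) ^ 2)
          = B * (A + B) * x * ((1 + B / A * (1 - x)) ^ 2)⁻¹ := by
        rw [← h9, div_eq_mul_inv _ ((1 + B / A * (1 - x)) ^ 2)]; ring
      rw [h11, h10]
      generalize ((1 + B / A * (1 - x)) ^ 2)⁻¹ = z
      field_simp
      ring
    have h12 : 1 / η ^ 2 ≤ (τ * (B / (A + B)) * x)
        - M * ((1 + B / A) * (B / A * x) / (1 + B / A - B / A * x) ^ 2) := by
      rw [h4]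
      exact div_le_div_of_nonneg_right hξ (by positivity)
    have h13 : 2 / Real.pi ^ 2 * (η * t) ^ 2 ≤ 1 - Real.cos (η * t) := by linarith
    have h14 := mul_le_mul h12 h13 (by positivity) (le_trans (by positivity) h12)
    have h15 : 1 / η ^ 2 * (2 / Real.pi ^ 2 * (η * t) ^ 2) = 2 / Real.pi ^ 2 * t ^ 2 := by
      field_simp
    rw [h15] at h14
    linarith
  calc _ ≤ Real.exp (τ * (B / (A + B)) * (x - 1)) *
        Real.exp (-(τ * (B / (A + B)) * x * (1 - Real.cos (η * t)))) *
        ((1 + B / A - B / A * x) ^ M * Real.exp (M * ((1 + B / A) * (B / A * x)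
          / (1 + B / A - B / A * x) ^ 2) * (1 - Real.cos (η * t)))) * Real.exp (n * η) := by
        gcongr
    _ = saddleHeight A B M n ξ * (Real.exp (-(τ * (B / (A + B)) * x * (1 - Real.cos (η * t)))
        + M * ((1 + B / A) * (B / A * x) / (1 + B / A - B / A * x) ^ 2) * (1 - Real.cos (η * t)))) := by
        rw [saddleHeight, ← hηd, ← hτ, ← hx, Real.exp_add]
        ring
    _ ≤ _ := by
        have := saddleHeight_nonneg hA hB M n ξ
        gcongr

end SaddleBound

section SaddleLimit

open Asymptotics

lemma exp_sub_taylor_isLittleO :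
    (fun z : ℂ => Complex.exp z - 1 - z - z ^ 2 / 2 - z ^ 3 / 6) =o[nhds 0] fun z => z ^ 3 := by
  refine IsBigO.trans_isLittleO ?_ (isLittleO_pow_pow (m := 3) (n := 4) (by norm_num))
  refine IsBigO.of_bound (5 * (24 * 4)⁻¹) ?_
  filter_upwards [Metric.closedBall_mem_nhds (0 : ℂ) one_pos] with z hz
  have h := Complex.exp_bound (mem_closedBall_zero_iff.1 hz) (n := 4) (by norm_num)
  have e : Complex.exp z - ∑ m ∈ Finset.range 4, z ^ m / (m.factorial : ℂ)
      = Complex.exp z - 1 - z - z ^ 2 / 2 - z ^ 3 / 6 := by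
    simp [Finset.sum_range_succ, Nat.factorial]
    ring
  rw [e] at h
  rw [norm_pow, mul_comm]
  refine h.trans_eq ?_
  norm_num [Nat.factorial]

lemma exp_sub_one_sq_sub_isLittleO :
    (fun z : ℂ => (Complex.exp z - 1) ^ 2 - z ^ 2 - z ^ 3) =o[nhds 0] fun z => z ^ 3 := by
  have h1 := exp_sub_taylor_isLittleO
  have ht : Tendsto (fun z : ℂ => 2 * z) (nhds 0) (nhds 0) := by
    simpa using (tendsto_id (x := nhds (0 : ℂ))).const_mul 2
  have h2 := h1.comp_tendsto ht
  have h3 : (fun z : ℂ => Complex.exp (2 * z) - 1 - 2 * z - (2 * z) ^ 2 / 2 - (2 * z) ^ 3 / 6)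
      =o[nhds 0] fun z => z ^ 3 := by
    refine h2.trans_isBigO ?_
    have : ((fun z : ℂ => z ^ 3) ∘ fun z => 2 * z) = fun z : ℂ => 8 * z ^ 3 := by
      funext z
      simp only [Function.comp]
      ring
    rw [this]
    exact isBigO_const_mul_self _ _ _
  refine (h3.sub (h1.const_mul_left 2)).congr_left fun z => ?_
  rw [two_mul z, Complex.exp_add]
  ring

lemma log_one_sub_add_isLittleO :
    (fun z : ℂ => Complex.log (1 - z) + z + z ^ 2 / 2 + z ^ 3 / 3) =o[nhds 0] fun z => z ^ 3 := by
  refine IsBigO.trans_isLittleO ?_ (isLittleO_pow_pow (m := 3) (n := 4) (by norm_num))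
  refine IsBigO.of_bound 1 ?_
  filter_upwards [Metric.closedBall_mem_nhds (0 : ℂ) (ε := 1 / 2) (by norm_num)] with z hz
  have hz' : ‖z‖ ≤ 1 / 2 := mem_closedBall_zero_iff.1 hz
  have h := Complex.norm_log_sub_logTaylor_le 3 (z := -z) (by rw [norm_neg]; linarith)
  have e : Complex.log (1 + -z) - Complex.logTaylor (3 + 1) (-z)
      = Complex.log (1 - z) + z + z ^ 2 / 2 + z ^ 3 / 3 := by
    simp [Complex.logTaylor, Finset.sum_range_succ, sub_eq_add_neg]
    ring
  rw [e, norm_neg] at h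
  rw [norm_pow, one_mul]
  refine h.trans ?_
  have h2 : (1 - ‖z‖)⁻¹ ≤ 2 := by
    rw [inv_le_comm₀ (by linarith) (by norm_num)]
    linarith
  have h3 : 0 ≤ ‖z‖ ^ 4 := by positivity
  norm_num
  nlinarith [mul_le_mul_of_nonneg_left h2 h3]

lemma tendsto_comp_div_pow_three {f : ℂ → ℂ} (hf : f =o[nhds 0] fun z => z ^ 3) {z η : ℕ → ℂ} {c : ℂ}
    (hη : Tendsto η atTop (nhds 0)) (hz : Tendsto (fun k => z k / η k) atTop (nhds c))
    (h0 : ∀ k, η k ≠ 0) :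
    Tendsto (fun k => f (z k) / η k ^ 3) atTop (nhds 0) := by
  have hz0 : Tendsto z atTop (nhds 0) := by
    have := hz.mul hη
    rw [mul_zero] at this
    refine this.congr fun k => ?_
    exact div_mul_cancel₀ _ (h0 k)
  have hO : z =O[atTop] η := by
    refine (isBigO_of_div_tendsto_nhds (Eventually.of_forall fun k hk => absurd hk (h0 k)) c hz)
  exact ((hf.comp_tendsto hz0).trans_isBigO (hO.pow 3)).tendsto_div_nhds_zero

lemma tendsto_exp_sub_one_div {w : ℂ} {η : ℕ → ℂ} (hη : Tendsto η atTop (nhds 0))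
    (h0 : ∀ k, η k ≠ 0) :
    Tendsto (fun k => (Complex.exp (η k * w) - 1) / η k) atTop (nhds w) := by
  have h : HasDerivAt (fun z : ℂ => Complex.exp (z * w)) w 0 := by
    have := ((hasDerivAt_id (0 : ℂ)).mul_const w).cexp
    simpa using this
  have h' := h.tendsto_slope.comp (tendsto_nhdsWithin_iff.2 ⟨hη, Eventually.of_forall h0⟩)
  refine h'.congr fun k => ?_
  simp [slope_def_field]

end SaddleLimit

section SaddleLimit

open Asymptotics

variable {A B : ℕ → ℝ} {M n : ℕ → ℕ} {q : ℝ}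

lemma tendsto_saddleWidth (hA : ∀ k, 0 < A k) (hB : ∀ k, 0 < B k) (hBt : Tendsto B atTop atTop) :
    Tendsto (fun k => saddleWidth (A k) (B k)) atTop (nhds 0) := by
  have h2 : Tendsto (fun k => (B k)⁻¹) atTop (nhds 0) := tendsto_inv_atTop_zero.comp hBt
  have h3 : Tendsto (fun k => saddleWidth (A k) (B k) ^ 3) atTop (nhds 0) := by
    have h4 : Tendsto (fun k => (B k)⁻¹ ^ 2) atTop (nhds 0) := by simpa using h2.pow 2
    refine squeeze_zero (fun k => (pow_pos (saddleWidth_pos (hA k) (hB k)) 3).le) (fun k => ?_) h4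
    have := hA k
    have := hB k
    rw [saddleWidth_pow_three (hA k) (hB k), inv_pow, inv_eq_one_div,
      div_le_div_iff₀ (by positivity) (by positivity)]
    nlinarith [mul_pos this (pow_pos this 2)]
  have h5 := h3.rpow_const (p := (1 : ℝ) / 3) (Or.inr (by norm_num))
  rw [Real.zero_rpow (by norm_num)] at h5
  refine h5.congr fun k => ?_
  rw [← Real.rpow_natCast, ← Real.rpow_mul (saddleWidth_pos (hA k) (hB k)).le]
  norm_num

lemma tendsto_saddleIntegrand (hA : ∀ k, 0 < A k) (hB : ∀ k, 0 < B k)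
    (hM : ∀ k, (M k : ℝ) = A k ^ 2) (hn : ∀ k, (n k : ℝ) + 1 = B k ^ 2)
    (hBt : Tendsto B atTop atTop) (hq0 : 0 < q) (hq : Tendsto (fun k => B k / A k) atTop (nhds q))
    {ξ : ℕ → ℝ} {ξ₀ : ℝ} (hξ : Tendsto ξ atTop (nhds ξ₀)) (w : ℂ) :
    Tendsto (fun k => saddleIntegrand (A k) (B k) (M k) (n k) (ξ k) w) atTop
      (nhds (Complex.exp (-w ^ 3 / 3 + ξ₀ * w))) := by
  have hη0 : ∀ k, ((saddleWidth (A k) (B k) : ℝ) : ℂ) ≠ 0 := fun k => by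
    exact_mod_cast (saddleWidth_pos (hA k) (hB k)).ne'
  have hη : Tendsto (fun k => ((saddleWidth (A k) (B k) : ℝ) : ℂ)) atTop (nhds 0) := by
    exact_mod_cast (Complex.continuous_ofReal.tendsto 0).comp (tendsto_saddleWidth hA hB hBt)
  set η : ℕ → ℂ := fun k => ((saddleWidth (A k) (B k) : ℝ) : ℂ) with hηd
  have hqc : Tendsto (fun k => ((B k / A k : ℝ) : ℂ)) atTop (nhds (q : ℂ)) :=
    (Complex.continuous_ofReal.tendsto q).comp hq
  have hξc : Tendsto (fun k => ((ξ k : ℝ) : ℂ)) atTop (nhds (ξ₀ : ℂ)) :=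
    (Complex.continuous_ofReal.tendsto ξ₀).comp hξ
  set Q : ℕ → ℂ := fun k => ((B k / A k : ℝ) : ℂ) with hQ
  have hQ0 : ∀ k, Q k ≠ 0 := fun k => by
    have : B k / A k ≠ 0 := (div_pos (hB k) (hA k)).ne'
    simp only [hQ]
    exact_mod_cast this
  have hQ1 : ∀ k, 1 + Q k ≠ 0 := fun k => by
    have : 1 + B k / A k ≠ 0 := (add_pos one_pos (div_pos (hB k) (hA k))).ne'
    simp only [hQ]
    exact_mod_cast this
  have hδ := tendsto_exp_sub_one_div (w := w) hη hη0
  set δ : ℕ → ℂ := fun k => Complex.exp (η k * w) - 1 with hδd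
  have hY : Tendsto (fun k => η k * w / η k) atTop (nhds w) :=
    tendsto_const_nhds.congr fun k => (mul_div_cancel_left₀ w (hη0 k)).symm
  have hQδ : Tendsto (fun k => Q k * δ k / η k) atTop (nhds (q * w)) :=
    (hqc.mul hδ).congr fun k => (mul_div_assoc _ _ _).symm
  have t1 := tendsto_comp_div_pow_three exp_sub_taylor_isLittleO hη hY hη0
  have t2 := tendsto_comp_div_pow_three log_one_sub_add_isLittleO hη hQδ hη0
  have t3 := tendsto_comp_div_pow_three exp_sub_one_sq_sub_isLittleO hη hY hη0
  have hqc0 : (q : ℂ) ≠ 0 := by exact_mod_cast hq0.ne'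
  have hqc1 : 1 + (q : ℂ) ≠ 0 := by
    have : 1 + q ≠ 0 := (add_pos one_pos hq0).ne'
    exact_mod_cast this
  have hmain := ((((tendsto_const_nhds (x := w ^ 3 / 6)).add t1).add
    ((((hqc.mul (hδ.pow 3)).div_const 3).neg).add (t2.div (hqc.pow 2) (pow_ne_zero 2 hqc0)))).add
    (((tendsto_const_nhds (x := -w ^ 3 / 2))).sub (t3.div_const 2))).div
    ((tendsto_const_nhds (x := (1 : ℂ))).add hqc) hqc1
  have hexpo := ((hmain.add (hξc.mul hδ)).add (hη.mul_const w)).cexp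
  have hev : ∀ᶠ k in atTop, 1 - Q k * δ k ≠ 0 := by
    have : Tendsto (fun k => 1 - Q k * δ k) atTop (nhds 1) := by
      have h := (tendsto_const_nhds (x := (1 : ℂ))).sub (hQδ.mul hη)
      rw [mul_zero, sub_zero] at h
      exact h.congr fun k => by rw [div_mul_cancel₀ _ (hη0 k)]
    exact this.eventually_ne one_ne_zero
  have hlim : (w ^ 3 / 6 + 0 + (-(q * w ^ 3 / 3) + 0 / q ^ 2) + (-w ^ 3 / 2 - 0 / 2)) / (1 + q)
      + ξ₀ * w + 0 * w = -w ^ 3 / 3 + ξ₀ * w := by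
    field_simp
    ring
  rw [hlim] at hexpo
  refine hexpo.congr' ?_
  filter_upwards [hev] with k hk
  have hBc : (B k : ℂ) ≠ 0 := by exact_mod_cast (hB k).ne'
  have hAc : (A k : ℂ) ≠ 0 := by exact_mod_cast (hA k).ne'
  have hABc : (A k : ℂ) + B k ≠ 0 := by exact_mod_cast (add_pos (hA k) (hB k)).ne'
  have e1 : (((((A k + B k) ^ 2 + edgeScale (A k) (B k) * ξ k) * (B k / (A k + B k)) : ℝ)) : ℂ)
      = (B k : ℂ) ^ 2 + A k * B k + ξ k / η k := by
    have h1 : ((A k + B k) ^ 2 + edgeScale (A k) (B k) * ξ k) * (B k / (A k + B k))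
        = B k ^ 2 + A k * B k + ξ k / saddleWidth (A k) (B k) := by
      rw [add_mul, mul_right_comm, edgeScale_mul_eq (hA k) (hB k)]
      have := add_pos (hA k) (hB k)
      field_simp
      ring
    rw [h1]
    push_cast
    rfl
  have e2 : (M k : ℂ) = (A k : ℂ) ^ 2 := by exact_mod_cast hM k
  have e3 : (n k : ℂ) = (B k : ℂ) ^ 2 - 1 := by
    rw [eq_sub_iff_add_eq]
    exact_mod_cast hn k
  have e4 : η k ^ 3 * ((B k : ℂ) ^ 2 * (1 + Q k)) = 1 := by
    have : saddleWidth (A k) (B k) ^ 3 * (B k ^ 2 * (1 + B k / A k)) = 1 := by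
      have := hA k
      have := hB k
      rw [saddleWidth_pow_three (hA k) (hB k)]
      field_simp
    simp only [hQ, hηd]
    exact_mod_cast this
  have e5 : (1 - Q k * δ k) ^ M k = Complex.exp (M k * Complex.log (1 - Q k * δ k)) := by
    rw [Complex.exp_nat_mul, Complex.exp_log hk]
  have e6 : Q k * A k = B k := by
    rw [hQ]
    push_cast
    field_simp
  rw [saddleIntegrand, e1]
  change _ = Complex.exp (_ * δ k) * (1 - Q k * δ k) ^ M k * Complex.exp (-(n k * (η k * w)))
  rw [e5, ← Complex.exp_add, ← Complex.exp_add, e2, e3]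
  congr 1
  simp only [Pi.div_apply]
  have hδ1 : Complex.exp (η k * w) = δ k + 1 := by rw [hδd]; ring
  rw [hδ1]
  generalize Complex.log (1 - Q k * δ k) = L
  have e7 : (1 + Q k)⁻¹ = η k ^ 3 * (B k : ℂ) ^ 2 := by
    field_simp [hQ1 k]
    linear_combination -e4
  rw [div_eq_mul_inv _ (1 + Q k), e7, ← e6]
  have hk0 : η k ≠ 0 := hη0 k
  have hk1 : Q k ≠ 0 := hQ0 k
  field_simp
  ring

end SaddleLimit

section ScaledLaguerre

lemma saddleHeight_eq_norm {A B : ℝ} (hA : 0 < A) (hB : 0 < B) (M n : ℕ) (ξ : ℝ) :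
    saddleHeight A B M n ξ = ‖saddleIntegrand A B M n ξ (-1)‖ := by
  have e : saddleIntegrand A B M n ξ (-1) = (saddleHeight A B M n ξ : ℝ) := by
    rw [saddleIntegrand, saddleHeight]
    push_cast
    rw [mul_neg_one, mul_neg, neg_neg]
    congr 3
    ring
  rw [e, Complex.norm_real, Real.norm_of_nonneg (saddleHeight_nonneg hA hB M n ξ)]

lemma continuous_saddleIntegrand (A B : ℝ) (M n : ℕ) (ξ : ℝ) :
    Continuous fun t : ℝ => saddleIntegrand A B M n ξ (Complex.I * (t + Complex.I)) := by
  unfold saddleIntegrand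
  fun_prop

lemma Ai_eq (x : ℝ) : Ai x = (2 * Real.pi)⁻¹ * (∫ t : ℝ, Complex.exp
    (-(Complex.I * (t + Complex.I)) ^ 3 / 3 + x * (Complex.I * (t + Complex.I)))).re := by
  have h : ∀ t : ℝ, Complex.exp (Complex.I * (t + Complex.I) ^ 3 / 3
      + Complex.I * x * (t + Complex.I)) = Complex.exp
      (-(Complex.I * (t + Complex.I)) ^ 3 / 3 + x * (Complex.I * (t + Complex.I))) := by
    intro t
    congr 1
    rw [mul_pow, Complex.I_pow_three]
    ring
  rw [Ai, one_div]
  simp only [h]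

lemma tendsto_one_sub_exp_neg_div {η : ℕ → ℝ} (hη : Tendsto η atTop (nhds 0)) (h0 : ∀ k, η k ≠ 0) :
    Tendsto (fun k => (1 - Real.exp (-η k)) / η k) atTop (nhds 1) := by
  have h : HasDerivAt (fun z : ℝ => 1 - Real.exp (-z)) 1 0 := by
    have := ((hasDerivAt_id (0 : ℝ)).neg.exp).const_sub 1
    simpa using this
  have h' := h.tendsto_slope.comp (tendsto_nhdsWithin_iff.2 ⟨hη, Eventually.of_forall h0⟩)
  refine h'.congr fun k => ?_
  simp [slope_def_field]

variable {A B : ℕ → ℝ} {M n : ℕ → ℕ} {q : ℝ}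

lemma exists_norm_saddleIntegrand_le (hA : ∀ k, 0 < A k) (hB : ∀ k, 0 < B k)
    (hM : ∀ k, (M k : ℝ) = A k ^ 2) (hn : ∀ k, (n k : ℝ) + 1 = B k ^ 2)
    (hBt : Tendsto B atTop atTop) (hq0 : 0 < q) (hq : Tendsto (fun k => B k / A k) atTop (nhds q))
    {S : ℝ} (hS : 0 ≤ S) :
    ∃ C, 0 < C ∧ ∀ᶠ k in atTop, ∀ ξ, -S ≤ ξ → ∀ t : ℝ, |saddleWidth (A k) (B k) * t| ≤ Real.pi →
      ‖saddleIntegrand (A k) (B k) (M k) (n k) ξ (Complex.I * (t + Complex.I))‖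
        ≤ C * Real.exp (-(ξ / 2)) * Real.exp (-(2 / Real.pi ^ 2) * t ^ 2) := by
  have hη := tendsto_saddleWidth hA hB hBt
  have hη0 : ∀ k, 0 < saddleWidth (A k) (B k) := fun k => saddleWidth_pos (hA k) (hB k)
  set η : ℕ → ℝ := fun k => saddleWidth (A k) (B k) with hηd
  have h1 := tendsto_one_sub_exp_neg_div hη fun k => (hη0 k).ne'
  have hx : Tendsto (fun k => Real.exp (-η k)) atTop (nhds 1) := by
    simpa using hη.neg.rexp
  have hy : Tendsto (fun k => B k / A k * (1 - Real.exp (-η k))) atTop (nhds 0) := by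
    simpa using hq.mul (hx.const_sub 1)
  have hF : Tendsto (fun k => Real.exp (-η k) * (((1 - Real.exp (-η k)) / η k) *
      ((2 + B k / A k * (1 - Real.exp (-η k))) / (1 + B k / A k * (1 - Real.exp (-η k))) ^ 2)
      - S * η k)) atTop (nhds 2) := by
    have := hx.mul ((h1.mul ((hy.const_add 2).div ((hy.const_add 1).pow 2) (by norm_num))).sub
      (hη.const_mul S))
    simpa using this
  have hH := (tendsto_saddleIntegrand hA hB hM hn hBt hq0 hq (tendsto_const_nhds (x := (0 : ℝ)))
    (-1)).norm
  set L := ‖Complex.exp (-(-1) ^ 3 / 3 + (0 : ℝ) * (-1))‖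
  refine ⟨(L + 1) * Real.exp S, by positivity, ?_⟩
  filter_upwards [hF.eventually_const_le (by norm_num : (1 : ℝ) < 2),
    h1.eventually_const_le (by norm_num : (1 / 2 : ℝ) < 1),
    hH.eventually_le_const (lt_add_one L)] with k hk1 hk2 hk3 ξ hξ t ht
  have hx1 : Real.exp (-η k) < 1 := Real.exp_lt_one_iff.2 (neg_lt_zero.2 (hη0 k))
  refine (norm_saddleIntegrand_le (hA k) (hB k) (hM k) (n k) ht ?_).trans ?_
  · refine hk1.trans ?_
    change _ ≤ Real.exp (-η k) * ((1 - ((1 + B k / A k * (1 - Real.exp (-η k))) ^ 2)⁻¹) /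
      (B k / A k * η k) + ξ * η k)
    refine mul_le_mul_of_nonneg_left ?_ (Real.exp_pos _).le
    have hqk := div_pos (hB k) (hA k)
    have := hη0 k
    have h2 : 0 < 1 + B k / A k * (1 - Real.exp (-η k)) := by
      have := mul_pos hqk (sub_pos.2 hx1)
      positivity
    have e : (1 - ((1 + B k / A k * (1 - Real.exp (-η k))) ^ 2)⁻¹) / (B k / A k * η k)
        = ((1 - Real.exp (-η k)) / η k) *
      ((2 + B k / A k * (1 - Real.exp (-η k))) / (1 + B k / A k * (1 - Real.exp (-η k))) ^ 2) := by
      generalize B k / A k = Q at *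
      generalize Real.exp (-η k) = x at *
      field_simp
      ring
    rw [e]
    nlinarith
  · rw [saddleHeight_eq (hA k) (hB k), saddleHeight_eq_norm (hA k) (hB k)]
    refine mul_le_mul_of_nonneg_right ?_ (Real.exp_pos _).le
    rw [mul_assoc (L + 1), ← Real.exp_add]
    refine mul_le_mul hk3 (Real.exp_le_exp.2 ?_) (Real.exp_pos _).le (by positivity)
    have h3 : (1 - Real.exp (-η k)) / η k ≤ 1 := by
      rw [div_le_one (hη0 k)]
      linarith [Real.add_one_le_exp (-η k)]
    change -((1 - Real.exp (-η k)) / η k * ξ) ≤ _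
    generalize (1 - Real.exp (-η k)) / η k = h at *
    rcases le_total 0 ξ with h4 | h4
    · nlinarith
    · nlinarith

lemma exists_abs_scaledLaguerre_le (hA : ∀ k, 0 < A k) (hB : ∀ k, 0 < B k)
    (hM : ∀ k, (M k : ℝ) = A k ^ 2) (hn : ∀ k, (n k : ℝ) + 1 = B k ^ 2)
    (hBt : Tendsto B atTop atTop) (hq0 : 0 < q) (hq : Tendsto (fun k => B k / A k) atTop (nhds q))
    {S : ℝ} (hS : 0 ≤ S) :
    ∃ C, 0 < C ∧ ∀ᶠ k in atTop, ∀ ξ, -S ≤ ξ →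
      |scaledLaguerre (A k) (B k) (M k) (n k) ξ| ≤ C * Real.exp (-(ξ / 2)) := by
  obtain ⟨C, hC, hev⟩ := exists_norm_saddleIntegrand_le hA hB hM hn hBt hq0 hq hS
  set J := ∫ t : ℝ, Real.exp (-(2 / Real.pi ^ 2) * t ^ 2) with hJ
  have hJi : Integrable fun t : ℝ => Real.exp (-(2 / Real.pi ^ 2) * t ^ 2) :=
    integrable_exp_neg_mul_sq (by positivity)
  have hJ0 : 0 < J := by
    rw [hJ, integral_gaussian]
    positivity
  refine ⟨(2 * Real.pi)⁻¹ * (C * J), by positivity, ?_⟩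
  filter_upwards [hev] with k hk ξ hξ
  have hη := saddleWidth_pos (hA k) (hB k)
  have h1 := two_pi_mul_scaledLaguerre (hA k) (hB k) (M k) (n k) ξ
  have h2 : ‖((2 * Real.pi * scaledLaguerre (A k) (B k) (M k) (n k) ξ : ℝ) : ℂ)‖
      ≤ C * Real.exp (-(ξ / 2)) * J := by
    rw [h1, intervalIntegral.integral_of_le (by
      have : 0 < Real.pi / saddleWidth (A k) (B k) := by positivity
      linarith)]
    calc _ ≤ ∫ t in Set.Ioc (-(Real.pi / saddleWidth (A k) (B k))) (Real.pi / saddleWidth (A k) (B k)),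
          C * Real.exp (-(ξ / 2)) * Real.exp (-(2 / Real.pi ^ 2) * t ^ 2) := by
          refine norm_integral_le_of_norm_le (hJi.const_mul _).integrableOn ?_
          refine (ae_restrict_iff' measurableSet_Ioc).2 (ae_of_all _ fun t ht => hk ξ hξ t ?_)
          rw [abs_mul, abs_of_pos hη, mul_comm, ← le_div_iff₀ hη, abs_le]
          exact ⟨ht.1.le, ht.2⟩
      _ ≤ ∫ t, C * Real.exp (-(ξ / 2)) * Real.exp (-(2 / Real.pi ^ 2) * t ^ 2) :=
          setIntegral_le_integral (hJi.const_mul _) (ae_of_all _ fun t => by positivity)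
      _ = _ := by rw [integral_const_mul]
  rw [Complex.norm_real, Real.norm_eq_abs, abs_mul, abs_of_pos Real.two_pi_pos] at h2
  rw [mul_assoc, inv_mul_eq_div, le_div_iff₀ Real.two_pi_pos]
  linarith

lemma tendsto_scaledLaguerre (hA : ∀ k, 0 < A k) (hB : ∀ k, 0 < B k)
    (hM : ∀ k, (M k : ℝ) = A k ^ 2) (hn : ∀ k, (n k : ℝ) + 1 = B k ^ 2)
    (hBt : Tendsto B atTop atTop) (hq0 : 0 < q) (hq : Tendsto (fun k => B k / A k) atTop (nhds q))
    {ξ : ℕ → ℝ} {ξ₀ : ℝ} (hξ : Tendsto ξ atTop (nhds ξ₀)) :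
    Tendsto (fun k => scaledLaguerre (A k) (B k) (M k) (n k) (ξ k)) atTop (nhds (Ai ξ₀)) := by
  have hη := tendsto_saddleWidth hA hB hBt
  have hη0 : ∀ k, 0 < saddleWidth (A k) (B k) := fun k => saddleWidth_pos (hA k) (hB k)
  set S := |ξ₀| + 1
  have hS : 0 ≤ S := by positivity
  have hξS : ∀ᶠ k in atTop, -S ≤ ξ k := by
    refine hξ.eventually_const_le ?_
    have := neg_abs_le ξ₀
    simp only [S]
    linarith
  obtain ⟨C, hC, hev⟩ := exists_norm_saddleIntegrand_le hA hB hM hn hBt hq0 hq hS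
  set I : ℕ → Set ℝ := fun k =>
    Set.Ioc (-(Real.pi / saddleWidth (A k) (B k))) (Real.pi / saddleWidth (A k) (B k)) with hI
  have hIt : ∀ k t, t ∈ I k → |saddleWidth (A k) (B k) * t| ≤ Real.pi := fun k t ht => by
    rw [abs_mul, abs_of_pos (hη0 k), mul_comm, ← le_div_iff₀ (hη0 k), abs_le]
    exact ⟨ht.1.le, ht.2⟩
  have h : Tendsto (fun k => ∫ t, (I k).indicator (fun t : ℝ =>
      saddleIntegrand (A k) (B k) (M k) (n k) (ξ k) (Complex.I * (t + Complex.I))) t) atTop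
      (nhds (∫ t : ℝ, Complex.exp
        (-(Complex.I * (t + Complex.I)) ^ 3 / 3 + ξ₀ * (Complex.I * (t + Complex.I))))) := by
    refine tendsto_integral_filter_of_dominated_convergence
      (fun t => C * Real.exp (S / 2) * Real.exp (-(2 / Real.pi ^ 2) * t ^ 2))
      (Eventually.of_forall fun k =>
        ((continuous_saddleIntegrand _ _ _ _ _).aestronglyMeasurable.indicator measurableSet_Ioc))
      ?_ ((integrable_exp_neg_mul_sq (by positivity)).const_mul _) (ae_of_all _ fun t => ?_)
    · filter_upwards [hev, hξS] with k hk hkS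
      refine ae_of_all _ fun t => ?_
      by_cases ht : t ∈ I k
      · rw [Set.indicator_of_mem ht]
        refine (hk (ξ k) hkS t (hIt k t ht)).trans ?_
        gcongr
        linarith
      · rw [Set.indicator_of_notMem ht, norm_zero]
        positivity
    · refine (tendsto_saddleIntegrand hA hB hM hn hBt hq0 hq hξ _).congr' ?_
      have h1 : Tendsto (fun k => saddleWidth (A k) (B k) * |t|) atTop (nhds 0) := by
        simpa using hη.mul_const |t|
      filter_upwards [h1.eventually_lt_const Real.pi_pos] with k hk
      rw [Set.indicator_of_mem]
      rw [mul_comm, ← lt_div_iff₀ (hη0 k), abs_lt] at hk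
      exact ⟨hk.1, hk.2.le⟩
  rw [Ai_eq]
  refine (((Complex.continuous_re.tendsto _).comp h).const_mul _).congr fun k => ?_
  have h1 := two_pi_mul_scaledLaguerre (hA k) (hB k) (M k) (n k) (ξ k)
  rw [intervalIntegral.integral_of_le (by
    have := div_pos Real.pi_pos (hη0 k)
    linarith)] at h1
  simp only [Function.comp]
  rw [integral_indicator measurableSet_Ioc, ← h1, Complex.ofReal_re, inv_mul_cancel_left₀ Real.two_pi_pos.ne']

end ScaledLaguerre

section ScaledKernel

lemma scaledLaguerre_mul {A B : ℝ} (hA : 0 < A) (hB : 0 < B) (m n : ℕ) (s x y : ℝ) :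
    scaledLaguerre A B (m + 1) n (s + x) * scaledLaguerre B A (n + 1) m (s + y) =
      edgeScale A B ^ 2 * Real.exp (B / (A + B) * edgeScale A B * (y - x)) * ((-1) ^ (n + m) *
        (laguerreCoeff (m + 1) n ((A + B) ^ 2 + edgeScale A B * s + edgeScale A B * x) *
          (Real.exp (-((A + B) ^ 2 + edgeScale A B * s + edgeScale A B * y)) *
            laguerreCoeff (n + 1) m ((A + B) ^ 2 + edgeScale A B * s + edgeScale A B * y)))) := by
  rw [scaledLaguerre, scaledLaguerre, edgeScale_comm B A, ← edgeScale_mul_eq hA hB,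
    ← edgeScale_mul_eq hB hA, edgeScale_comm B A, add_comm B A, mul_add, mul_add, ← add_assoc,
    ← add_assoc]
  set σ := edgeScale A B
  set X := (A + B) ^ 2 + σ * s + σ * x with hX
  set Y := (A + B) ^ 2 + σ * s + σ * y with hY
  have he : Real.exp (B / (A + B) * σ * (y - x)) * Real.exp (-Y)
      = Real.exp (-(X * (B / (A + B)))) * Real.exp (-(Y * (A / (A + B)))) := by
    rw [← Real.exp_add, ← Real.exp_add, hX, hY]
    congr 1
    field_simp
    ring
  have hr : 0 < B / (A + B) := by positivity
  have hq : 0 < A / (A + B) := by positivity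
  set r := B / (A + B)
  set q := A / (A + B)
  have hc : q * r ^ n * (q ^ (m + 1))⁻¹ * (r * q ^ m * (r ^ (n + 1))⁻¹) = 1 := by
    have := hr.ne'
    have := hq.ne'
    rw [pow_succ, pow_succ]
    field_simp
  rw [pow_add]
  linear_combination ((-1) ^ n * (-1) ^ m * σ ^ 2 * laguerreCoeff (m + 1) n X
    * laguerreCoeff (n + 1) m Y) * (Real.exp (-(X * r)) * Real.exp (-(Y * q)) * hc - he)

lemma continuous_laguerreCoeff (M n : ℕ) : Continuous (laguerreCoeff M n) := by
  obtain ⟨p, hp⟩ := exists_eval_eq_coeff_expSeries_neg_mul n ((1 + PowerSeries.X : PowerSeries ℝ) ^ M)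
  have : laguerreCoeff M n = fun y => p.eval y := funext fun y => by rw [laguerreCoeff, hp]
  rw [this]
  exact p.continuous

lemma continuous_scaledLaguerre (A B : ℝ) (M n : ℕ) : Continuous (scaledLaguerre A B M n) := by
  have := continuous_laguerreCoeff M n
  unfold scaledLaguerre
  fun_prop

/-- The determinant for the last-passage time as a Fredholm expansion in edge scaling. -/
lemma hasSum_det_residueSum_scaled {A B : ℝ} (hA : 0 < A) (hB : 0 < B) (m n : ℕ) (s : ℝ) :
    HasSum (fun k : ℕ => ((-1 : ℝ) ^ k / (Nat.factorial k)) *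
      ∫ ξ : Fin k → ℝ, Matrix.det (Matrix.of fun a b =>
        ∫ r in Set.Ioi 0, scaledLaguerre A B (m + 1) n (s + (ξ a + r)) *
          scaledLaguerre B A (n + 1) m (s + (ξ b + r)))
        ∂(Measure.pi fun _ => volume.restrict (Set.Ioi 0)))
      (Matrix.det (Matrix.of fun i j : Fin (n + 1) =>
        residueSum (m + 1) i j ((A + B) ^ 2 + edgeScale A B * s))) :=
  hasSum_det_residueSum m n _ _ (edgeScale_pos hA hB)
    (φ := fun x => scaledLaguerre A B (m + 1) n (s + x))
    (ψ := fun y => scaledLaguerre B A (n + 1) m (s + y)) (scaledLaguerre_mul hA hB m n s)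

end ScaledKernel

section Airy

/-- The integrand of the `j`-th derivative of the Airy function. -/
noncomputable def airyIntegrand (j : ℕ) (x t : ℝ) : ℂ :=
  (Complex.I * (t + Complex.I)) ^ j *
    Complex.exp (-(Complex.I * (t + Complex.I)) ^ 3 / 3 + x * (Complex.I * (t + Complex.I)))

/-- The `j`-th derivative of the Airy function. -/
noncomputable def airyDeriv (j : ℕ) (x : ℝ) : ℝ :=
  (2 * Real.pi)⁻¹ * (∫ t : ℝ, airyIntegrand j x t).re

lemma airyDeriv_zero : airyDeriv 0 = Ai := by
  funext x
  simp only [airyDeriv, airyIntegrand, pow_zero, one_mul, Ai_eq]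

lemma continuous_airyIntegrand (j : ℕ) (x : ℝ) : Continuous (airyIntegrand j x) := by
  unfold airyIntegrand
  fun_prop

lemma norm_airyIntegrand_le (j : ℕ) (x t : ℝ) :
    ‖airyIntegrand j x t‖ ≤ j.factorial * Real.exp 2 * Real.exp (-x) * Real.exp (-(1 / 2) * t ^ 2) := by
  have hw : ‖Complex.I * (t + Complex.I)‖ ≤ |t| + 1 := by
    rw [norm_mul, Complex.norm_I, one_mul]
    refine (norm_add_le _ _).trans ?_
    rw [Complex.norm_real, Complex.norm_I, Real.norm_eq_abs]
  have hre : (-(Complex.I * (t + Complex.I)) ^ 3 / 3 + x * (Complex.I * (t + Complex.I))).re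
      = 1 / 3 - t ^ 2 - x := by
    have : -(Complex.I * (t + Complex.I)) ^ 3 / 3 + x * (Complex.I * (t + Complex.I))
        = ((1 / 3 - t ^ 2 - x : ℝ) : ℂ) + ((t ^ 3 / 3 - t + x * t : ℝ) : ℂ) * Complex.I := by
      push_cast
      linear_combination (-(1 / 3) * t ^ 3 * Complex.I - t ^ 2 * (Complex.I ^ 2 - 1)
        - t * Complex.I * (Complex.I ^ 2 - 1) - (Complex.I ^ 4 - Complex.I ^ 2 + 1) / 3 + x) * Complex.I_sq
    rw [this, Complex.add_re, Complex.ofReal_re, Complex.re_ofReal_mul, Complex.I_re, mul_zero,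
      add_zero]
  have hp : ‖Complex.I * (t + Complex.I)‖ ^ j ≤ j.factorial * Real.exp (|t| + 1) := by
    have h1 := Real.pow_div_factorial_le_exp _ (by positivity : 0 ≤ |t| + 1) j
    rw [div_le_iff₀ (by positivity), mul_comm] at h1
    exact (pow_le_pow_left₀ (norm_nonneg _) hw j).trans h1
  rw [airyIntegrand, norm_mul, norm_pow, Complex.norm_exp, hre]
  calc _ ≤ j.factorial * Real.exp (|t| + 1) * Real.exp (1 / 3 - t ^ 2 - x) := by gcongr
    _ = j.factorial * Real.exp (|t| + 1 + (1 / 3 - t ^ 2 - x)) := by rw [mul_assoc, ← Real.exp_add]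
    _ ≤ j.factorial * Real.exp (2 + -x + -(1 / 2) * t ^ 2) := by
        refine mul_le_mul_of_nonneg_left (Real.exp_le_exp.2 ?_) (Nat.cast_nonneg _)
        nlinarith [sq_nonneg (|t| - 1), sq_abs t]
    _ = _ := by rw [Real.exp_add, Real.exp_add]; ring

lemma integrable_airyIntegrand (j : ℕ) (x : ℝ) : Integrable (airyIntegrand j x) :=
  Integrable.mono' ((integrable_exp_neg_mul_sq (by norm_num : (0 : ℝ) < 1 / 2)).const_mul
    (j.factorial * Real.exp 2 * Real.exp (-x)))
    (continuous_airyIntegrand j x).aestronglyMeasurable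
    (ae_of_all _ fun t => norm_airyIntegrand_le j x t)

lemma exists_abs_airyDeriv_le (j : ℕ) : ∃ C, 0 < C ∧ ∀ x, |airyDeriv j x| ≤ C * Real.exp (-x) := by
  refine ⟨(2 * Real.pi)⁻¹ * (j.factorial * Real.exp 2 * ∫ t : ℝ, Real.exp (-(1 / 2) * t ^ 2)),
    ?_, fun x => ?_⟩
  · rw [integral_gaussian]
    positivity
  · rw [airyDeriv, abs_mul, abs_of_pos (by positivity), mul_assoc]
    gcongr
    refine (Complex.abs_re_le_norm _).trans ((norm_integral_le_integral_norm _).trans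
      ((integral_mono (integrable_airyIntegrand j x).norm
        ((integrable_exp_neg_mul_sq (by norm_num : (0 : ℝ) < 1 / 2)).const_mul
          (j.factorial * Real.exp 2 * Real.exp (-x))) (norm_airyIntegrand_le j x)).trans_eq ?_))
    rw [integral_const_mul]
    ring

lemma hasDerivAt_airyDeriv (j : ℕ) (x : ℝ) : HasDerivAt (airyDeriv j) (airyDeriv (j + 1) x) x := by
  have h := (hasDerivAt_integral_of_dominated_loc_of_deriv_le (F := airyIntegrand j)
    (F' := airyIntegrand (j + 1)) (x₀ := x) (s := Set.Ioi (x - 1)) (μ := volume)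
    (bound := fun t => (j + 1).factorial * Real.exp 2 * Real.exp (-(x - 1))
      * Real.exp (-(1 / 2) * t ^ 2)) (Ioi_mem_nhds (by linarith))
    (Eventually.of_forall fun y => (continuous_airyIntegrand j y).aestronglyMeasurable)
    (integrable_airyIntegrand j x) (continuous_airyIntegrand (j + 1) x).aestronglyMeasurable
    (ae_of_all _ fun t y hy => (norm_airyIntegrand_le (j + 1) y t).trans (by
      have : x - 1 < y := hy
      gcongr))
    ((integrable_exp_neg_mul_sq (by norm_num : (0 : ℝ) < 1 / 2)).const_mul _)
    (ae_of_all _ fun t y _ => ?_)).2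
  · exact ((Complex.reCLM.hasFDerivAt.comp_hasDerivAt x h).const_mul (2 * Real.pi)⁻¹)
  · have h1 : HasDerivAt (fun y : ℝ => (y : ℂ)) 1 y := Complex.ofRealCLM.hasDerivAt
    refine ((((h1.mul_const (Complex.I * (t + Complex.I))).const_add
      (-(Complex.I * (t + Complex.I)) ^ 3 / 3)).cexp).const_mul
      ((Complex.I * (t + Complex.I)) ^ j)).congr_deriv ?_
    rw [airyIntegrand]
    ring

lemma airyDeriv_two (x : ℝ) : airyDeriv 2 x = x * airyDeriv 0 x := by
  have hd : ∀ t : ℝ, HasDerivAt (airyIntegrand 0 x)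
      (Complex.I * (x * airyIntegrand 0 x t - airyIntegrand 2 x t)) t := by
    intro t
    have h1 : HasDerivAt (fun y : ℝ => (y : ℂ)) 1 t := Complex.ofRealCLM.hasDerivAt
    have h2 := (h1.add_const Complex.I).const_mul Complex.I
    refine ((((h2.pow 3).neg.div_const 3).add (h2.const_mul (x : ℂ))).cexp.const_mul
      1).congr_deriv ?_ |>.congr_of_eventuallyEq ?_
    · simp only [airyIntegrand, Pi.pow_apply, Pi.add_apply, Pi.neg_apply]
      push_cast
      ring
    · filter_upwards with y
      simp [airyIntegrand]
  have hint : Integrable fun t => x * airyIntegrand 0 x t - airyIntegrand 2 x t :=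
    ((integrable_airyIntegrand 0 x).const_mul _).sub (integrable_airyIntegrand 2 x)
  have h0 := integral_eq_zero_of_hasDerivAt_of_integrable hd (hint.const_mul _)
    (integrable_airyIntegrand 0 x)
  rw [integral_const_mul, mul_eq_zero, or_iff_right Complex.I_ne_zero,
    integral_sub ((integrable_airyIntegrand 0 x).const_mul _) (integrable_airyIntegrand 2 x),
    integral_const_mul, sub_eq_zero] at h0
  rw [airyDeriv, airyDeriv, ← h0, Complex.re_ofReal_mul]
  ring

lemma deriv_Ai : deriv Ai = airyDeriv 1 := by
  funext x
  rw [← airyDeriv_zero]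
  exact (hasDerivAt_airyDeriv 0 x).deriv

lemma deriv_deriv_Ai : deriv (deriv Ai) = airyDeriv 2 := by
  funext x
  rw [deriv_Ai]
  exact (hasDerivAt_airyDeriv 1 x).deriv

lemma hasDerivAt_Ai (x : ℝ) : HasDerivAt Ai (airyDeriv 1 x) x :=
  airyDeriv_zero ▸ hasDerivAt_airyDeriv 0 x

lemma hasDerivAt_airyDeriv_one (x : ℝ) : HasDerivAt (airyDeriv 1) (x * Ai x) x := by
  rw [← airyDeriv_zero, ← airyDeriv_two]
  exact hasDerivAt_airyDeriv 1 x

lemma continuous_Ai : Continuous Ai :=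
  continuous_iff_continuousAt.2 fun x => (hasDerivAt_Ai x).continuousAt

lemma exists_abs_Ai_le : ∃ C, 0 < C ∧ ∀ x, |Ai x| ≤ C * Real.exp (-x) :=
  airyDeriv_zero ▸ exists_abs_airyDeriv_le 0

lemma tendsto_airyDeriv (j : ℕ) (x : ℝ) :
    Tendsto (fun r => airyDeriv j (x + r)) atTop (nhds 0) := by
  obtain ⟨C, -, h⟩ := exists_abs_airyDeriv_le j
  refine squeeze_zero_norm (fun r => h _) ?_
  rw [← mul_zero C]
  exact ((Real.tendsto_exp_neg_atTop_nhds_zero).comp (tendsto_atTop_add_const_left _ _ tendsto_id)).const_mul C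

lemma integrableOn_Ai_mul_Ai (x y : ℝ) :
    IntegrableOn (fun r => Ai (x + r) * Ai (y + r)) (Set.Ioi 0) := by
  obtain ⟨C, hC, h⟩ := exists_abs_Ai_le
  refine Integrable.mono' ((exp_neg_integrableOn_Ioi 0 (by norm_num : (0 : ℝ) < 2)).const_mul
    (C * C * Real.exp (-x) * Real.exp (-y))) ?_ (ae_of_all _ fun r => ?_)
  · exact ((continuous_Ai.comp (by fun_prop : Continuous fun r : ℝ => x + r)).mul
      (continuous_Ai.comp (by fun_prop : Continuous fun r : ℝ => y + r))).aestronglyMeasurable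
  · rw [norm_mul, Real.norm_eq_abs, Real.norm_eq_abs]
    calc _ ≤ (C * Real.exp (-(x + r))) * (C * Real.exp (-(y + r))) :=
          mul_le_mul (h _) (h _) (abs_nonneg _) (by positivity)
      _ = C * C * (Real.exp (-(x + r)) * Real.exp (-(y + r))) := by ring
      _ = C * C * (Real.exp (-x) * (Real.exp (-y) * Real.exp (-2 * r))) := by
          rw [← Real.exp_add, ← Real.exp_add, ← Real.exp_add]
          congr 2
          ring
      _ = _ := by ring

lemma airyKernel_eq_integral (x y : ℝ) :
    airyKernel x y = ∫ r in Set.Ioi 0, Ai (x + r) * Ai (y + r) := by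
  have d0 : ∀ x r : ℝ, HasDerivAt (fun r => Ai (x + r)) (airyDeriv 1 (x + r)) r := fun x r =>
    (hasDerivAt_Ai (x + r)).comp_const_add x r
  have d1 : ∀ x r : ℝ, HasDerivAt (fun r => airyDeriv 1 (x + r)) ((x + r) * Ai (x + r)) r :=
    fun x r => (hasDerivAt_airyDeriv_one (x + r)).comp_const_add x r
  have t0 : ∀ x : ℝ, Tendsto (fun r => Ai (x + r)) atTop (nhds 0) := fun x =>
    airyDeriv_zero ▸ tendsto_airyDeriv 0 x
  rw [airyKernel, deriv_deriv_Ai, deriv_Ai]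
  split_ifs with hxy
  · subst hxy
    have h := integral_Ioi_of_hasDerivAt_of_tendsto' (a := 0) (m := 0)
      (f := fun r => airyDeriv 1 (x + r) ^ 2 - (x + r) * Ai (x + r) ^ 2)
      (f' := fun r => -(Ai (x + r) * Ai (x + r)))
      (fun r _ => (((d1 x r).fun_pow 2).sub (((hasDerivAt_id r).const_add x).mul
        ((d0 x r).fun_pow 2))).congr_deriv (by simp; ring))
      (integrableOn_Ai_mul_Ai x x).neg (by
        have h2 := (((tendsto_airyDeriv 1 x).pow 2).sub ((tendsto_airyDeriv 2 x).mul (t0 x)))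
        simp only [airyDeriv_two, airyDeriv_zero] at h2
        refine (h2.congr fun r => ?_).trans (by simp)
        ring)
    rw [integral_neg] at h
    rw [airyDeriv_two, airyDeriv_zero]
    simp only [add_zero] at h
    linear_combination h
  · have hne : x - y ≠ 0 := sub_ne_zero.2 hxy
    have h := integral_Ioi_of_hasDerivAt_of_tendsto' (a := 0) (m := 0)
      (f := fun r => (Ai (x + r) * airyDeriv 1 (y + r) - airyDeriv 1 (x + r) * Ai (y + r)) / (x - y))
      (f' := fun r => -(Ai (x + r) * Ai (y + r)))
      (fun r _ => ((((d0 x r).mul (d1 y r)).sub ((d1 x r).mul (d0 y r))).div_const _).congr_deriv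
        (by field_simp; ring))
      (integrableOn_Ai_mul_Ai x y).neg (by
        have h2 := ((((t0 x).mul (tendsto_airyDeriv 1 y)).sub ((tendsto_airyDeriv 1 x).mul (t0 y))).div_const (x - y))
        simpa using h2)
    rw [integral_neg] at h
    simp only [add_zero] at h
    linear_combination h

end Airy

section Hadamard

lemma abs_det_le_prod_norm {k : ℕ} (A : Matrix (Fin k) (Fin k) ℝ) :
    |A.det| ≤ ∏ i, ‖WithLp.toLp 2 (fun j => A j i)‖ := by
  set b := EuclideanSpace.basisFun (Fin k) ℝ
  have : Fact (Module.finrank ℝ (EuclideanSpace ℝ (Fin k)) = k) := ⟨finrank_euclideanSpace_fin⟩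
  have h := b.toBasis.orientation.abs_volumeForm_apply_le
    fun i => (WithLp.toLp 2 (fun j => A j i) : EuclideanSpace ℝ (Fin k))
  rw [Orientation.volumeForm_robust _ b rfl, Module.Basis.det_apply] at h
  convert h using 3
  ext i j
  simp [Module.Basis.toMatrix_apply, b]

lemma abs_det_le_of_abs_le_one {k : ℕ} {A : Matrix (Fin k) (Fin k) ℝ} (h : ∀ i j, |A i j| ≤ 1) :
    |A.det| ≤ √k ^ k := by
  refine (abs_det_le_prod_norm A).trans ((Finset.prod_le_prod (fun i _ => norm_nonneg _)
    fun i _ => ?_).trans_eq (by rw [Finset.prod_const, Finset.card_univ, Fintype.card_fin]))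
  rw [EuclideanSpace.norm_eq]
  refine Real.sqrt_le_sqrt ((Finset.sum_le_sum fun j _ => ?_).trans_eq
    (by rw [Finset.sum_const, Finset.card_univ, Fintype.card_fin, nsmul_one]))
  exact pow_le_one₀ (norm_nonneg _) (h j i)

lemma abs_det_le_of_abs_le_mul {k : ℕ} {A : Matrix (Fin k) (Fin k) ℝ} {p q : Fin k → ℝ}
    (hp : ∀ i, 0 < p i) (hq : ∀ i, 0 < q i) (h : ∀ i j, |A i j| ≤ p i * q j) :
    |A.det| ≤ √k ^ k * ∏ i, p i * q i := by
  set B : Matrix (Fin k) (Fin k) ℝ := Matrix.of fun i j => (p i * q j)⁻¹ * A i j with hB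
  have e : A = Matrix.of fun i j => p i * (Matrix.of fun i j => q j * B i j) i j := by
    ext i j
    have := (hp i).ne'
    have := (hq j).ne'
    simp only [hB, Matrix.of_apply]
    field_simp
  have hdet : A.det = (∏ i, p i) * ((∏ i, q i) * B.det) := by
    rw [← Matrix.det_mul_row, ← Matrix.det_mul_column, ← e]
  have hB1 : |B.det| ≤ √k ^ k := by
    refine abs_det_le_of_abs_le_one fun i j => ?_
    have := mul_pos (hp i) (hq j)
    rw [hB, Matrix.of_apply, abs_mul, abs_inv, abs_of_pos this, inv_mul_le_iff₀ this, mul_one]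
    exact h i j
  rw [hdet, abs_mul, abs_mul, abs_of_pos (Finset.prod_pos fun i _ => hp i),
    abs_of_pos (Finset.prod_pos fun i _ => hq i), Finset.prod_mul_distrib, ← mul_assoc, mul_comm]
  exact mul_le_mul_of_nonneg_right hB1 (mul_nonneg (Finset.prod_nonneg fun i _ => (hp i).le)
    (Finset.prod_nonneg fun i _ => (hq i).le))

lemma summable_sqrt_pow_mul_pow_div_factorial {D : ℝ} (hD : 0 ≤ D) :
    Summable fun k : ℕ => √k ^ k * D ^ k / k.factorial := by
  refine Summable.of_nonneg_of_le (fun k => by positivity) (fun k => ?_)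
    ((Real.summable_pow_div_factorial (2 * Real.exp 1 * D ^ 2)).add
      (summable_geometric_of_lt_one (by norm_num) (by norm_num : (1 / 2 : ℝ) < 1)))
  set w := (2 * Real.exp 1 * D ^ 2) ^ k / k.factorial with hw
  have hw0 : 0 ≤ w := by positivity
  have hv0 : (0 : ℝ) ≤ (1 / 2) ^ k := by positivity
  have h1 := Real.pow_div_factorial_le_exp (k : ℝ) (Nat.cast_nonneg k) k
  rw [← Real.exp_one_pow] at h1
  have h2 : (√k ^ k * D ^ k / k.factorial) ^ 2 ≤ w * (1 / 2) ^ k := by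
    calc (√k ^ k * D ^ k / k.factorial) ^ 2
        = (k : ℝ) ^ k / k.factorial * (D ^ 2) ^ k / k.factorial := by
          rw [div_pow, mul_pow, ← pow_mul, ← pow_mul, mul_comm k 2, pow_mul, pow_mul,
            Real.sq_sqrt (Nat.cast_nonneg k)]
          field_simp
      _ ≤ Real.exp 1 ^ k * (D ^ 2) ^ k / k.factorial := by gcongr
      _ = w * (1 / 2) ^ k := by
          rw [hw, mul_pow, mul_pow, one_div, inv_pow]
          field_simp
  refine (sq_le_sq₀ (by positivity) (by positivity)).1 (h2.trans ?_)
  nlinarith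

end Hadamard

section Fredholm

/-- The kernel of a product of two Hankel operators on the half-line. -/
noncomputable def hankelKernel (φ ψ : ℝ → ℝ) (x y : ℝ) : ℝ :=
  ∫ r in Set.Ioi 0, φ (x + r) * ψ (y + r)

/-- The Fredholm determinant on the half-line of the product of two Hankel operators. -/
noncomputable def hankelFredholm (φ ψ : ℝ → ℝ) : ℝ :=
  ∑' k : ℕ, ((-1 : ℝ) ^ k / (Nat.factorial k)) *
    ∫ ξ : Fin k → ℝ, Matrix.det (Matrix.of fun a b => hankelKernel φ ψ (ξ a) (ξ b))
      ∂(Measure.pi fun _ => volume.restrict (Set.Ioi 0))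

variable {φ ψ : ℝ → ℝ} {C : ℝ}

lemma abs_mul_le_exp (hφ : ∀ x, 0 < x → |φ x| ≤ C * Real.exp (-(x / 2)))
    (hψ : ∀ x, 0 < x → |ψ x| ≤ C * Real.exp (-(x / 2))) {x y r : ℝ} (hx : 0 < x) (hy : 0 < y)
    (hr : 0 < r) : |φ (x + r) * ψ (y + r)|
      ≤ C * Real.exp (-(x / 2)) * (C * Real.exp (-(y / 2))) * Real.exp (-r) := by
  rw [abs_mul]
  calc _ ≤ C * Real.exp (-((x + r) / 2)) * (C * Real.exp (-((y + r) / 2))) :=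
        mul_le_mul (hφ _ (by positivity)) (hψ _ (by positivity)) (abs_nonneg _)
          ((abs_nonneg _).trans (hφ (x + r) (by positivity)))
    _ = C * C * (Real.exp (-((x + r) / 2)) * Real.exp (-((y + r) / 2))) := by ring
    _ = C * C * (Real.exp (-(x / 2)) * (Real.exp (-(y / 2)) * Real.exp (-r))) := by
        rw [← Real.exp_add, ← Real.exp_add, ← Real.exp_add]
        congr 2
        ring
    _ = _ := by ring

lemma integrableOn_exp_neg_Ioi_zero : IntegrableOn (fun r : ℝ => Real.exp (-r)) (Set.Ioi 0) := by
  simpa using exp_neg_integrableOn_Ioi 0 (one_pos : (0 : ℝ) < 1)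

lemma abs_hankelKernel_le (hφ : ∀ x, 0 < x → |φ x| ≤ C * Real.exp (-(x / 2)))
    (hψ : ∀ x, 0 < x → |ψ x| ≤ C * Real.exp (-(x / 2))) {x y : ℝ} (hx : 0 < x) (hy : 0 < y) :
    |hankelKernel φ ψ x y| ≤ C * Real.exp (-(x / 2)) * (C * Real.exp (-(y / 2))) := by
  rw [← Real.norm_eq_abs, hankelKernel]
  refine (norm_integral_le_of_norm_le (integrableOn_exp_neg_Ioi_zero.const_mul
    (C * Real.exp (-(x / 2)) * (C * Real.exp (-(y / 2))))) ?_).trans_eq ?_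
  · filter_upwards [ae_restrict_mem measurableSet_Ioi] with r hr
    exact abs_mul_le_exp hφ hψ hx hy hr
  · rw [integral_const_mul, integral_exp_neg_Ioi, neg_zero, Real.exp_zero, mul_one]

lemma stronglyMeasurable_hankelKernel (hφ : Continuous φ) (hψ : Continuous ψ) :
    StronglyMeasurable (Function.uncurry (hankelKernel φ ψ)) := by
  refine StronglyMeasurable.integral_prod_right
    (f := fun (p : ℝ × ℝ) (r : ℝ) => φ (p.1 + r) * ψ (p.2 + r)) (Continuous.stronglyMeasurable ?_)
  unfold Function.uncurry
  fun_prop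

lemma measurable_det_hankelKernel (hφ : Continuous φ) (hψ : Continuous ψ) (k : ℕ) :
    Measurable fun ξ : Fin k → ℝ =>
      Matrix.det (Matrix.of fun a b => hankelKernel φ ψ (ξ a) (ξ b)) := by
  have h := (stronglyMeasurable_hankelKernel hφ hψ).measurable
  simp only [Matrix.det_apply, Matrix.of_apply]
  refine Finset.measurable_sum _ fun σ _ => Measurable.const_smul (Finset.measurable_prod _ fun i _ => ?_) _
  exact h.comp (g := Function.uncurry (hankelKernel φ ψ)) (f := fun ξ : Fin k → ℝ => (ξ (σ i), ξ i))
    ((measurable_pi_apply (σ i)).prodMk (measurable_pi_apply i))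

lemma ae_pi_restrict_Ioi (k : ℕ) :
    ∀ᵐ ξ : Fin k → ℝ ∂(Measure.pi fun _ => volume.restrict (Set.Ioi 0)), ∀ i, 0 < ξ i := by
  rw [← Measure.restrict_pi_pi, ae_restrict_iff' (MeasurableSet.univ_pi fun _ => measurableSet_Ioi)]
  exact ae_of_all _ fun ξ hξ i => hξ i (Set.mem_univ i)

lemma abs_det_hankelKernel_le (hC : 0 < C) (hφ : ∀ x, 0 < x → |φ x| ≤ C * Real.exp (-(x / 2)))
    (hψ : ∀ x, 0 < x → |ψ x| ≤ C * Real.exp (-(x / 2))) {k : ℕ} {ξ : Fin k → ℝ}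
    (hξ : ∀ i, 0 < ξ i) :
    |Matrix.det (Matrix.of fun a b => hankelKernel φ ψ (ξ a) (ξ b))|
      ≤ √k ^ k * (C ^ 2) ^ k * ∏ i, Real.exp (-ξ i) := by
  refine (abs_det_le_of_abs_le_mul (p := fun i => C * Real.exp (-(ξ i / 2)))
    (q := fun i => C * Real.exp (-(ξ i / 2))) (fun i => by positivity) (fun i => by positivity)
    fun i j => abs_hankelKernel_le hφ hψ (hξ i) (hξ j)).trans_eq ?_
  have h : ∀ i, C * Real.exp (-(ξ i / 2)) * (C * Real.exp (-(ξ i / 2))) = C ^ 2 * Real.exp (-ξ i) := by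
    intro i
    rw [mul_mul_mul_comm, ← Real.exp_add, ← sq]
    congr 2
    ring
  simp only [h, Finset.prod_mul_distrib, Finset.prod_const, Finset.card_univ, Fintype.card_fin]
  ring

lemma integrable_prod_exp_neg (k : ℕ) : Integrable (fun ξ : Fin k → ℝ => ∏ i, Real.exp (-ξ i))
    (Measure.pi fun _ => volume.restrict (Set.Ioi 0)) :=
  Integrable.fintype_prod (f := fun _ x => Real.exp (-x)) fun _ => integrableOn_exp_neg_Ioi_zero

lemma integral_prod_exp_neg (k : ℕ) : (∫ ξ : Fin k → ℝ, ∏ i, Real.exp (-ξ i)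
    ∂(Measure.pi fun _ => volume.restrict (Set.Ioi 0))) = 1 := by
  rw [integral_fintype_prod_eq_prod (fun _ x => Real.exp (-x))]
  simp only [integral_exp_neg_Ioi, neg_zero, Real.exp_zero, Finset.prod_const_one]

/-- Dominated convergence for Fredholm determinants of products of Hankel operators. -/
lemma tendsto_hankelFredholm {φ ψ : ℕ → ℝ → ℝ} {f g : ℝ → ℝ} (hC : 0 < C)
    (hφc : ∀ n, Continuous (φ n)) (hψc : ∀ n, Continuous (ψ n))
    (hφ : ∀ᶠ n in atTop, ∀ x, 0 < x → |φ n x| ≤ C * Real.exp (-(x / 2)))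
    (hψ : ∀ᶠ n in atTop, ∀ x, 0 < x → |ψ n x| ≤ C * Real.exp (-(x / 2)))
    (hf : ∀ x, Tendsto (fun n => φ n x) atTop (nhds (f x)))
    (hg : ∀ x, Tendsto (fun n => ψ n x) atTop (nhds (g x))) :
    Tendsto (fun n => hankelFredholm (φ n) (ψ n)) atTop (nhds (hankelFredholm f g)) := by
  have hK : ∀ x y, 0 < x → 0 < y → Tendsto (fun n => hankelKernel (φ n) (ψ n) x y) atTop
      (nhds (hankelKernel f g x y)) := by
    intro x y hx hy
    refine tendsto_integral_filter_of_dominated_convergence _ (Eventually.of_forall fun n => ?_) ?_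
      (integrableOn_exp_neg_Ioi_zero.const_mul
        (C * Real.exp (-(x / 2)) * (C * Real.exp (-(y / 2)))))
      (ae_of_all _ fun r => (hf _).mul (hg _))
    · have := hφc n
      have := hψc n
      exact Continuous.aestronglyMeasurable (by fun_prop)
    · filter_upwards [hφ, hψ] with n h1 h2
      filter_upwards [ae_restrict_mem measurableSet_Ioi] with r hr
      exact abs_mul_le_exp h1 h2 hx hy hr
  have hdet : ∀ᶠ n in atTop, ∀ k : ℕ, ∀ ξ : Fin k → ℝ, (∀ i, 0 < ξ i) →
      |Matrix.det (Matrix.of fun a b => hankelKernel (φ n) (ψ n) (ξ a) (ξ b))|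
        ≤ √k ^ k * (C ^ 2) ^ k * ∏ i, Real.exp (-ξ i) := by
    filter_upwards [hφ, hψ] with n h1 h2 k ξ hξ
    exact abs_det_hankelKernel_le hC h1 h2 hξ
  refine tendsto_tsum_of_dominated_convergence
    (summable_sqrt_pow_mul_pow_div_factorial (sq_nonneg C)) (fun k => Tendsto.const_mul _ ?_) ?_
  · refine tendsto_integral_filter_of_dominated_convergence _
      (Eventually.of_forall fun n =>
        (measurable_det_hankelKernel (hφc n) (hψc n) k).aestronglyMeasurable) ?_
      ((integrable_prod_exp_neg k).const_mul (√k ^ k * (C ^ 2) ^ k)) ?_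
    · filter_upwards [hdet] with n h
      filter_upwards [ae_pi_restrict_Ioi k] with ξ hξ
      exact h k ξ hξ
    · filter_upwards [ae_pi_restrict_Ioi k] with ξ hξ
      simp only [Matrix.det_apply, Matrix.of_apply]
      exact tendsto_finsetSum _ fun σ _ => Tendsto.const_smul
        (tendsto_finsetProd _ fun i _ => hK _ _ (hξ _) (hξ _)) _
  · filter_upwards [hdet] with n h k
    rw [norm_mul, norm_div, norm_pow, norm_neg, norm_one, one_pow, RCLike.norm_natCast,
      one_div_mul_eq_div]
    gcongr
    refine (norm_integral_le_of_norm_le ((integrable_prod_exp_neg k).const_mul (√k ^ k * (C ^ 2) ^ k))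
      ?_).trans_eq ?_
    · filter_upwards [ae_pi_restrict_Ioi k] with ξ hξ
      exact h k ξ hξ
    · rw [integral_const_mul, integral_prod_exp_neg, mul_one]

lemma TW_eq_hankelFredholm (s : ℝ) :
    TW s = hankelFredholm (fun x => Ai (s + x)) (fun x => Ai (s + x)) := by
  rw [TW, hankelFredholm]
  congr 1
  funext k
  congr 1
  have h1 : MeasurePreserving (fun x : ℝ => s + x) volume volume := measurePreserving_add_left volume s
  have h2 : MeasurePreserving (fun (ξ : Fin k → ℝ) i => s + ξ i) volume volume :=
    measurePreserving_pi _ _ fun _ => h1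
  have h3 : MeasurableEmbedding (fun (ξ : Fin k → ℝ) i => s + ξ i) :=
    (MeasurableEquiv.piCongrRight fun _ : Fin k => MeasurableEquiv.addLeft s).measurableEmbedding
  rw [← h2.setIntegral_preimage_emb h3]
  have h4 : (fun (ξ : Fin k → ℝ) i => s + ξ i) ⁻¹' {ξ | ∀ i, s ≤ ξ i}
      = Set.univ.pi fun _ => Set.Ici 0 := by
    ext ξ
    simp only [Set.mem_preimage, Set.mem_ofPred_eq, Set.mem_univ_pi, Set.mem_Ici,
      le_add_iff_nonneg_right]
  rw [h4, volume_pi, Measure.restrict_pi_pi]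
  simp only [← Measure.restrict_congr_set (Ioi_ae_eq_Ici (a := (0 : ℝ)) (μ := volume))]
  simp only [airyKernel_eq_integral, hankelKernel, add_assoc]

end Fredholm

section EdgeLimit

/-- The finite determinants for the last-passage time converge to the Tracy–Widom distribution
in edge scaling. -/
lemma tendsto_det_residueSum {m n : ℕ → ℕ} (hm : Tendsto m atTop atTop) (hn : Tendsto n atTop atTop)
    {q : ℝ} (hq0 : 0 < q) (hq : Tendsto (fun k => √((n k : ℝ) + 1) / √((m k : ℝ) + 1)) atTop (nhds q))
    {s : ℕ → ℝ} {s₀ : ℝ} (hs : Tendsto s atTop (nhds s₀)) :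
    Tendsto (fun k => Matrix.det (Matrix.of fun i j : Fin (n k + 1) => residueSum (m k + 1) i j
      ((√((m k : ℝ) + 1) + √((n k : ℝ) + 1)) ^ 2
        + edgeScale √((m k : ℝ) + 1) √((n k : ℝ) + 1) * s k))) atTop (nhds (TW s₀)) := by
  set A : ℕ → ℝ := fun k => √((m k : ℝ) + 1) with hA'
  set B : ℕ → ℝ := fun k => √((n k : ℝ) + 1) with hB'
  have hA : ∀ k, 0 < A k := fun k => Real.sqrt_pos.2 (by positivity)
  have hB : ∀ k, 0 < B k := fun k => Real.sqrt_pos.2 (by positivity)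
  have hA2 : ∀ k, (m k : ℝ) + 1 = A k ^ 2 := fun k => (Real.sq_sqrt (by positivity)).symm
  have hB2 : ∀ k, (n k : ℝ) + 1 = B k ^ 2 := fun k => (Real.sq_sqrt (by positivity)).symm
  have hAt : Tendsto A atTop atTop := Real.tendsto_sqrt_atTop.comp
    (tendsto_atTop_add_const_right _ _ (tendsto_natCast_atTop_atTop.comp hm))
  have hBt : Tendsto B atTop atTop := Real.tendsto_sqrt_atTop.comp
    (tendsto_atTop_add_const_right _ _ (tendsto_natCast_atTop_atTop.comp hn))
  have hA3 : ∀ k, ((m k + 1 : ℕ) : ℝ) = A k ^ 2 := fun k => by rw [← hA2]; push_cast; rfl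
  have hB3 : ∀ k, ((n k + 1 : ℕ) : ℝ) = B k ^ 2 := fun k => by rw [← hB2]; push_cast; rfl
  have hq' : Tendsto (fun k => A k / B k) atTop (nhds q⁻¹) :=
    (hq.inv₀ hq0.ne').congr fun k => by rw [inv_div]
  set S := |s₀| + 1
  have hS : 0 ≤ S := by positivity
  have hsS : ∀ᶠ k in atTop, -S ≤ s k := by
    filter_upwards [hs.eventually_const_lt (sub_one_lt s₀)] with k hk
    have := neg_abs_le s₀
    simp only [S]
    linarith
  obtain ⟨C₁, hC₁, h₁⟩ := exists_abs_scaledLaguerre_le hA hB hA3 hB2 hBt hq0 hq hS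
  obtain ⟨C₂, hC₂, h₂⟩ := exists_abs_scaledLaguerre_le hB hA hB3 hA2 hAt (inv_pos.2 hq0) hq' hS
  have hbound : ∀ {C₀ : ℝ} {f : ℕ → ℝ → ℝ}, C₀ ≤ max C₁ C₂ →
      (∀ᶠ k in atTop, ∀ ξ, -S ≤ ξ → |f k ξ| ≤ C₀ * Real.exp (-(ξ / 2))) →
      ∀ᶠ k in atTop, ∀ x, 0 < x →
        |f k (s k + x)| ≤ max C₁ C₂ * Real.exp (S / 2) * Real.exp (-(x / 2)) := by
    intro C₀ f hC₀ hf
    filter_upwards [hf, hsS] with k hk hsk x hx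
    refine (hk _ (by linarith)).trans ?_
    rw [mul_assoc, ← Real.exp_add]
    have : 0 ≤ max C₁ C₂ := hC₁.le.trans (le_max_left _ _)
    gcongr
    linarith
  rw [TW_eq_hankelFredholm]
  refine (tendsto_hankelFredholm (C := max C₁ C₂ * Real.exp (S / 2))
    (φ := fun k x => scaledLaguerre (A k) (B k) (m k + 1) (n k) (s k + x))
    (ψ := fun k x => scaledLaguerre (B k) (A k) (n k + 1) (m k) (s k + x))
    (mul_pos (hC₁.trans_le (le_max_left _ _)) (Real.exp_pos _))
    (fun k => (continuous_scaledLaguerre _ _ _ _).comp (by fun_prop))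
    (fun k => (continuous_scaledLaguerre _ _ _ _).comp (by fun_prop))
    (hbound (le_max_left _ _) h₁) (hbound (le_max_right _ _) h₂)
    (fun x => tendsto_scaledLaguerre hA hB hA3 hB2 hBt hq0 hq (hs.add_const x))
    (fun x => tendsto_scaledLaguerre hB hA hB3 hA2 hAt (inv_pos.2 hq0) hq'
      (hs.add_const x))).congr fun k => ?_
  rw [hankelFredholm, ← (hasSum_det_residueSum_scaled (hA k) (hB k) (m k) (n k) (s k)).tsum_eq]
  rfl

end EdgeLimit

section Parameters

open Asymptotics

lemma natCast_rpow_one_third_isLittleO :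
    (fun N : ℕ => (N : ℝ) ^ ((1 : ℝ) / 3)) =o[atTop] fun N : ℕ => (N : ℝ) := by
  refine isLittleO_of_tendsto' ?_ ?_
  · filter_upwards [eventually_gt_atTop 0] with N hN h
    exact absurd h (Nat.cast_ne_zero.2 hN.ne')
  · refine ((tendsto_rpow_neg_atTop (by norm_num : (0 : ℝ) < 2 / 3)).comp
      tendsto_natCast_atTop_atTop).congr' ?_
    filter_upwards [eventually_gt_atTop 0] with N hN
    have : (0 : ℝ) < N := Nat.cast_pos.2 hN
    rw [Function.comp_apply, ← Real.rpow_sub_one this.ne']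
    congr 1
    norm_num

variable {γ : ℝ} {M : ℕ → ℕ} {d : ℕ → ℝ}

lemma tendsto_div_of_sub_isBigO
    (ha : (fun N : ℕ => (M N : ℝ) - γ * N) =O[atTop] fun N : ℕ => (N : ℝ) ^ ((1 : ℝ) / 3)) :
    Tendsto (fun N : ℕ => (M N : ℝ) / N) atTop (nhds γ) := by
  have h := (ha.trans_isLittleO natCast_rpow_one_third_isLittleO).tendsto_div_nhds_zero
  rw [← zero_add γ]
  refine (h.add_const γ).congr' ?_
  filter_upwards [eventually_gt_atTop 0] with N hN
  have : (N : ℝ) ≠ 0 := Nat.cast_ne_zero.2 hN.ne'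
  field_simp
  ring

lemma tendsto_sqrt_div_sqrt
    (ha : (fun N : ℕ => (M N : ℝ) - γ * N) =O[atTop] fun N : ℕ => (N : ℝ) ^ ((1 : ℝ) / 3)) :
    Tendsto (fun N : ℕ => √(M N : ℝ) / √(N : ℝ)) atTop (nhds √γ) :=
  ((Real.continuous_sqrt.tendsto γ).comp (tendsto_div_of_sub_isBigO ha)).congr fun _ =>
    Real.sqrt_div (Nat.cast_nonneg _) _

lemma tendsto_edgeScale_div (hγ : 1 ≤ γ) (hM : ∀ N, 1 ≤ M N)
    (ha : (fun N : ℕ => (M N : ℝ) - γ * N) =O[atTop] fun N : ℕ => (N : ℝ) ^ ((1 : ℝ) / 3)) :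
    Tendsto (fun N : ℕ => edgeScale √(M N : ℝ) √(N : ℝ) / (N : ℝ) ^ ((1 : ℝ) / 3)) atTop
      (nhds (γ ^ (-(1 : ℝ) / 6) * (1 + √γ) ^ ((4 : ℝ) / 3))) := by
  have hγ0 : 0 < γ := one_pos.trans_le hγ
  have hg : 0 < √γ := Real.sqrt_pos.2 hγ0
  have hρ := tendsto_sqrt_div_sqrt ha
  have h := ((((hρ.const_add 1).pow 4).div hρ hg.ne').rpow_const (p := (1 : ℝ) / 3)
    (Or.inr (by norm_num)))
  have e : ((1 + √γ) ^ 4 / √γ) ^ ((1 : ℝ) / 3) = γ ^ (-(1 : ℝ) / 6) * (1 + √γ) ^ ((4 : ℝ) / 3) := by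
    rw [Real.div_rpow (by positivity) hg.le, ← Real.rpow_natCast, ← Real.rpow_mul (by positivity),
      Real.sqrt_eq_rpow, ← Real.rpow_mul hγ0.le, div_eq_mul_inv, ← Real.rpow_neg hγ0.le, mul_comm]
    norm_num
  rw [e] at h
  refine h.congr' ?_
  filter_upwards [eventually_gt_atTop 0] with N hN
  have hN0 : (0 : ℝ) < N := Nat.cast_pos.2 hN
  have hb : 0 < √(N : ℝ) := Real.sqrt_pos.2 hN0
  have ha : 0 < √(M N : ℝ) := Real.sqrt_pos.2 (Nat.cast_pos.2 (hM N))
  simp only [Pi.div_apply]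
  rw [edgeScale, ← Real.div_rpow (by positivity) hN0.le]
  congr 1
  nth_rewrite 5 [← Real.sq_sqrt hN0.le]
  field_simp
  ring

lemma centering_sub_isLittleO (hγ : 1 ≤ γ) (hM : ∀ N, 1 ≤ M N)
    (ha : (fun N : ℕ => (M N : ℝ) - γ * N) =O[atTop] fun N : ℕ => (N : ℝ) ^ ((1 : ℝ) / 3))
    (hd : (fun N : ℕ => d N - (1 + 1 / √γ) * ((M N : ℝ) - γ * N))
      =o[atTop] fun N : ℕ => (N : ℝ) ^ ((1 : ℝ) / 3)) :
    (fun N : ℕ => (1 + √γ) ^ 2 * N + d N - (√(M N : ℝ) + √(N : ℝ)) ^ 2)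
      =o[atTop] fun N : ℕ => (N : ℝ) ^ ((1 : ℝ) / 3) := by
  have hγ0 : 0 < γ := one_pos.trans_le hγ
  have hg : 0 < √γ := Real.sqrt_pos.2 hγ0
  have hρ := tendsto_sqrt_div_sqrt ha
  have h1 : (fun N : ℕ => 1 / √γ - 2 / (√(M N : ℝ) / √(N : ℝ) + √γ)) =o[atTop]
      fun _ : ℕ => (1 : ℝ) := by
    rw [isLittleO_one_iff]
    have := (((hρ.add_const √γ).inv₀ (by positivity)).const_mul 2).const_sub (1 / √γ)
    simp only [← div_eq_mul_inv] at this
    convert this using 2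
    field_simp
    ring
  have h2 := ha.mul_isLittleO h1
  simp only [mul_one] at h2
  refine (hd.add h2).congr' ?_ EventuallyEq.rfl
  filter_upwards [eventually_gt_atTop 0] with N hN
  have hN0 : (0 : ℝ) < N := Nat.cast_pos.2 hN
  have hb : 0 < √(N : ℝ) := Real.sqrt_pos.2 hN0
  have ha : 0 < √(M N : ℝ) := Real.sqrt_pos.2 (Nat.cast_pos.2 (hM N))
  have hb2 : √(N : ℝ) ^ 2 = N := Real.sq_sqrt hN0.le
  have ha2 : √(M N : ℝ) ^ 2 = M N := Real.sq_sqrt (Nat.cast_nonneg _)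
  have hg2 : √γ ^ 2 = γ := Real.sq_sqrt hγ0.le
  set a := √(M N : ℝ)
  set b := √(N : ℝ)
  set g := √γ
  rw [← ha2, ← hb2, ← hg2]
  have hs : a / b + g = (a + g * b) / b := by field_simp
  have hs0 : 0 < a + g * b := by positivity
  rw [hs, div_div_eq_mul_div]
  field_simp
  ring

lemma tendsto_edge_parameter (hγ : 1 ≤ γ) (hM : ∀ N, 1 ≤ M N)
    (ha : (fun N : ℕ => (M N : ℝ) - γ * N) =O[atTop] fun N : ℕ => (N : ℝ) ^ ((1 : ℝ) / 3))
    (hd : (fun N : ℕ => d N - (1 + 1 / √γ) * ((M N : ℝ) - γ * N))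
      =o[atTop] fun N : ℕ => (N : ℝ) ^ ((1 : ℝ) / 3)) (s : ℝ) :
    Tendsto (fun N : ℕ => ((1 + √γ) ^ 2 * N + d N + γ ^ (-(1 : ℝ) / 6) * (1 + √γ) ^ ((4 : ℝ) / 3)
      * (N : ℝ) ^ ((1 : ℝ) / 3) * s - (√(M N : ℝ) + √(N : ℝ)) ^ 2)
        / edgeScale √(M N : ℝ) √(N : ℝ)) atTop (nhds s) := by
  set w := γ ^ (-(1 : ℝ) / 6) * (1 + √γ) ^ ((4 : ℝ) / 3) with hw
  have hγ0 : 0 < γ := one_pos.trans_le hγ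
  have hw0 : 0 < w := by positivity
  have h := ((centering_sub_isLittleO hγ hM ha hd).tendsto_div_nhds_zero.add_const (w * s)).div
    (tendsto_edgeScale_div hγ hM ha) hw0.ne'
  rw [zero_add, ← hw, mul_div_cancel_left₀ _ hw0.ne'] at h
  refine h.congr' ?_
  filter_upwards [eventually_gt_atTop 0] with N hN
  have hN0 : (0 : ℝ) < N := Nat.cast_pos.2 hN
  have hσ := edgeScale_pos (Real.sqrt_pos.2 (Nat.cast_pos.2 (hM N))) (Real.sqrt_pos.2 hN0)
  have hc : 0 < (N : ℝ) ^ ((1 : ℝ) / 3) := by positivity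
  simp only [Pi.div_apply]
  field_simp
  ring

lemma eventually_threshold_nonneg
    (ha : (fun N : ℕ => (M N : ℝ) - γ * N) =O[atTop] fun N : ℕ => (N : ℝ) ^ ((1 : ℝ) / 3))
    (hd : (fun N : ℕ => d N - (1 + 1 / √γ) * ((M N : ℝ) - γ * N))
      =o[atTop] fun N : ℕ => (N : ℝ) ^ ((1 : ℝ) / 3)) (c : ℝ) :
    ∀ᶠ N : ℕ in atTop, 0 ≤ (1 + √γ) ^ 2 * N + d N + c * (N : ℝ) ^ ((1 : ℝ) / 3) := by
  have hdO : d =O[atTop] fun N : ℕ => (N : ℝ) ^ ((1 : ℝ) / 3) :=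
    (hd.isBigO.add (ha.const_mul_left (1 + 1 / √γ))).congr_left fun N => by ring
  have h := ((hdO.add ((isBigO_refl _ _).const_mul_left c)).trans_isLittleO
    natCast_rpow_one_third_isLittleO).bound one_pos
  filter_upwards [h] with N hN
  rw [one_mul, Real.norm_eq_abs, Real.norm_of_nonneg (Nat.cast_nonneg N)] at hN
  have h1 := neg_le_of_abs_le hN
  have h2 : (N : ℝ) ≤ (1 + √γ) ^ 2 * N := by
    refine le_mul_of_one_le_left (Nat.cast_nonneg N) ?_
    nlinarith [Real.sqrt_nonneg γ]
  linarith

end Parameters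

open Asymptotics in
/-- Fluctuations of `H(M_N, N)` with `M_N = γN + a_N`, `a_N = O(N^{1/3})`, and centering
`d_N` with `d_N − (1+1/√γ)a_N = o(N^{1/3})`:
`ℙ[(H(M_N,N) − (1+√γ)²N − d_N)/(γ^{−1/6}(1+√γ)^{4/3}N^{1/3}) ≤ s] → F(s)`. -/
theorem stmt8
    {Ω : Type*} [MeasurableSpace Ω] (ℙ : Measure Ω) [IsProbabilityMeasure ℙ]
    (u : ℕ × ℕ → Ω → ℝ)
    (hmeas : ∀ p, Measurable (u p))
    (hindep : ProbabilityTheory.iIndepFun u ℙ)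
    (hexp : ∀ p t, 0 ≤ t → ℙ {ω | u p ω ≤ t} = ENNReal.ofReal (1 - Real.exp (-t)))
    (γ : ℝ) (hγ : 1 ≤ γ)
    (M : ℕ → ℕ) (hM : ∀ N, 1 ≤ M N)
    (d : ℕ → ℝ)
    (ha : (fun N : ℕ => (M N : ℝ) - γ * N) =O[atTop] fun N : ℕ => (N : ℝ) ^ ((1 : ℝ) / 3))
    (hd : (fun N : ℕ => d N - (1 + 1 / Real.sqrt γ) * ((M N : ℝ) - γ * N))
        =o[atTop] fun N : ℕ => (N : ℝ) ^ ((1 : ℝ) / 3))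
    (s : ℝ) :
    Tendsto
      (fun N : ℕ =>
        (ℙ {ω | (lppSupR (fun p => u p ω) (M N) N - (1 + Real.sqrt γ) ^ 2 * N - d N) /
            (γ ^ (-(1 : ℝ) / 6) * (1 + Real.sqrt γ) ^ ((4 : ℝ) / 3)
              * (N : ℝ) ^ ((1 : ℝ) / 3)) ≤ s}).toReal)
      atTop (nhds (TW s)) := by
  have hγ0 : 0 < γ := one_pos.trans_le hγ
  have hg : 0 < √γ := Real.sqrt_pos.2 hγ0
  set w := γ ^ (-(1 : ℝ) / 6) * (1 + √γ) ^ ((4 : ℝ) / 3) with hw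
  have hw0 : 0 < w := by positivity
  set t : ℕ → ℝ := fun N => (1 + √γ) ^ 2 * N + d N + w * (N : ℝ) ^ ((1 : ℝ) / 3) * s with ht
  have ht0 : ∀ᶠ N in atTop, 0 ≤ t N := by
    filter_upwards [eventually_threshold_nonneg ha hd (w * s)] with N hN
    rwa [mul_right_comm] at hN
  have hcast : ∀ k, ((M (k + 1) - 1 : ℕ) : ℝ) + 1 = M (k + 1) := fun k => by
    exact_mod_cast Nat.sub_add_cancel (hM (k + 1))
  have hMt : Tendsto M atTop atTop := by
    have h := (tendsto_div_of_sub_isBigO ha).pos_mul_atTop hγ0 tendsto_natCast_atTop_atTop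
    refine tendsto_natCast_atTop_iff.1 (h.congr' ?_)
    filter_upwards [eventually_gt_atTop 0] with N hN
    exact div_mul_cancel₀ _ (Nat.cast_ne_zero.2 hN.ne')
  have key := tendsto_det_residueSum (m := fun k => M (k + 1) - 1) (n := fun k => k)
    ((tendsto_sub_atTop_nat 1).comp (hMt.comp (tendsto_add_atTop_nat 1))) tendsto_id
    (inv_pos.2 hg) (by
      refine (((tendsto_sqrt_div_sqrt ha).inv₀ hg.ne').comp (tendsto_add_atTop_nat 1)).congr
        fun k => ?_
      rw [hcast, Function.comp_apply, inv_div]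
      push_cast
      rfl)
    ((tendsto_edge_parameter hγ hM ha hd s).comp (tendsto_add_atTop_nat 1))
  refine (tendsto_add_atTop_iff_nat 1).1 (key.congr' ?_)
  filter_upwards [(tendsto_add_atTop_nat 1).eventually ht0] with k hk
  have hN0 : (0 : ℝ) < (k + 1 : ℕ) := Nat.cast_pos.2 k.succ_pos
  have hσ := edgeScale_pos (Real.sqrt_pos.2 (Nat.cast_pos.2 (hM (k + 1)))) (Real.sqrt_pos.2 hN0)
  have hset : {ω | (lppSupR (fun p => u p ω) (M (k + 1)) (k + 1) - (1 + √γ) ^ 2 * (k + 1 : ℕ)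
      - d (k + 1)) / (w * ((k + 1 : ℕ) : ℝ) ^ ((1 : ℝ) / 3)) ≤ s}
      = {ω | lppSupR (fun p => u p ω) (M (k + 1)) (k + 1) ≤ t (k + 1)} := by
    ext ω
    have hc : 0 < w * ((k + 1 : ℕ) : ℝ) ^ ((1 : ℝ) / 3) := by positivity
    simp only [Set.mem_ofPred_eq, ht]
    rw [div_le_iff₀ hc]
    constructor <;> intro h <;> linarith
  rw [hset, toReal_measure_lppSupR_le hmeas hindep hexp (hM (k + 1)) k.succ_pos hk]
  rw [hcast, Nat.sub_add_cancel (hM (k + 1)), ← Nat.cast_succ, Function.comp_apply,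
    mul_div_cancel₀ _ hσ.ne', add_sub_cancel]
end

section
/- For every A = (a_{ij}) ∈ ℳ_{M,N}^k, the maximum of Σ_{(i,j)∈π} a_{ij} over all up/right paths π ∈ Π_{M,N} equals ℓ(f^{−1}(A)), the length of a longest increasing subsequence of the generalized permutation corresponding to A. -/
theorem UpRightPath.fst_add_snd {M N : ℕ} {π : ℕ → ℕ × ℕ} (h : UpRightPath M N π) {l : ℕ}
    (hl : l ≤ M + N - 2) : (π l).1 + (π l).2 = l + 2 := by
  induction l with
  | zero => simp [h.1]
  | succ l ih =>
    have := ih (by omega)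
    rcases h.2.2 l (by omega) with h | h <;> rw [h] <;> simp only <;> omega

theorem UpRightPath.le_of_le {M N : ℕ} {π : ℕ → ℕ × ℕ} (h : UpRightPath M N π) {l l' : ℕ}
    (hll : l ≤ l') (hl : l' ≤ M + N - 2) : π l ≤ π l' := by
  induction l', hll using Nat.le_induction with
  | base => exact le_rfl
  | succ l' _ ih =>
    refine (ih (by omega)).trans ?_
    rcases h.2.2 l' (by omega) with h | h <;> rw [h, Prod.le_def] <;> simp

/-- A path to `(M, N)` followed by one more step, from `(M, N)` to `q`. -/
theorem UpRightPath.exists_snoc {M N M' N' : ℕ} {π : ℕ → ℕ × ℕ} (h : UpRightPath M N π)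
    (hM : 1 ≤ M) (hN : 1 ≤ N)
    (hq : (M', N') = (M + 1, N) ∨ (M', N') = (M, N + 1)) :
    ∃ π', UpRightPath M' N' π' ∧ ∀ l ≤ M + N - 2, π' l = π l := by
  have hsum : M' + N' - 2 = M + N - 2 + 1 := by
    simp only [Prod.mk.injEq] at hq
    omega
  refine ⟨fun l => if l ≤ M + N - 2 then π l else (M', N'), ⟨?_, ?_, ?_⟩, ?_⟩
  · simp [h.1]
  · simp [hsum]
  · intro l hl
    rcases Nat.lt_or_ge l (M + N - 2) with hl' | hl'
    · have h1 : l + 1 ≤ M + N - 2 := hl'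
      simpa [h1, hl'.le] using h.2.2 l hl'
    · have h1 : l = M + N - 2 := by omega
      subst h1
      simpa [h.2.1] using hq
  · intro l hl
    simp [hl]

/-- Every chain in the rectangle `[1, M] × [1, N]` lies on an up/right path. -/
theorem exists_upRightPath_of_isChain (M N : ℕ) (hM : 1 ≤ M) (hN : 1 ≤ N) (C : Set (ℕ × ℕ))
    (hC : IsChain (· ≤ ·) C) (hbd : ∀ p ∈ C, (1, 1) ≤ p ∧ p ≤ (M, N)) :
    ∃ π, UpRightPath M N π ∧ ∀ p ∈ C, ∃ l ≤ M + N - 2, π l = p := by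
  induction hn : M + N generalizing M N C with
  | zero => omega
  | succ n ih =>
    rw [← hn]
    have extend : ∀ M₀ N₀, 1 ≤ M₀ → 1 ≤ N₀ →
        ((M, N) = (M₀ + 1, N₀) ∨ (M, N) = (M₀, N₀ + 1)) →
        (∀ i j, (i, j) ∈ C → ¬(i = M ∧ j = N) → i ≤ M₀ ∧ j ≤ N₀) →
        ∃ π, UpRightPath M N π ∧ ∀ p ∈ C, ∃ l ≤ M + N - 2, π l = p := by
      intro M₀ N₀ hM₀ hN₀ hstep hle
      have hsum : M + N = M₀ + N₀ + 1 := by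
        simp only [Prod.mk.injEq] at hstep
        omega
      obtain ⟨π, hπ, hcov⟩ := ih M₀ N₀ hM₀ hN₀ (C \ {(M, N)}) (hC.mono Set.sdiff_subset)
        (fun p hp => ⟨(hbd p hp.1).1, hle p.1 p.2 hp.1 fun h => hp.2 (Prod.ext h.1 h.2)⟩) (by omega)
      obtain ⟨π', hπ', heq⟩ := hπ.exists_snoc hM₀ hN₀ hstep
      refine ⟨π', hπ', fun p hp => ?_⟩
      by_cases hpe : p = (M, N)
      · exact ⟨M + N - 2, le_rfl, hpe ▸ hπ'.2.1⟩
      · obtain ⟨l, hl, rfl⟩ := hcov p ⟨hp, hpe⟩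
        exact ⟨l, by omega, heq l (by omega)⟩
    simp only [Prod.mk.injEq] at extend
    simp only [Prod.forall, Prod.mk_le_mk] at hbd
    rcases Nat.lt_or_ge 1 M with hM1 | hM1
    · by_cases hcol : ∀ i j, (i, j) ∈ C → i = M → j = N
      · refine extend (M - 1) N (by omega) hN (by omega) fun i j hp hne => ?_
        have := hbd i j hp
        have := hcol i j hp
        omega
      · push Not at hcol
        obtain ⟨i, j, hp, rfl, hj⟩ := hcol
        have hpb := hbd i j hp
        refine extend i (N - 1) hM (by omega) (by omega) fun i' j' hp' hne => ?_
        have := hbd i' j' hp'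
        have := hC.total hp hp'
        simp only [Prod.mk_le_mk] at this
        omega
    · rcases Nat.lt_or_ge 1 N with hN1 | hN1
      · refine extend M (N - 1) hM (by omega) (by omega) fun i j hp hne => ?_
        have := hbd i j hp
        omega
      · obtain rfl : M = 1 := by omega
        obtain rfl : N = 1 := by omega
        refine ⟨fun _ => (1, 1), ⟨rfl, rfl, fun l hl => by omega⟩, fun p hp => ⟨0, by omega, ?_⟩⟩
        have := hbd p.1 p.2 hp
        ext <;> simp only <;> omega

/-- The weight of a path counts the columns of `σ` whose site lies on the path. -/
theorem UpRightPath.sum_card_eq {M N : ℕ} {π : ℕ → ℕ × ℕ} (h : UpRightPath M N π)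
    {ι : Type*} [Fintype ι] (σ : ι → ℕ × ℕ) :
    ∑ l ∈ Finset.range (M + N - 1), (Finset.univ.filter fun r => σ r = π l).card =
      (Finset.univ.filter fun r => σ r ∈ (Finset.range (M + N - 1)).image π).card := by
  classical
  rw [← Finset.card_biUnion]
  · congr 1
    ext r
    simp [eq_comm]
  · intro l hl l' hl' hne
    rw [Function.onFun, Finset.disjoint_filter]
    intro r _ hr hr'
    simp only [Finset.coe_range, Set.mem_Iio] at hl hl'
    have h1 := h.fst_add_snd (l := l) (by omega)
    have h2 := h.fst_add_snd (l := l') (by omega)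
    rw [← hr] at h1
    rw [← hr'] at h2
    omega

/-- Lemma 2.1: for a generalized permutation `σ` (columns lexicographically ordered, rows in
`{1,…,M}` and `{1,…,N}`) with associated matrix `A = f(σ)`, `a_{ij} = #{r : σ r = (i,j)}`,
the maximum over up/right paths `π ∈ Π_{M,N}` of `Σ_{(i,j)∈π} a_{ij}` equals `ℓ(σ)`, the
length of a longest increasing subsequence of `σ`. -/
theorem stmt10 (M N k : ℕ) (hM : 1 ≤ M) (hN : 1 ≤ N)
    (σ : Fin k → ℕ × ℕ)
    (hrange : ∀ r, 1 ≤ (σ r).1 ∧ (σ r).1 ≤ M ∧ 1 ≤ (σ r).2 ∧ (σ r).2 ≤ N)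
    (hlex : ∀ r s : Fin k, r < s →
      (σ r).1 < (σ s).1 ∨ ((σ r).1 = (σ s).1 ∧ (σ r).2 ≤ (σ s).2)) :
    sSup {m | ∃ π : ℕ → ℕ × ℕ, UpRightPath M N π ∧
        m = ∑ l ∈ Finset.range (M + N - 1),
          (Finset.univ.filter fun r : Fin k => σ r = π l).card} =
    sSup {m | ∃ ρ : Fin m → Fin k, StrictMono ρ ∧ Monotone fun a => (σ (ρ a)).2} := by
  have hbdd : BddAbove {m | ∃ ρ : Fin m → Fin k,
      StrictMono ρ ∧ Monotone fun a => (σ (ρ a)).2} := by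
    refine ⟨k, ?_⟩
    rintro m ⟨ρ, hρ, -⟩
    simpa using Fintype.card_le_of_injective ρ hρ.injective
  have hsub : {m | ∃ π : ℕ → ℕ × ℕ, UpRightPath M N π ∧
        m = ∑ l ∈ Finset.range (M + N - 1),
          (Finset.univ.filter fun r : Fin k => σ r = π l).card} ⊆
      {m | ∃ ρ : Fin m → Fin k, StrictMono ρ ∧ Monotone fun a => (σ (ρ a)).2} := by
    rintro m ⟨π, hπ, hm⟩
    rw [hπ.sum_card_eq] at hm
    set S := Finset.univ.filter fun r : Fin k => σ r ∈ (Finset.range (M + N - 1)).image π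
    refine ⟨S.orderEmbOfFin hm.symm, (S.orderEmbOfFin hm.symm).strictMono, fun a b hab => ?_⟩
    have hmem : ∀ c, ∃ l ≤ M + N - 2, π l = σ (S.orderEmbOfFin hm.symm c) := by
      intro c
      have hc := S.orderEmbOfFin_mem hm.symm c
      obtain ⟨l, hl, hl'⟩ := Finset.mem_image.1 (Finset.mem_filter.1 hc).2
      exact ⟨l, by rw [Finset.mem_range] at hl; omega, hl'⟩
    obtain ⟨l, hl, hla⟩ := hmem a
    obtain ⟨l', hl', hlb⟩ := hmem b
    rcases hab.eq_or_lt with rfl | hlt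
    · exact le_rfl
    · have hlex' := hlex _ _ ((S.orderEmbOfFin hm.symm).strictMono hlt)
      rw [← hla, ← hlb] at hlex'
      simp only [← hla, ← hlb]
      rcases le_total l l' with hll | hll
      · exact (hπ.le_of_le hll hl').2
      · have := (hπ.le_of_le hll hl).1
        omega
  apply le_antisymm
  · obtain ⟨π, hπ, -⟩ := exists_upRightPath_of_isChain M N hM hN ∅ IsChain.empty (by simp)
    exact csSup_le_csSup hbdd ⟨_, π, hπ, rfl⟩ hsub
  · refine csSup_le ⟨0, Fin.elim0, fun a => a.elim0, fun a => a.elim0⟩ ?_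
    rintro m ⟨ρ, hρ, hmono⟩
    have hmono' : Monotone fun a => σ (ρ a) := by
      intro a b hab
      refine ⟨?_, hmono hab⟩
      rcases hab.eq_or_lt with rfl | hlt
      · exact le_rfl
      · have := hlex _ _ (hρ hlt)
        simp only
        omega
    obtain ⟨π, hπ, hcov⟩ := exists_upRightPath_of_isChain M N hM hN
      (Set.range fun a => σ (ρ a)) hmono'.isChain_range (by
        rintro _ ⟨a, rfl⟩
        obtain ⟨h1, h2, h3, h4⟩ := hrange (ρ a)
        exact ⟨⟨h1, h3⟩, ⟨h2, h4⟩⟩)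
    refine le_trans ?_ (le_csSup (hbdd.mono hsub) ⟨π, hπ, rfl⟩)
    rw [hπ.sum_card_eq]
    calc m = (Finset.univ.image ρ).card := by
          rw [Finset.card_image_of_injective _ hρ.injective, Finset.card_fin]
      _ ≤ _ := Finset.card_le_card fun r hr => by
          obtain ⟨a, -, rfl⟩ := Finset.mem_image.1 hr
          obtain ⟨l, hl, hla⟩ := hcov _ ⟨a, rfl⟩
          rw [Finset.mem_filter, Finset.mem_image]
          exact ⟨Finset.mem_univ _, l, by rw [Finset.mem_range]; omega, hla⟩
end
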